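/- Let n ≥ 4 and let μ be an (n−1)-asymptotically optimally doubling Radon measure on ℝⁿ with Σ = supp μ. Then ϑ^C_Σ(x,r) → 0 as r ↓ 0, uniformly for x in compact subsets of Σ (equivalently, min(ϑ^C_Σ(x,r), θ^P_Σ(x,r)) → 0 uniformly on compact subsets of Σ). Moreover, if x ∈ Σ is a nonflat point, then θ^C_Σ(x,r) → 0 as r ↓ 0. -/

import Mathlib

open Metric Set MeasureTheory Filter Module
open scoped RealInnerProductSpace Topology Pointwise ENNReal

noncomputable section

/-- `ℝⁿ` as a Euclidean space. -/
abbrev E (n : ℕ) : Type := EuclideanSpace ℝ (Fin n)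

/-- `d(A,B) = sup_{a ∈ A} inf_{b ∈ B} |a - b|`. -/
def setD {n : ℕ} (A B : Set (E n)) : ℝ := ⨆ a ∈ A, Metric.infDist a B

/-- `d^{x,r}(A,B) = (1/r) d(A ∩ B(x,r), B ∩ B(x,r))`. -/
def dxr {n : ℕ} (x : E n) (r : ℝ) (A B : Set (E n)) : ℝ :=
  (1 / r) * setD (A ∩ closedBall x r) (B ∩ closedBall x r)

/-- `D^{x,r}(A,B) = max(d^{x,r}(A,B), d^{x,r}(B,A))`. -/
def Dxr {n : ℕ} (x : E n) (r : ℝ) (A B : Set (E n)) : ℝ :=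
  max (dxr x r A B) (dxr x r B A)

/-- `d̃^{x,r}(A,B) = (1/r) d(A ∩ B(x,r), B)`. -/
def dtxr {n : ℕ} (x : E n) (r : ℝ) (A B : Set (E n)) : ℝ :=
  (1 / r) * setD (A ∩ closedBall x r) B

/-- `D̃^{x,r}(A,B) = max(d̃^{x,r}(A,B), d̃^{x,r}(B,A))`. -/
def Dtxr {n : ℕ} (x : E n) (r : ℝ) (A B : Set (E n)) : ℝ :=
  max (dtxr x r A B) (dtxr x r B A)

/-- `C` is a cone based at `y`: `y ∈ C` and `s • (C − y) = C − y` for all `s > 0`. -/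
def IsConeAt {n : ℕ} (y : E n) (C : Set (E n)) : Prop :=
  y ∈ C ∧ ∀ s : ℝ, 0 < s → s • {z : E n | y + z ∈ C} = {z : E n | y + z ∈ C}

/-- The standard KP cone `{x₄² = x₁² + x₂² + x₃²}` in `ℝⁿ`, `n ≥ 4`. -/
def stdKP (n : ℕ) (hn : 4 ≤ n) : Set (E n) :=
  {x : E n | (x ⟨3, by omega⟩) ^ 2 =
    (x ⟨0, by omega⟩) ^ 2 + (x ⟨1, by omega⟩) ^ 2 + (x ⟨2, by omega⟩) ^ 2}

/-- `C` is a KP cone based at `y`: in some orthonormal coordinates centered at the origin,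
`C − y` is the standard KP cone. -/
def IsKPCone {n : ℕ} (hn : 4 ≤ n) (y : E n) (C : Set (E n)) : Prop :=
  ∃ f : E n ≃ₗᵢ[ℝ] E n, {z : E n | y + z ∈ C} = f ⁻¹' stdKP n hn

/-- `θ^P_Σ(x,r)` : best approximation of `S` in `B(x,r)` by affine `m`-planes through `x`. -/
def thetaP {n : ℕ} (m : ℕ) (S : Set (E n)) (x : E n) (r : ℝ) : ℝ :=
  ⨅ L : {L : AffineSubspace ℝ (E n) // x ∈ L ∧ Module.finrank ℝ L.direction = m},
    Dxr x r S (L.1 : Set (E n))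

/-- `θ^C_Σ(x,r)` : best approximation of `S` in `B(x,r)` by KP cones based at `x`. -/
def thetaC {n : ℕ} (hn : 4 ≤ n) (S : Set (E n)) (x : E n) (r : ℝ) : ℝ :=
  ⨅ C : {C : Set (E n) // IsKPCone hn x C}, Dxr x r S C.1

/-- `ϑ^C_Σ(x,r)` : best approximation of `S` in `B(x,r)` by KP cones containing `x`. -/
def varthetaC {n : ℕ} (hn : 4 ≤ n) (S : Set (E n)) (x : E n) (r : ℝ) : ℝ :=
  ⨅ C : {C : Set (E n) // (∃ y, IsKPCone hn y C) ∧ x ∈ C}, Dxr x r S C.1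

/-- The angle `∠(P₁,P₂) = arcsin Γ(P₁,P₂)` between two affine planes. -/
def planeAngle {n : ℕ} (P₁ P₂ : AffineSubspace ℝ (E n)) : ℝ :=
  Real.arcsin (dxr (0 : E n) 1 (P₁.direction : Set (E n)) (P₂.direction : Set (E n)))

/-- The support of a measure. -/
def msupp {n : ℕ} (μ : Measure (E n)) : Set (E n) :=
  {x : E n | ∀ r : ℝ, 0 < r → 0 < μ (closedBall x r)}

/-- Weak convergence of a sequence of measures in the sense of Radon measures. -/
def VagueTendsto {n : ℕ} (μs : ℕ → Measure (E n)) (ν : Measure (E n)) : Prop :=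
  ∀ f : E n → ℝ, Continuous f → HasCompactSupport f →
    Tendsto (fun i => ∫ y, f y ∂(μs i)) atTop (nhds (∫ y, f y ∂ν))

/-- `ν` is a tangent measure of `μ` at `x`: `ν ≠ 0` and for some `rᵢ ↓ 0`, `cᵢ > 0`,
`cᵢ (T_{x,rᵢ})₊μ → ν` weakly. -/
def IsTangentMeasure {n : ℕ} (μ ν : Measure (E n)) (x : E n) : Prop :=
  ν ≠ 0 ∧ ∃ r c : ℕ → ℝ, (∀ i, 0 < r i) ∧ Tendsto r atTop (nhds 0) ∧ (∀ i, 0 < c i) ∧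
    VagueTendsto (fun i => ENNReal.ofReal (c i) • Measure.map (fun y => (r i)⁻¹ • (y - x)) μ) ν

/-- `μ` is `m`-asymptotically optimally doubling. -/
def AOD {n : ℕ} (m : ℕ) (μ : Measure (E n)) : Prop :=
  ∀ K : Set (E n), K ⊆ msupp μ → IsCompact K → ∀ δ : ℝ, 0 < δ →
    ∃ r₀ : ℝ, 0 < r₀ ∧ ∀ x ∈ K, ∀ r : ℝ, 0 < r → r ≤ r₀ →
      ∀ τ : ℝ, τ ∈ Set.Icc (1/2 : ℝ) 1 →
        |(μ (closedBall x (τ * r))).toReal / (μ (closedBall x r)).toReal - τ ^ m| < δ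

/-- `ν` is `m`-flat: `m`-dimensional Hausdorff measure restricted to an affine `m`-plane. -/
def IsFlatMeasure {n : ℕ} (m : ℕ) (ν : Measure (E n)) : Prop :=
  ∃ L : AffineSubspace ℝ (E n), (L : Set (E n)).Nonempty ∧
    Module.finrank ℝ L.direction = m ∧
    ν = (Measure.hausdorffMeasure (m : ℝ)).restrict (L : Set (E n))

/-- Volume of the unit ball in `ℝᵐ`. -/
def unitBallVol (m : ℕ) : ℝ := (volume (Metric.ball (0 : EuclideanSpace ℝ (Fin m)) 1)).toReal

/-- `ω₃`, the volume of the unit `3`-ball. -/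
def omega3 : ℝ := unitBallVol 3

/-- The second moment `Q_{0,r}` of a measure on `ℝ⁴`. -/
def Qmom (μ : Measure (E 4)) (r : ℝ) (z : E 4) : ℝ :=
  (5 / (omega3 * r ^ 5)) * ∫ w in closedBall (0 : E 4) r, ⟪z, w⟫ ^ 2 ∂μ

/-- Entries `q_{ij}` of the second moment matrix in given directions. -/
def qmom (μ : Measure (E 4)) (r : ℝ) (u v : E 4) : ℝ :=
  (5 / (omega3 * r ^ 5)) * ∫ w in closedBall (0 : E 4) r, ⟪u, w⟫ * ⟪v, w⟫ ∂μ

/-- `μ` is `(α,m)`-Hölder asymptotically uniform. -/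
def HolderAsympUniform {n : ℕ} (α : ℝ) (m : ℕ) (μ : Measure (E n)) : Prop :=
  ∀ K : Set (E n), K ⊆ msupp μ → IsCompact K →
    ∃ C r₀ : ℝ, 0 < r₀ ∧ ∀ x ∈ K, ∀ r : ℝ, 0 < r → r ≤ r₀ →
      |(μ (closedBall x r)).toReal / (unitBallVol m * r ^ m) - 1| ≤ C * r ^ α

/-- `φ` is a `C^{1,β}` diffeomorphism from `U` onto `U'`: a continuously differentiable bijection
with `β`-Hölder derivative whose inverse is also `C^{1,β}`. -/
def IsC1HolderDiffeoOn (β : ℝ) (U U' : Set (E 4)) (φ : E 4 → E 4) : Prop :=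
  Set.BijOn φ U U' ∧
  (∀ x ∈ U, HasFDerivAt φ (fderiv ℝ φ x) x) ∧
  (∃ M : ℝ, ∀ x ∈ U, ∀ y ∈ U, ‖fderiv ℝ φ x - fderiv ℝ φ y‖ ≤ M * ‖x - y‖ ^ β) ∧
  ∃ ψ : E 4 → E 4, Set.BijOn ψ U' U ∧
    (∀ x ∈ U, ψ (φ x) = x) ∧ (∀ y ∈ U', φ (ψ y) = y) ∧
    (∀ y ∈ U', HasFDerivAt ψ (fderiv ℝ ψ y) y) ∧
    (∃ M : ℝ, ∀ x ∈ U', ∀ y ∈ U', ‖fderiv ℝ ψ x - fderiv ℝ ψ y‖ ≤ M * ‖x - y‖ ^ β)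


section

lemma msupp_eq_support {n : ℕ} (ν : Measure (E n)) : msupp ν = ν.support := by
  ext x
  rw [(nhds_basis_closedBall (x := x)).mem_measureSupport]
  rfl

lemma msupp_closed {n : ℕ} (ν : Measure (E n)) : IsClosed (msupp ν) := by
  rw [msupp_eq_support]; exact Measure.isClosed_support

lemma msupp_ae {n : ℕ} (ν : Measure (E n)) : ∀ᵐ x ∂ν, x ∈ msupp ν := by
  rw [msupp_eq_support]; exact Measure.support_mem_ae

lemma msupp_subset {n : ℕ} (ν : Measure (E n)) {F : Set (E n)} (hF : IsClosed F)
    (h : ∀ᵐ x ∂ν, x ∈ F) : msupp ν ⊆ F := by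
  rw [msupp_eq_support]; exact Measure.support_subset_of_isClosed hF h

/-- `m`-uniform measures (normalised). -/
def IsUnif {n : ℕ} (m : ℕ) (ν : Measure (E n)) : Prop :=
  ∀ x ∈ msupp ν, ∀ r : ℝ, 0 < r → ν (closedBall x r) = ENNReal.ofReal (r ^ m)

lemma IsUnif.locfin {n m : ℕ} {ν : Measure (E n)} (h : IsUnif m ν) :
    IsLocallyFiniteMeasure ν := by
  constructor
  intro y
  by_cases hy : y ∈ msupp ν
  · exact ⟨closedBall y 1, closedBall_mem_nhds y one_pos, by
      rw [h y hy 1 one_pos]; exact ENNReal.ofReal_lt_top⟩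
  · simp only [msupp, mem_ofPred_eq, not_forall] at hy
    obtain ⟨r, hr, h0⟩ := hy
    refine ⟨closedBall y r, closedBall_mem_nhds y hr, ?_⟩
    simp only [not_lt, nonpos_iff_eq_zero] at h0
    rw [h0]; exact ENNReal.zero_lt_top

/-- radial law -/
def radM (m : ℕ) : Measure ℝ :=
  (volume.restrict (Ioi (0:ℝ))).withDensity (fun r => ENNReal.ofReal (m * r ^ (m - 1)))

lemma radM_Iic_nonneg {m : ℕ} (hm : 1 ≤ m) {b : ℝ} (hb : 0 ≤ b) :
    radM m (Iic b) = ENNReal.ofReal (b ^ m) := by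
  rw [radM, withDensity_apply _ measurableSet_Iic, Measure.restrict_restrict measurableSet_Iic,
    Set.inter_comm, Ioi_inter_Iic, ← ofReal_integral_eq_lintegral_ofReal]
  · rw [← intervalIntegral.integral_of_le hb]
    congr 1
    rw [intervalIntegral.integral_const_mul, integral_pow]
    have : (m - 1 + 1) = m := by omega
    rw [this]
    have h1 : ((m - 1 : ℕ) : ℝ) + 1 = m := by exact_mod_cast this
    rw [h1]
    have : (m:ℝ) ≠ 0 := by positivity
    field_simp
    rw [zero_pow (by omega)]; ring
  · exact (Continuous.integrableOn_Icc (by fun_prop)).mono_set Ioc_subset_Icc_self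
  · filter_upwards [ae_restrict_mem measurableSet_Ioc] with x hx
    have := hx.1.le
    positivity

lemma radM_Iic_neg {m : ℕ} {b : ℝ} (hb : b < 0) : radM m (Iic b) = 0 := by
  rw [radM, withDensity_apply _ measurableSet_Iic, Measure.restrict_restrict measurableSet_Iic]
  have : Iic b ∩ Ioi 0 = ∅ := by
    ext x; simp only [mem_inter_iff, mem_Iic, mem_Ioi, mem_empty_iff_false, iff_false]
    intro h; linarith [h.1, h.2]
  rw [this]; simp

lemma IsUnif.map_norm {n m : ℕ} (hm : 1 ≤ m) {ν : Measure (E n)} (h : IsUnif m ν) {x : E n}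
    (hx : x ∈ msupp ν) {ε : ℝ} (hε : 0 < ε) :
    ν.map (fun w => ε * ‖w - x‖) = ENNReal.ofReal ((ε ^ m)⁻¹) • radM m := by
  have hmeas : Measurable (fun w : E n => ε * ‖w - x‖) := by fun_prop
  have key : ∀ b, ν.map (fun w => ε * ‖w - x‖) (Iic b) =
      (ENNReal.ofReal ((ε ^ m)⁻¹) • radM m) (Iic b) := by
    intro b
    rw [Measure.map_apply hmeas measurableSet_Iic]
    rcases lt_trichotomy b 0 with hb | hb | hb
    · rw [Measure.smul_apply, radM_Iic_neg hb]
      have : (fun w : E n => ε * ‖w - x‖) ⁻¹' Iic b = ∅ := by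
        ext w; simp only [mem_preimage, mem_Iic, mem_empty_iff_false, iff_false, not_le]
        have : 0 ≤ ε * ‖w - x‖ := by positivity
        linarith
      rw [this]; simp
    · subst hb
      rw [Measure.smul_apply, radM_Iic_nonneg hm le_rfl, zero_pow (by omega)]
      simp only [ENNReal.ofReal_zero, smul_zero]
      have h1 : ∀ r : ℝ, 0 < r → ν ((fun w : E n => ε * ‖w - x‖) ⁻¹' Iic 0) ≤
          ENNReal.ofReal (r ^ m) := by
        intro r hr
        rw [← h x hx r hr]
        apply measure_mono
        intro w hw
        simp only [mem_preimage, mem_Iic] at hw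
        rw [mem_closedBall, dist_eq_norm]
        have : ‖w - x‖ ≤ 0 := by
          by_contra hc
          push Not at hc
          have := mul_pos hε hc
          linarith
        linarith
      have h2 : Tendsto (fun r : ℝ => ENNReal.ofReal (r ^ m)) (𝓝[>] 0) (𝓝 0) := by
        have : Tendsto (fun r : ℝ => ENNReal.ofReal (r ^ m)) (𝓝 0) (𝓝 (ENNReal.ofReal (0 ^ m))) :=
          (ENNReal.continuous_ofReal.comp (continuous_pow m)).tendsto 0
        rw [zero_pow (by omega), ENNReal.ofReal_zero] at this
        exact this.mono_left nhdsWithin_le_nhds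
      exact le_antisymm (ge_of_tendsto h2 (eventually_nhdsWithin_of_forall h1)) zero_le
    · rw [Measure.smul_apply, radM_Iic_nonneg hm hb.le]
      have : (fun w : E n => ε * ‖w - x‖) ⁻¹' Iic b = closedBall x (b / ε) := by
        ext w
        simp only [mem_preimage, mem_Iic, mem_closedBall, dist_eq_norm]
        rw [le_div_iff₀ hε, mul_comm]
      rw [this, h x hx _ (by positivity), smul_eq_mul, ← ENNReal.ofReal_mul (by positivity)]
      congr 1
      rw [div_pow]; ring
  have fin : ∀ b, (ENNReal.ofReal ((ε ^ m)⁻¹) • radM m) (Iic b) ≠ ∞ := by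
    intro b
    rw [Measure.smul_apply, smul_eq_mul]
    apply ENNReal.mul_ne_top ENNReal.ofReal_ne_top
    rcases lt_or_ge b 0 with hb | hb
    · rw [radM_Iic_neg hb]; simp
    · rw [radM_Iic_nonneg hm hb]; exact ENNReal.ofReal_ne_top
  apply Measure.ext_of_Ioc'
  · intro a b _
    refine ne_top_of_le_ne_top (fin b) ?_
    rw [← key]; exact measure_mono Ioc_subset_Iic_self
  · intro a b hab
    rw [← Iic_sdiff_Iic, measure_sdiff (Iic_subset_Iic.2 hab.le) nullMeasurableSet_Iic (by
      rw [key]; exact fin a), measure_sdiff (Iic_subset_Iic.2 hab.le) nullMeasurableSet_Iic (fin a),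
      key, key]

lemma IsUnif.integrable_rad {n m : ℕ} (hm : 1 ≤ m) {ν : Measure (E n)} (h : IsUnif m ν) {x : E n}
    (hx : x ∈ msupp ν) {ε : ℝ} (hε : 0 < ε) {g : ℝ → ℝ} (hg : Integrable g (radM m)) :
    Integrable (fun w => g (ε * ‖w - x‖)) ν := by
  have h1 : Integrable g (ν.map (fun w => ε * ‖w - x‖)) := by
    rw [h.map_norm hm hx hε]; exact hg.smul_measure ENNReal.ofReal_ne_top
  exact h1.comp_measurable (by fun_prop)

lemma IsUnif.integral_rad {n m : ℕ} (hm : 1 ≤ m) {ν : Measure (E n)} (h : IsUnif m ν) {x : E n}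
    (hx : x ∈ msupp ν) {ε : ℝ} (hε : 0 < ε) {g : ℝ → ℝ} (hg : Continuous g) :
    ∫ w, g (ε * ‖w - x‖) ∂ν = (ε ^ m)⁻¹ * ∫ r, g r ∂(radM m) := by
  rw [← integral_map (φ := fun w => ε * ‖w - x‖) (f := g) (by fun_prop)
    hg.aestronglyMeasurable, h.map_norm hm hx hε, integral_smul_measure,
    ENNReal.toReal_ofReal (by positivity)]
  rfl

lemma radM_integrable_iff {m : ℕ} {g : ℝ → ℝ} : Integrable g (radM m) ↔
    IntegrableOn (fun r => (m * r ^ (m - 1)) * g r) (Ioi 0) := by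
  rw [radM, integrable_withDensity_iff_integrable_smul' (by fun_prop) (Eventually.of_forall fun _ => ENNReal.ofReal_lt_top)]
  unfold IntegrableOn
  apply integrable_congr
  filter_upwards [ae_restrict_mem measurableSet_Ioi] with x hx
  have hx' : (0:ℝ) < x := hx
  rw [ENNReal.toReal_ofReal (by positivity), smul_eq_mul]

lemma radM_integral {m : ℕ} (g : ℝ → ℝ) : ∫ r, g r ∂(radM m) =
    ∫ r in Ioi 0, (m * r ^ (m - 1)) * g r := by
  rw [radM, integral_withDensity_eq_integral_toReal_smul (by fun_prop) (Eventually.of_forall fun _ => ENNReal.ofReal_lt_top)]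
  apply integral_congr_ae
  filter_upwards [ae_restrict_mem measurableSet_Ioi] with x hx
  have hx' : (0:ℝ) < x := hx
  simp only [smul_eq_mul]
  rw [ENNReal.toReal_ofReal (by positivity)]

/-- `∫ r^(2k) exp(-r^2)` -/
lemma radM_gauss_moment {m : ℕ} (hm : 1 ≤ m) (k : ℕ) :
    ∫ r, r ^ (2 * k) * Real.exp (- r ^ 2) ∂(radM m) = (m / 2) * Real.Gamma (m / 2 + k) := by
  rw [radM_integral]
  have := integral_rpow_mul_exp_neg_rpow (p := 2) (q := (m:ℝ) - 1 + 2 * k) two_pos (by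
    have : (1:ℝ) ≤ m := by exact_mod_cast hm
    have : (0:ℝ) ≤ k := by positivity
    linarith)
  have e : ((m:ℝ) - 1 + 2 * k + 1) / 2 = m / 2 + k := by ring
  rw [e] at this
  have h2 : (m / 2) * Real.Gamma (m / 2 + k) = m * (1 / 2 * Real.Gamma (m / 2 + k)) := by ring
  rw [h2, ← this, ← integral_const_mul]
  apply setIntegral_congr_fun measurableSet_Ioi
  intro r hr
  have hr' : (0:ℝ) < r := hr
  simp only
  have e1 : (m:ℝ) - 1 + 2 * k = ((m - 1 + 2 * k : ℕ) : ℝ) := by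
    push_cast [Nat.cast_sub hm]; ring
  rw [e1, Real.rpow_natCast, Real.rpow_two, pow_add]; ring

lemma radM_gauss_integrable {m : ℕ} (k : ℕ) (c : ℝ) :
    Integrable (fun r => r ^ k * Real.exp (- r ^ 2 + c * r)) (radM m) := by
  rw [radM_integrable_iff]
  have h1 := integrableOn_rpow_mul_exp_neg_mul_sq (b := 1/2) (by norm_num)
    (s := ((m - 1 + k : ℕ) : ℝ)) (by
      have : (0:ℝ) ≤ ((m - 1 + k : ℕ) : ℝ) := by positivity
      linarith)
  have h2 := h1.const_mul (m * Real.exp (c ^ 2 / 2))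
  refine Integrable.mono' h2 ?_ ?_
  · exact (Continuous.aestronglyMeasurable (by fun_prop))
  · filter_upwards [ae_restrict_mem measurableSet_Ioi] with x hx
    have hx' : (0:ℝ) < x := hx
    rw [Real.norm_of_nonneg (by positivity), Real.rpow_natCast, pow_add]
    have : Real.exp (-x ^ 2 + c * x) ≤ Real.exp (c ^ 2 / 2) * Real.exp (-(1/2) * x ^ 2) := by
      rw [← Real.exp_add]; apply Real.exp_le_exp.2; nlinarith [sq_nonneg (x - c)]
    calc _ ≤ m * x ^ (m - 1) * (x ^ k * (Real.exp (c ^ 2 / 2) * Real.exp (-(1/2) * x ^ 2))) := by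
          gcongr
      _ = _ := by ring
end

section

def cg (m : ℕ) : ℝ := (m / 2) * Real.Gamma (m / 2)

lemma cg_pos {m : ℕ} (hm : 1 ≤ m) : 0 < cg m := by
  have : (0:ℝ) < m := by exact_mod_cast hm
  have := Real.Gamma_pos_of_pos (half_pos this)
  unfold cg; positivity

def gam {n : ℕ} (m : ℕ) (ν : Measure (E n)) (ε : ℝ) : Measure (E n) :=
  (ν.withDensity (fun w => ENNReal.ofReal ((cg m)⁻¹ * ε ^ m * Real.exp (-(ε * ‖w‖) ^ 2)))).map
    (fun w => ε • w)

/-- fixed radial moments -/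
def Mke (m k : ℕ) (c : ℝ) : ℝ :=
  (cg m)⁻¹ * ∫ r, r ^ k * Real.exp (c * r) * Real.exp (- r ^ 2) ∂(radM m)

lemma gam_dens_pos {m : ℕ} (hm : 1 ≤ m) {ε : ℝ} (hε : 0 < ε) (t : ℝ) :
    0 < (cg m)⁻¹ * ε ^ m * Real.exp (-(ε * t) ^ 2) := by
  have := cg_pos hm; positivity

lemma gam_integral {n m : ℕ} (hm : 1 ≤ m) (ν : Measure (E n)) {ε : ℝ} (hε : 0 < ε)
    {f : E n → ℝ} (hf : Continuous f) :
    ∫ z, f z ∂(gam m ν ε) =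
      (cg m)⁻¹ * ε ^ m * ∫ w, Real.exp (-(ε * ‖w‖) ^ 2) * f (ε • w) ∂ν := by
  rw [gam, integral_map (by fun_prop) hf.aestronglyMeasurable,
    integral_withDensity_eq_integral_toReal_smul (by fun_prop)
      (Eventually.of_forall fun _ => ENNReal.ofReal_lt_top), ← integral_const_mul]
  apply integral_congr_ae
  filter_upwards with w
  rw [ENNReal.toReal_ofReal (gam_dens_pos hm hε _).le, smul_eq_mul]; ring

lemma gam_integrable {n m : ℕ} (hm : 1 ≤ m) (ν : Measure (E n)) {ε : ℝ} (hε : 0 < ε)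
    {f : E n → ℝ} (hf : Continuous f)
    (h : Integrable (fun w => Real.exp (-(ε * ‖w‖) ^ 2) * f (ε • w)) ν) :
    Integrable f (gam m ν ε) := by
  rw [gam, integrable_map_measure hf.aestronglyMeasurable (by fun_prop),
    integrable_withDensity_iff_integrable_smul' (by fun_prop)
      (Eventually.of_forall fun _ => ENNReal.ofReal_lt_top)]
  refine (h.const_mul ((cg m)⁻¹ * ε ^ m)).congr ?_
  filter_upwards with w
  rw [ENNReal.toReal_ofReal (gam_dens_pos hm hε _).le, smul_eq_mul]
  simp only [Function.comp]; ring

lemma gam_norm_integrable {n m : ℕ} (hm : 1 ≤ m) {ν : Measure (E n)} (h : IsUnif m ν)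
    (h0 : (0 : E n) ∈ msupp ν) {ε : ℝ} (hε : 0 < ε) {g : ℝ → ℝ} (hg : Continuous g)
    (hi : Integrable (fun r => g r * Real.exp (- r ^ 2)) (radM m)) :
    Integrable (fun z => g ‖z‖) (gam m ν ε) := by
  apply gam_integrable hm ν hε (by fun_prop)
  have := h.integrable_rad hm h0 hε hi
  refine this.congr ?_
  filter_upwards with w
  rw [sub_zero, norm_smul, Real.norm_of_nonneg hε.le, mul_comm]

lemma gam_norm_integral {n m : ℕ} (hm : 1 ≤ m) {ν : Measure (E n)} (h : IsUnif m ν)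
    (h0 : (0 : E n) ∈ msupp ν) {ε : ℝ} (hε : 0 < ε) {g : ℝ → ℝ} (hg : Continuous g) :
    ∫ z, g ‖z‖ ∂(gam m ν ε) = (cg m)⁻¹ * ∫ r, g r * Real.exp (- r ^ 2) ∂(radM m) := by
  rw [gam_integral hm ν hε (by fun_prop)]
  have := h.integral_rad hm h0 hε (g := fun r => g r * Real.exp (- r ^ 2)) (by fun_prop)
  have e : ∫ w, Real.exp (-(ε * ‖w‖) ^ 2) * g ‖ε • w‖ ∂ν =
      ∫ w, g (ε * ‖w - 0‖) * Real.exp (-(ε * ‖w - 0‖) ^ 2) ∂ν := by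
    congr 1; ext w
    rw [sub_zero, norm_smul, Real.norm_of_nonneg hε.le, mul_comm]
  rw [e, this]
  field_simp

structure GS {n : ℕ} (m : ℕ) (S : Set (E n)) (ε : ℝ) (γ : Measure (E n)) : Prop where
  prob : IsProbabilityMeasure γ
  nint : ∀ (k : ℕ) (c : ℝ), Integrable (fun z : E n => ‖z‖ ^ k * Real.exp (c * ‖z‖)) γ
  nval : ∀ (k : ℕ) (c : ℝ), ∫ z : E n, ‖z‖ ^ k * Real.exp (c * ‖z‖) ∂γ = Mke m k c
  supp : ∀ᵐ z ∂γ, ε⁻¹ • z ∈ S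
  g3 : ∀ x ∈ S, ∫ z : E n, Real.exp (2 * ε * ⟪z, x⟫) ∂γ = Real.exp (ε ^ 2 * ‖x‖ ^ 2)
  g4 : ∀ x ∈ S, ∫ z : E n, (‖z‖ ^ 2 - 2 * ε * ⟪z, x⟫ + ε ^ 2 * ‖x‖ ^ 2) *
    Real.exp (2 * ε * ⟪z, x⟫) ∂γ = (m / 2) * Real.exp (ε ^ 2 * ‖x‖ ^ 2)
  m2 : ∫ z : E n, ‖z‖ ^ 2 ∂γ = m / 2
  m4 : ∫ z : E n, ‖z‖ ^ 4 ∂γ = m / 2 * (m / 2 + 1)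
  m6 : ∫ z : E n, ‖z‖ ^ 6 ∂γ = m / 2 * (m / 2 + 1) * (m / 2 + 2)

lemma gauss_shift {n : ℕ} (ε : ℝ) (w x : E n) :
    Real.exp (-(ε * ‖w‖) ^ 2) * Real.exp (2 * ε * ⟪ε • w, x⟫) =
      Real.exp (ε ^ 2 * ‖x‖ ^ 2) * Real.exp (-(ε * ‖w - x‖) ^ 2) := by
  rw [← Real.exp_add, ← Real.exp_add]
  congr 1
  rw [mul_pow ε, mul_pow ε, @norm_sub_sq_real, real_inner_smul_left]; ring

lemma gam_GS {n m : ℕ} (hm : 1 ≤ m) {ν : Measure (E n)} (h : IsUnif m ν)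
    (h0 : (0 : E n) ∈ msupp ν) {ε : ℝ} (hε : 0 < ε) : GS m (msupp ν) ε (gam m ν ε) := by
  have hc := cg_pos hm
  have hm' : (0:ℝ) < m := by exact_mod_cast hm
  have hG1 : Real.Gamma (m / 2 + 1) = m / 2 * Real.Gamma (m / 2) :=
    Real.Gamma_add_one (by positivity)
  have hG2 : Real.Gamma (m / 2 + 2) = (m / 2 + 1) * Real.Gamma (m / 2 + 1) := by
    rw [← Real.Gamma_add_one (by positivity)]; congr 1; ring
  have hG3 : Real.Gamma (m / 2 + 3) = (m / 2 + 2) * Real.Gamma (m / 2 + 2) := by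
    rw [← Real.Gamma_add_one (by positivity)]; congr 1; ring
  have hGp := Real.Gamma_pos_of_pos (half_pos hm')
  have mom := fun k => radM_gauss_moment hm k
  have nn : ∀ (k : ℕ) (c : ℝ), Integrable (fun z : E n => ‖z‖ ^ k * Real.exp (c * ‖z‖))
      (gam m ν ε) := by
    intro k c
    apply gam_norm_integrable hm h h0 hε (g := fun r => r ^ k * Real.exp (c * r)) (by fun_prop)
    refine (radM_gauss_integrable (m := m) k c).congr ?_
    filter_upwards with r
    rw [Real.exp_add]; ring
  have gs : ∀ x ∈ msupp ν, ∫ w, Real.exp (-(ε * ‖w - x‖) ^ 2) ∂ν = (ε ^ m)⁻¹ * cg m := by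
    intro x hx
    rw [h.integral_rad hm hx hε (g := fun r => Real.exp (-r ^ 2)) (by fun_prop)]
    have := mom 0
    simp only [mul_zero, pow_zero, one_mul, Nat.cast_zero, add_zero] at this
    rw [this]; rfl
  have gs2 : ∀ x ∈ msupp ν, ∫ w, (ε * ‖w - x‖) ^ 2 * Real.exp (-(ε * ‖w - x‖) ^ 2) ∂ν =
      (ε ^ m)⁻¹ * (m / 2 * cg m) := by
    intro x hx
    rw [h.integral_rad hm hx hε (g := fun r => r ^ 2 * Real.exp (-r ^ 2)) (by fun_prop)]
    have := mom 1
    simp only [mul_one, Nat.cast_one] at this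
    rw [this, hG1, cg]
  refine ⟨?_, nn, ?_, ?_, ?_, ?_, ?_, ?_, ?_⟩
  · have hI := (nn 0 0)
    have hfin : gam m ν ε univ ≠ ∞ := by
      simp only [pow_zero, zero_mul, Real.exp_zero, mul_one] at hI
      rcases integrable_const_iff.1 hI with h | h
      · simp at h
      · exact h.measure_univ_lt_top.ne
    have h1 : ∫ z, (1:ℝ) ∂(gam m ν ε) = 1 := by
      have := gam_norm_integral hm h h0 hε (g := fun _ => (1:ℝ)) continuous_const
      rw [this]
      have := mom 0
      simp only [mul_zero, pow_zero, one_mul, Nat.cast_zero, add_zero] at this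
      simp only [one_mul]
      rw [this, cg]; field_simp
    constructor
    rw [integral_const, smul_eq_mul, mul_one, measureReal_def, ENNReal.toReal_eq_one_iff] at h1
    exact h1
  · intro k c
    rw [gam_norm_integral hm h h0 hε (g := fun r => r ^ k * Real.exp (c * r)) (by fun_prop)]; rfl
  · rw [gam, ae_map_iff (by fun_prop) (by
      exact ((msupp_closed ν).preimage (continuous_const_smul ε⁻¹)).measurableSet)]
    have := withDensity_absolutelyContinuous ν
      (fun w => ENNReal.ofReal ((cg m)⁻¹ * ε ^ m * Real.exp (-(ε * ‖w‖) ^ 2)))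
    filter_upwards [this.ae_le (msupp_ae ν)] with w hw
    rwa [smul_smul, inv_mul_cancel₀ hε.ne', one_smul]
  · intro x hx
    rw [gam_integral hm ν hε (by fun_prop)]
    simp_rw [gauss_shift]
    rw [integral_const_mul, gs x hx]
    field_simp
  · intro x hx
    rw [gam_integral hm ν hε (by fun_prop)]
    have : ∀ w : E n, Real.exp (-(ε * ‖w‖) ^ 2) * ((‖ε • w‖ ^ 2 - 2 * ε * ⟪ε • w, x⟫ +
        ε ^ 2 * ‖x‖ ^ 2) * Real.exp (2 * ε * ⟪ε • w, x⟫)) = Real.exp (ε ^ 2 * ‖x‖ ^ 2) *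
        ((ε * ‖w - x‖) ^ 2 * Real.exp (-(ε * ‖w - x‖) ^ 2)) := by
      intro w
      have h1 := gauss_shift ε w x
      have h2 : ‖ε • w‖ ^ 2 - 2 * ε * ⟪ε • w, x⟫ + ε ^ 2 * ‖x‖ ^ 2 = (ε * ‖w - x‖) ^ 2 := by
        rw [norm_smul, mul_pow ε, @norm_sub_sq_real, real_inner_smul_left, mul_pow,
          Real.norm_eq_abs, sq_abs]; ring
      rw [h2]
      linear_combination ((ε * ‖w - x‖) ^ 2) * h1
    simp_rw [this]
    rw [integral_const_mul, gs2 x hx]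
    field_simp
  · rw [gam_norm_integral hm h h0 hε (g := fun r => r ^ 2) (by fun_prop)]
    have := mom 1
    simp only [mul_one, Nat.cast_one] at this
    rw [this, hG1, cg]; field_simp
  · rw [gam_norm_integral hm h h0 hε (g := fun r => r ^ 4) (by fun_prop)]
    have := mom 2
    norm_num at this
    rw [this, hG2, hG1, cg]; field_simp
  · rw [gam_norm_integral hm h h0 hε (g := fun r => r ^ 6) (by fun_prop)]
    have := mom 3
    norm_num at this
    rw [this, hG3, hG2, hG1, cg]; field_simp
end

section

open MvPolynomial Asymptotics

lemma functional_bigO {n : ℕ} {S : Set (E n)} {K : ℕ} {l : Filter ℝ} {g : ℝ → ℝ}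
    (p : ℝ → restrictTotalDegree (Fin n) ℝ K)
    (hp : ∀ x ∈ S, (fun ε => eval x.ofLp (p ε).1) =O[l] g)
    (φ : restrictTotalDegree (Fin n) ℝ K →ₗ[ℝ] ℝ)
    (hφ : ∀ w : restrictTotalDegree (Fin n) ℝ K, (∀ x ∈ S, eval x.ofLp w.1 = 0) → φ w = 0) :
    (fun ε => φ (p ε)) =O[l] g := by
  let ev : S → restrictTotalDegree (Fin n) ℝ K →ₗ[ℝ] ℝ := fun x =>
    (MvPolynomial.aeval (x.1.ofLp : Fin n → ℝ)).toLinearMap.comp (Submodule.subtype _)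
  have hev : ∀ x w, ev x w = eval x.1.ofLp w.1 := by
    intro x w
    simp only [ev, LinearMap.comp_apply, AlgHom.toLinearMap_apply, Submodule.subtype_apply]
    exact DFunLike.congr_fun (MvPolynomial.coe_aeval_eq_eval _) _
  have hmem : φ ∈ Submodule.span ℝ (range ev) := by
    apply FiniteDimensional.mem_span_of_iInf_ker_le_ker
    intro w hw
    rw [Submodule.mem_iInf] at hw
    apply hφ
    intro x hx
    have := hw ⟨x, hx⟩
    rwa [LinearMap.mem_ker, hev] at this
  clear hφ
  induction hmem using Submodule.span_induction with
  | mem f hf =>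
    obtain ⟨x, rfl⟩ := hf
    simp_rw [hev]; exact hp x.1 x.2
  | zero => simpa using isBigO_zero _ _
  | add f g _ _ h1 h2 => simpa using h1.add h2
  | smul c f _ h => simpa using h.const_mul_left c

lemma division_bigO {n : ℕ} {S : Set (E n)} {K : ℕ} {l : Filter ℝ} {g : ℝ → ℝ}
    (q : MvPolynomial (Fin n) ℝ) (hq : q.totalDegree = 2)
    (hdiv : ∀ p : MvPolynomial (Fin n) ℝ, (∀ x ∈ S, eval x.ofLp p = 0) → q ∣ p)
    (p : ℝ → MvPolynomial (Fin n) ℝ) (hK : ∀ ε, (p ε).totalDegree ≤ K)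
    (hp : ∀ x ∈ S, (fun ε => eval x.ofLp (p ε)) =O[l] g) :
    ∃ ℓ : ℝ → MvPolynomial (Fin n) ℝ, (∀ ε, (ℓ ε).totalDegree + 2 ≤ max K 2) ∧
      ∀ d, (fun ε => coeff d (p ε) - coeff d (q * ℓ ε)) =O[l] g := by
  let W : Submodule ℝ (restrictTotalDegree (Fin n) ℝ K) :=
    { carrier := {w | ∀ x ∈ S, eval x.ofLp w.1 = 0}
      add_mem' := by
        intro a b ha hb x hx
        simp [ha x hx, hb x hx]
      zero_mem' := by intro x _; simp
      smul_mem' := by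
        intro c a ha x hx
        simp [ha x hx] }
  obtain ⟨W', hc⟩ := W.exists_isCompl
  let f := W.projectionOnto W' hc
  have hf' : ∀ w : W, f w.1 = w := fun w => Submodule.projectionOnto_apply_left hc w
  have hex : ∀ w : W, ∃ ℓ : MvPolynomial (Fin n) ℝ, ℓ.totalDegree + 2 ≤ max K 2 ∧
      w.1.1 = q * ℓ := by
    intro w
    obtain ⟨ℓ, hℓ⟩ := hdiv w.1.1 w.2
    by_cases h0 : ℓ = 0
    · exact ⟨ℓ, by simp [h0], hℓ⟩
    · refine ⟨ℓ, ?_, hℓ⟩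
      have hq0 : q ≠ 0 := by rintro rfl; simp at hq
      have h1 := (mem_restrictTotalDegree _ _ _).1 w.1.2
      rw [hℓ, totalDegree_mul_of_isDomain hq0 h0, hq] at h1
      omega
  choose L hL1 hL2 using hex
  let P : ℝ → restrictTotalDegree (Fin n) ℝ K := fun ε => ⟨p ε, (mem_restrictTotalDegree _ _ _).2 (hK ε)⟩
  refine ⟨fun ε => L (f (P ε)), fun ε => hL1 _, ?_⟩
  intro d
  let φ : restrictTotalDegree (Fin n) ℝ K →ₗ[ℝ] ℝ := (MvPolynomial.lcoeff ℝ d).comp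
    ((Submodule.subtype _).comp (LinearMap.id - (Submodule.subtype _).comp f))
  have := functional_bigO (S := S) P hp φ (by
    intro w hw
    have := hf' ⟨w, hw⟩
    simp only [φ, LinearMap.comp_apply, LinearMap.sub_apply, LinearMap.id_apply, this,
      Submodule.subtype_apply, sub_self, map_zero])
  refine this.congr_left ?_
  intro ε
  simp only [φ, LinearMap.comp_apply, LinearMap.sub_apply, LinearMap.id_apply,
      Submodule.subtype_apply]
  rw [← hL2, ← coeff_sub]
  rfl

abbrev toF {n : ℕ} (d : Fin n → ℕ) : Fin n →₀ ℕ := Finsupp.equivFunOnFinite.symm d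

/-- Taylor polynomial -/
def PT {n : ℕ} (γ : Measure (E n)) (ε : ℝ) (K : ℕ) : MvPolynomial (Fin n) ℝ :=
  (∑ k ∈ Finset.range (K + 1), ∑ d ∈ Finset.piAntidiag Finset.univ k,
    monomial (toF d) ((2 * ε) ^ k * (∫ z : E n, ∏ i, z i ^ d i ∂γ) / ∏ i, ((d i).factorial : ℝ))) -
  ∑ j ∈ Finset.range (K / 2 + 1), C (ε ^ (2 * j) / (j.factorial : ℝ)) * (∑ i, X i ^ 2) ^ j

lemma abs_mono_le {n : ℕ} (d : Fin n → ℕ) (z : E n) :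
    |∏ i, z i ^ d i| ≤ ‖z‖ ^ (∑ i, d i) := by
  rw [Finset.abs_prod, ← Finset.prod_pow_eq_pow_sum]
  apply Finset.prod_le_prod
  · intro i _; positivity
  · intro i _
    rw [abs_pow]
    gcongr
    exact PiLp.norm_apply_le z i

lemma GS.int_pow {n m : ℕ} {S : Set (E n)} {ε : ℝ} {γ : Measure (E n)} (h : GS m S ε γ) (k : ℕ) :
    Integrable (fun z : E n => ‖z‖ ^ k) γ := by
  simpa using h.nint k 0

lemma GS.int_of_le {n m : ℕ} {S : Set (E n)} {ε : ℝ} {γ : Measure (E n)} (h : GS m S ε γ)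
    {f : E n → ℝ} (hf : Continuous f) (k : ℕ) (c C : ℝ)
    (hb : ∀ z, |f z| ≤ C * (‖z‖ ^ k * Real.exp (c * ‖z‖))) : Integrable f γ :=
  ((h.nint k c).const_mul C).mono' hf.aestronglyMeasurable (Eventually.of_forall hb)

lemma GS.int_mono {n m : ℕ} {S : Set (E n)} {ε : ℝ} {γ : Measure (E n)} (h : GS m S ε γ)
    (d : Fin n → ℕ) : Integrable (fun z : E n => ∏ i, z i ^ d i) γ := by
  apply (h.int_pow (∑ i, d i)).mono' (by fun_prop)
  exact Eventually.of_forall (abs_mono_le d)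

lemma multinomial_real {n : ℕ} (k : ℕ) (u : Fin n → ℝ) :
    (∑ i, u i) ^ k / k.factorial = ∑ d ∈ Finset.piAntidiag (Finset.univ : Finset (Fin n)) k,
      (∏ i, u i ^ d i) / ∏ i, ((d i).factorial : ℝ) := by
  rw [Finset.sum_pow_eq_sum_piAntidiag, Finset.sum_div]
  apply Finset.sum_congr rfl
  intro d hd
  have hs := (Finset.mem_piAntidiag.1 hd).1
  have := Nat.multinomial_spec Finset.univ d
  rw [hs] at this
  have h2 : (∏ i, ((d i).factorial : ℝ)) * (Nat.multinomial Finset.univ d : ℝ) = k.factorial := by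
    exact_mod_cast this
  have h3 : (∏ i, ((d i).factorial : ℝ)) ≠ 0 := by
    apply Finset.prod_ne_zero_iff.2; intro i _; positivity
  rw [div_eq_div_iff (by positivity) h3, ← h2]; ring

lemma PT_eval {n m : ℕ} {S : Set (E n)} {ε : ℝ} {γ : Measure (E n)} (h : GS m S ε γ) (K : ℕ)
    (x : E n) : eval x.ofLp (PT γ ε K) =
      ∫ z : E n, ∑ k ∈ Finset.range (K + 1), (2 * ε * ⟪z, x⟫) ^ k / k.factorial ∂γ -
      ∑ j ∈ Finset.range (K / 2 + 1), (ε ^ 2 * ‖x‖ ^ 2) ^ j / j.factorial := by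
  have hin : ∀ z : E n, ⟪z, x⟫ = ∑ i, z i * x i := by
    intro z; simp [PiLp.inner_apply, mul_comm]
  have e1 : ∀ (k : ℕ) (z : E n), (2 * ε * ⟪z, x⟫) ^ k / k.factorial =
      ∑ d ∈ Finset.piAntidiag Finset.univ k, ((2 * ε) ^ k / (∏ i, ((d i).factorial : ℝ)) *
        ∏ i, x i ^ d i) * ∏ i, z i ^ d i := by
    intro k z
    rw [mul_pow, mul_div_assoc, hin, multinomial_real, Finset.mul_sum]
    apply Finset.sum_congr rfl
    intro d _
    simp_rw [mul_pow]
    rw [Finset.prod_mul_distrib]; ring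
  unfold PT
  simp_rw [e1]
  rw [integral_finsetSum]
  swap
  · intro k _
    apply integrable_finsetSum; intro d _
    exact (h.int_mono d).const_mul _
  rw [map_sub, map_sum, map_sum]
  congr 1
  · apply Finset.sum_congr rfl
    intro k _
    rw [map_sum, integral_finsetSum _ (fun d _ => (h.int_mono d).const_mul _)]
    apply Finset.sum_congr rfl
    intro d _
    rw [integral_const_mul, eval_monomial]
    simp only [Finsupp.prod_fintype, pow_zero, implies_true]
    simp only [toF, Finsupp.equivFunOnFinite_symm_apply_apply]
    ring
  · apply Finset.sum_congr rfl
    intro j _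
    rw [mul_pow, EuclideanSpace.norm_sq_eq]
    simp only [map_mul, eval_C, map_pow, map_sum, eval_X, Real.norm_eq_abs, sq_abs]
    ring

lemma exp_taylor_le (t : ℝ) (K : ℕ) :
    |Real.exp t - ∑ k ∈ Finset.range K, t ^ k / k.factorial| ≤ |t| ^ K * Real.exp |t| := by
  have := Complex.norm_exp_sub_sum_le_norm_mul_exp (t : ℂ) K
  rw [Complex.norm_real, Real.norm_eq_abs] at this
  convert this using 1
  rw [← Real.norm_eq_abs, ← Complex.norm_real]
  push_cast
  rfl

lemma PT_bigO {n m : ℕ} {S : Set (E n)} {γ : ℝ → Measure (E n)}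
    (h : ∀ ε, 0 < ε → GS m S ε (γ ε)) (K : ℕ) {x : E n} (hx : x ∈ S) :
    (fun ε => eval x.ofLp (PT (γ ε) ε K)) =O[𝓝[>] 0] (fun ε => ε ^ (K + 1)) := by
  set C1 := (2 * ‖x‖) ^ (K + 1) * Mke m (K + 1) (2 * ‖x‖)
  set C2 := (‖x‖ ^ 2) ^ (K / 2 + 1) * Real.exp (‖x‖ ^ 2)
  apply IsBigO.of_bound (C1 + C2)
  have : ∀ᶠ ε : ℝ in 𝓝[>] 0, ε ∈ Ioo (0:ℝ) 1 := Ioo_mem_nhdsGT one_pos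
  filter_upwards [this] with ε hε
  have hε0 := hε.1
  have G := h ε hε0
  have := G.prob
  rw [PT_eval G]
  have h3 := G.g3 x hx
  have hle : ∀ z : E n, |2 * ε * ⟪z, x⟫| ≤ (2 * ε * ‖x‖) * ‖z‖ := by
    intro z
    rw [abs_mul, abs_of_pos (by positivity : 0 < 2 * ε)]
    have := abs_real_inner_le_norm z x
    nlinarith [hε0]
  have hi1 : Integrable (fun z : E n => Real.exp (2 * ε * ⟪z, x⟫)) (γ ε) := by
    apply G.int_of_le (by fun_prop) 0 (2 * ε * ‖x‖) 1
    intro z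
    rw [abs_of_pos (Real.exp_pos _), pow_zero, one_mul, one_mul]
    exact Real.exp_le_exp.2 ((le_abs_self _).trans (hle z))
  have hi2 : Integrable (fun z : E n => ∑ k ∈ Finset.range (K + 1),
      (2 * ε * ⟪z, x⟫) ^ k / k.factorial) (γ ε) := by
    apply integrable_finsetSum; intro k _
    apply Integrable.div_const
    apply G.int_of_le (by fun_prop) k 0 ((2 * ε * ‖x‖) ^ k)
    intro z
    rw [abs_pow, zero_mul, Real.exp_zero, mul_one, ← mul_pow]
    exact pow_le_pow_left₀ (abs_nonneg _) (hle z) k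
  have A : |∫ z : E n, ∑ k ∈ Finset.range (K + 1), (2 * ε * ⟪z, x⟫) ^ k / k.factorial ∂(γ ε) -
      Real.exp (ε ^ 2 * ‖x‖ ^ 2)| ≤ C1 * ε ^ (K + 1) := by
    rw [← h3, ← integral_sub hi2 hi1]
    have h5 : ∀ z : E n, ‖∑ k ∈ Finset.range (K + 1), (2 * ε * ⟪z, x⟫) ^ k / k.factorial -
        Real.exp (2 * ε * ⟪z, x⟫)‖ ≤ (2 * ε * ‖x‖) ^ (K + 1) *
          (‖z‖ ^ (K + 1) * Real.exp (2 * ‖x‖ * ‖z‖)) := by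
      intro z
      rw [norm_sub_rev, Real.norm_eq_abs]
      refine (exp_taylor_le _ _).trans ?_
      rw [← mul_assoc, ← mul_pow]
      gcongr
      · exact hle z
      · refine (hle z).trans ?_
        gcongr
        nlinarith [norm_nonneg x, hε.2]
    rw [← Real.norm_eq_abs]
    refine (norm_integral_le_of_norm_le ((G.nint _ _).const_mul _) (Eventually.of_forall h5)).trans ?_
    rw [integral_const_mul, G.nval]
    apply le_of_eq
    simp only [C1]; ring
  have B : |Real.exp (ε ^ 2 * ‖x‖ ^ 2) - ∑ j ∈ Finset.range (K / 2 + 1),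
      (ε ^ 2 * ‖x‖ ^ 2) ^ j / j.factorial| ≤ C2 * ε ^ (K + 1) := by
    refine (exp_taylor_le _ _).trans ?_
    rw [abs_of_nonneg (by positivity : 0 ≤ ε ^ 2 * ‖x‖ ^ 2), mul_pow, ← pow_mul]
    have h1 : ε ^ (2 * (K / 2 + 1)) ≤ ε ^ (K + 1) :=
      pow_le_pow_of_le_one hε0.le hε.2.le (by omega)
    have h2 : Real.exp (ε ^ 2 * ‖x‖ ^ 2) ≤ Real.exp (‖x‖ ^ 2) := by
      apply Real.exp_le_exp.2
      have : ε ^ 2 ≤ 1 := pow_le_one₀ hε0.le hε.2.le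
      nlinarith [sq_nonneg ‖x‖]
    calc _ ≤ ε ^ (K + 1) * (‖x‖ ^ 2) ^ (K / 2 + 1) * Real.exp (‖x‖ ^ 2) := by gcongr
      _ = _ := by simp only [C2]; ring
  rw [Real.norm_eq_abs, Real.norm_eq_abs, abs_of_nonneg (by positivity : 0 ≤ ε ^ (K + 1))]
  have := abs_add_le (∫ z : E n, ∑ k ∈ Finset.range (K + 1), (2 * ε * ⟪z, x⟫) ^ k / k.factorial ∂(γ ε) -
      Real.exp (ε ^ 2 * ‖x‖ ^ 2)) (Real.exp (ε ^ 2 * ‖x‖ ^ 2) - ∑ j ∈ Finset.range (K / 2 + 1),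
      (ε ^ 2 * ‖x‖ ^ 2) ^ j / j.factorial)
  rw [sub_add_sub_cancel] at this
  linarith

lemma coeff_PT_aux {n : ℕ} (γ : Measure (E n)) (ε : ℝ) (K : ℕ) (D : Fin n → ℕ)
    (hD : ∑ i, D i ≤ K) : coeff (toF D) (∑ k ∈ Finset.range (K + 1),
    ∑ d ∈ Finset.piAntidiag Finset.univ k, monomial (toF d)
      ((2 * ε) ^ k * (∫ z : E n, ∏ i, z i ^ d i ∂γ) / ∏ i, ((d i).factorial : ℝ))) =
    (2 * ε) ^ (∑ i, D i) * (∫ z : E n, ∏ i, z i ^ D i ∂γ) / ∏ i, ((D i).factorial : ℝ) := by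
  classical
  simp only [coeff_sum, coeff_monomial, EmbeddingLike.apply_eq_iff_eq]
  rw [Finset.sum_eq_single (∑ i, D i)]
  · rw [Finset.sum_ite_eq', if_pos (by simp)]
  · intro k _ hk
    rw [Finset.sum_ite_eq', if_neg]
    simp only [Finset.mem_piAntidiag, not_and]
    intro h; exact absurd h.symm hk
  · intro h; simp at h; omega

def cnt {n : ℕ} (s : List (Fin n)) : Fin n → ℕ := fun i => s.count i

lemma cnt_cons {n : ℕ} (i : Fin n) (s : List (Fin n)) : toF (cnt (i :: s)) =
    toF (cnt s) + Finsupp.single i 1 := by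
  ext j
  simp [cnt, List.count_cons, Finsupp.single_apply]

lemma cnt_sum {n : ℕ} (s : List (Fin n)) : ∑ i, cnt s i = s.length := by
  induction s with
  | nil => simp [cnt]
  | cons i s ih =>
    have : ∀ j, cnt (i :: s) j = cnt s j + if i = j then 1 else 0 := by
      intro j; simp [cnt, List.count_cons]
    simp [this, Finset.sum_add_distrib, ih]

lemma cnt_prod {n : ℕ} (s : List (Fin n)) (u : Fin n → ℝ) :
    (s.map u).prod = ∏ i, u i ^ cnt s i := by
  induction s with
  | nil => simp [cnt]
  | cons i s ih =>
    have : ∀ j, cnt (i :: s) j = cnt s j + if i = j then 1 else 0 := by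
      intro j; simp [cnt, List.count_cons]
    simp only [this, pow_add, Finset.prod_mul_distrib, List.map_cons, List.prod_cons, ih]
    simp [mul_comm]

def pd {n : ℕ} : List (Fin n) → MvPolynomial (Fin n) ℝ → ℝ
  | [], p => coeff 0 p
  | i :: s, p => pd s (pderiv i p)

lemma pd_eq {n : ℕ} (s : List (Fin n)) : ∀ p : MvPolynomial (Fin n) ℝ,
    pd s p = (∏ i, ((cnt s i).factorial : ℝ)) * coeff (toF (cnt s)) p := by
  induction s with
  | nil =>
    intro p
    have : toF (cnt ([] : List (Fin n))) = 0 := by ext; simp [cnt]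
    rw [this]
    simp [pd, cnt]
  | cons i s ih =>
    intro p
    rw [pd, ih, coeff_pderiv, cnt_cons]
    have : ∀ j, ((cnt (i :: s) j).factorial : ℝ) =
        ((cnt s j).factorial : ℝ) * if i = j then ((cnt s i : ℝ) + 1) else 1 := by
      intro j
      by_cases h : i = j
      · subst h; simp [cnt, Nat.factorial_succ, mul_comm]
      · simp [cnt, h]
    simp_rw [this, Finset.prod_mul_distrib, Finset.prod_ite_eq]
    simp only [Finset.mem_univ, if_true]
    have : toF (cnt s) i = cnt s i := rfl
    rw [this]; ring

lemma pd_add {n : ℕ} (s : List (Fin n)) (p q : MvPolynomial (Fin n) ℝ) :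
    pd s (p + q) = pd s p + pd s q := by simp [pd_eq, mul_add]
lemma pd_sub {n : ℕ} (s : List (Fin n)) (p q : MvPolynomial (Fin n) ℝ) :
    pd s (p - q) = pd s p - pd s q := by simp [pd_eq, mul_sub]
lemma pd_C_mul {n : ℕ} (s : List (Fin n)) (c : ℝ) (p : MvPolynomial (Fin n) ℝ) :
    pd s (C c * p) = c * pd s p := by simp [pd_eq]; ring
lemma pd_sum {n : ℕ} {ι : Type*} (t : Finset ι) (s : List (Fin n))
    (p : ι → MvPolynomial (Fin n) ℝ) : pd s (∑ j ∈ t, p j) = ∑ j ∈ t, pd s (p j) := by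
  simp [pd_eq, Finset.mul_sum, coeff_sum]
lemma pd_zero {n : ℕ} (s : List (Fin n)) : pd s (0 : MvPolynomial (Fin n) ℝ) = 0 := by
  simp [pd_eq]
lemma pd_of_deg {n : ℕ} (s : List (Fin n)) (p : MvPolynomial (Fin n) ℝ)
    (h : p.totalDegree < s.length) : pd s p = 0 := by
  rw [pd_eq, coeff_eq_zero_of_totalDegree_lt, mul_zero]
  rw [← cnt_sum] at h
  refine h.trans_le (le_of_eq ?_)
  symm
  apply Finset.sum_subset (Finset.subset_univ _)
  intro i _ hi
  simpa using hi

/-- moments -/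
def mom {n : ℕ} (γ : Measure (E n)) (s : List (Fin n)) : ℝ := ∫ z : E n, (s.map (fun i => z i)).prod ∂γ

lemma pd_PT {n : ℕ} (γ : Measure (E n)) (ε : ℝ) (K : ℕ) (s : List (Fin n))
    (hs : s.length ≤ K) : pd s (PT γ ε K) = (2 * ε) ^ s.length * mom γ s -
      ∑ j ∈ Finset.range (K / 2 + 1), ε ^ (2 * j) / (j.factorial : ℝ) *
        pd s ((∑ i, X i ^ 2) ^ j) := by
  simp_rw [← pd_C_mul]
  rw [← pd_sum, PT, pd_sub]
  congr 1
  rw [pd_eq, coeff_PT_aux γ ε K _ (by rw [cnt_sum]; exact hs), cnt_sum, mom]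
  have e : ∀ z : E n, (s.map (fun i => z i)).prod = ∏ i, z i ^ cnt s i := fun z => cnt_prod s _
  simp only [e]
  have h3 : (∏ i, ((cnt s i).factorial : ℝ)) ≠ 0 := by
    apply Finset.prod_ne_zero_iff.2; intro i _; positivity
  field_simp

lemma toF_degree_le {n : ℕ} (d : Fin n → ℕ) (c : ℝ) :
    (monomial (toF d) c).totalDegree ≤ ∑ i, d i := by
  refine (totalDegree_monomial_le _ _).trans ?_
  rw [Finsupp.sum_fintype _ _ (by simp)]
  simp [toF]

lemma PT_totalDegree {n : ℕ} (γ : Measure (E n)) (ε : ℝ) (K : ℕ) :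
    (PT γ ε K).totalDegree ≤ K := by
  unfold PT
  refine (totalDegree_sub _ _).trans (max_le ?_ ?_)
  · apply totalDegree_finsetSum_le; intro k hk
    apply totalDegree_finsetSum_le; intro d hd
    refine (toF_degree_le _ _).trans ?_
    rw [(Finset.mem_piAntidiag.1 hd).1]; simp at hk; omega
  · apply totalDegree_finsetSum_le; intro k hk
    refine (totalDegree_mul _ _).trans ?_
    rw [totalDegree_C, zero_add]
    refine (totalDegree_pow _ _).trans ?_
    have : (∑ i : Fin n, X i ^ 2 : MvPolynomial (Fin n) ℝ).totalDegree ≤ 2 := by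
      apply totalDegree_finsetSum_le; intro i _
      rw [totalDegree_X_pow]
    simp at hk
    have := Nat.mul_le_mul_left k this
    omega
end

section
open MvPolynomial Asymptotics
set_option linter.unusedSimpArgs false

def qpoly {n : ℕ} (a b : Fin n → ℝ) : MvPolynomial (Fin n) ℝ :=
  ∑ k, C (a k) * X k ^ 2 + ∑ k, C (b k) * X k

def dl {n : ℕ} (i j : Fin n) : ℝ := if i = j then 1 else 0

lemma pderiv_qpoly {n : ℕ} (a b : Fin n → ℝ) (i : Fin n) :
    pderiv i (qpoly a b) = C (2 * a i) * X i + C (b i) := by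
  simp only [qpoly, map_add, map_sum, pderiv_C_mul, pderiv_pow, pderiv_X, Pi.single_apply]
  simp [mul_ite]
  rw [show (C 2 : MvPolynomial (Fin n) ℝ) = 2 from map_ofNat C 2]
  ring

lemma pd_perm {n : ℕ} {s t : List (Fin n)} (h : s.Perm t) (p : MvPolynomial (Fin n) ℝ) :
    pd s p = pd t p := by
  have : cnt s = cnt t := by ext i; exact h.count_eq i
  rw [pd_eq, pd_eq, this]

lemma mom_perm {n : ℕ} {s t : List (Fin n)} (h : s.Perm t) (γ : Measure (E n)) :
    mom γ s = mom γ t := by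
  unfold mom
  congr 1; ext z; exact (h.map _).prod_eq

lemma pd_qnil {n : ℕ} (a b : Fin n → ℝ) (p : MvPolynomial (Fin n) ℝ) :
    pd [] (qpoly a b * p) = 0 := by
  simp only [pd]
  rw [← constantCoeff_eq, map_mul]
  simp [qpoly]

lemma pd_qmul {n : ℕ} (a b : Fin n → ℝ) (j : Fin n) (s) (p : MvPolynomial (Fin n) ℝ) :
    pd (j :: s) (qpoly a b * p) = 2 * a j * pd s (X j * p) + b j * pd s p +
      pd s (qpoly a b * pderiv j p) := by
  rw [pd, Derivation.leibniz, pderiv_qpoly, smul_eq_mul, smul_eq_mul, pd_add, add_comm]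
  congr 1
  rw [mul_comm, add_mul, pd_add, mul_assoc, pd_C_mul, pd_C_mul]

lemma pd_Xnil {n : ℕ} (i : Fin n) (p : MvPolynomial (Fin n) ℝ) :
    pd [] (X i * p) = 0 := by
  simp only [pd]
  rw [← constantCoeff_eq, map_mul]
  simp

lemma pd_Xmul {n : ℕ} (i j : Fin n) (s) (p : MvPolynomial (Fin n) ℝ) :
    pd (j :: s) (X i * p) = dl i j * pd s p + pd s (X i * pderiv j p) := by
  rw [pd, Derivation.leibniz, pderiv_X, smul_eq_mul, smul_eq_mul, pd_add, add_comm, Pi.single_apply]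
  congr 1
  by_cases h : i = j
  · simp [dl, h]
  · simp [dl, h, pd_zero]

lemma pd1 {n : ℕ} (a b : Fin n → ℝ) (i : Fin n) (p : MvPolynomial (Fin n) ℝ) :
    pd [i] (qpoly a b * p) = b i * pd [] p := by
  simp only [pd_qmul, pd_Xmul, pd_Xnil, pd_qnil]; ring

lemma pd2 {n : ℕ} (a b : Fin n → ℝ) (i j : Fin n) (p : MvPolynomial (Fin n) ℝ) :
    pd [i, j] (qpoly a b * p) = 2 * a i * dl i j * pd [] p + b i * pd [j] p + b j * pd [i] p := by
  simp only [pd_qmul, pd_Xmul, pd_Xnil, pd_qnil]; simp only [pd]; ring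

lemma pd3 {n : ℕ} (a b : Fin n → ℝ) (i j k : Fin n) (p : MvPolynomial (Fin n) ℝ) :
    pd [i, j, k] (qpoly a b * p) = 2 * a i * dl i j * pd [k] p + 2 * a i * dl i k * pd [j] p +
      2 * a j * dl j k * pd [i] p + b i * pd [j, k] p + b j * pd [i, k] p + b k * pd [i, j] p := by
  simp only [pd_qmul, pd_Xmul, pd_Xnil, pd_qnil]; simp only [pd]; ring

lemma pd4 {n : ℕ} (a b : Fin n → ℝ) (i j k l : Fin n) (p : MvPolynomial (Fin n) ℝ) :
    pd [i, j, k, l] (qpoly a b * p) = 2 * a i * dl i j * pd [k, l] p +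
      2 * a i * dl i k * pd [j, l] p + 2 * a i * dl i l * pd [j, k] p +
      2 * a j * dl j k * pd [i, l] p + 2 * a j * dl j l * pd [i, k] p +
      2 * a k * dl k l * pd [i, j] p + b i * pd [j, k, l] p + b j * pd [i, k, l] p +
      b k * pd [i, j, l] p + b l * pd [i, j, k] p := by
  simp only [pd_qmul, pd_Xmul, pd_Xnil, pd_qnil]; simp only [pd]; ring

lemma pd6 {n : ℕ} (a b : Fin n → ℝ) (i j k : Fin n) (p : MvPolynomial (Fin n) ℝ)
    (hp : p.totalDegree ≤ 4 ∨ b = 0) :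
    pd [i, i, j, j, k, k] (qpoly a b * p) = 2 * a i * pd [j, j, k, k] p +
      2 * a j * pd [i, i, k, k] p + 2 * a k * pd [i, i, j, j] p +
      8 * a i * dl i j * pd [i, j, k, k] p + 8 * a i * dl i k * pd [i, j, j, k] p +
      8 * a j * dl j k * pd [i, i, j, k] p := by
  have h5 : ∀ (x : Fin n) (s : List (Fin n)), s.length = 5 → b x * pd s p = 0 := by
    intro x s hs
    rcases hp with hp | hp
    · rw [pd_of_deg s p (by omega), mul_zero]
    · simp [hp]
  have h1 := h5 i [i, j, j, k, k] rfl
  have h2 := h5 j [i, i, j, k, k] rfl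
  have h3 := h5 k [i, i, j, j, k] rfl
  have d : ∀ x : Fin n, dl x x = 1 := fun x => by simp [dl]
  simp only [pd] at h1 h2 h3
  simp only [pd_qmul, pd_Xmul, pd_Xnil, pd_qnil, d]
  simp only [pd]
  linear_combination 2 * h1 + 2 * h2 + 2 * h3

lemma Q_eq {n : ℕ} : (∑ i : Fin n, X i ^ 2 : MvPolynomial (Fin n) ℝ) = qpoly 1 0 := by
  simp [qpoly]

lemma pd_Qj {n : ℕ} (s : List (Fin n)) (j : ℕ) (h : s.length < 2 * j) :
    pd s ((∑ i : Fin n, X i ^ 2 : MvPolynomial (Fin n) ℝ) ^ j) = 0 := by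
  rw [pd_eq]
  have hh : ((∑ i : Fin n, X i ^ 2 : MvPolynomial (Fin n) ℝ) ^ j).IsHomogeneous (2 * j) := by
    apply IsHomogeneous.pow
    apply IsHomogeneous.sum; intro i _
    simpa using (isHomogeneous_X ℝ i).pow 2
  rw [hh.coeff_eq_zero, mul_zero]
  rw [Finsupp.degree_eq_sum]
  have : ∑ i, (toF (cnt s)) i = s.length := cnt_sum s
  omega

lemma Qd1 {n : ℕ} (i : Fin n) : pd [i] (1 : MvPolynomial (Fin n) ℝ) = 0 := by
  apply pd_of_deg; simp

lemma pd_one {n : ℕ} (s : List (Fin n)) (h : 0 < s.length) :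
    pd s (1 : MvPolynomial (Fin n) ℝ) = 0 := by
  apply pd_of_deg; simpa using h

lemma pd_PT1 {n : ℕ} (γ : Measure (E n)) (ε : ℝ) (K : ℕ) (hK : 1 ≤ K) (i : Fin n) :
    pd [i] (PT γ ε K) = 2 * ε * mom γ [i] := by
  rw [pd_PT _ _ _ _ (by simpa using hK), Finset.sum_eq_zero]
  · simp
  · intro j _
    rcases Nat.eq_zero_or_pos j with rfl | hj
    · simp [pd_one]
    · rw [pd_Qj _ _ (by simp; omega), mul_zero]

lemma pdQ2 {n : ℕ} (i j : Fin n) : pd [i, j] (qpoly 1 0 : MvPolynomial (Fin n) ℝ) = 2 * dl i j := by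
  have := pd2 1 0 i j 1
  rw [mul_one] at this
  rw [this]
  simp [pd]

lemma pd_PT2 {n : ℕ} (γ : Measure (E n)) (ε : ℝ) (K : ℕ) (hK : 2 ≤ K) (i j : Fin n) :
    pd [i, j] (PT γ ε K) = 4 * ε ^ 2 * mom γ [i, j] - 2 * ε ^ 2 * dl i j := by
  rw [pd_PT _ _ _ _ (by simpa using hK), Finset.sum_eq_single 1]
  · simp only [Q_eq, pow_one, pdQ2]; simp; ring
  · intro j _ hj
    rcases Nat.eq_zero_or_pos j with rfl | hj
    · simp [pd_one]
    · rw [pd_Qj _ _ (by simp; omega), mul_zero]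
  · intro h; simp at h; omega

lemma pdQ_odd {n : ℕ} (i j k : Fin n) (p : ℕ) :
    pd [i, j, k] ((∑ i : Fin n, X i ^ 2 : MvPolynomial (Fin n) ℝ) ^ p) = 0 := by
  rcases p with _ | _ | p
  · simp [pd_one]
  · have := pd3 1 0 i j k 1
    rw [mul_one] at this
    rw [zero_add, pow_one, Q_eq, this]
    simp [pd_one]
  · rw [pd_Qj _ _ (by simp; omega)]

lemma pd_PT3 {n : ℕ} (γ : Measure (E n)) (ε : ℝ) (K : ℕ) (hK : 3 ≤ K) (i j k : Fin n) :
    pd [i, j, k] (PT γ ε K) = 8 * ε ^ 3 * mom γ [i, j, k] := by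
  rw [pd_PT _ _ _ _ (by simpa using hK), Finset.sum_eq_zero]
  · simp only [List.length_cons, List.length_nil]; ring
  · intro p _
    rw [pdQ_odd, mul_zero]

lemma pdQ4 {n : ℕ} (i j k l : Fin n) : pd [i, j, k, l] (qpoly 1 0 ^ 2 : MvPolynomial (Fin n) ℝ) =
    8 * (dl i j * dl k l + dl i k * dl j l + dl i l * dl j k) := by
  rw [pow_two, pd4]
  simp only [pdQ2, Pi.one_apply, Pi.zero_apply]
  ring

lemma pd_PT4 {n : ℕ} (γ : Measure (E n)) (ε : ℝ) (K : ℕ) (hK : 4 ≤ K) (i j k l : Fin n) :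
    pd [i, j, k, l] (PT γ ε K) = 16 * ε ^ 4 * mom γ [i, j, k, l] -
      4 * ε ^ 4 * (dl i j * dl k l + dl i k * dl j l + dl i l * dl j k) := by
  rw [pd_PT _ _ _ _ (by simpa using hK), Finset.sum_eq_single 2]
  · simp only [Q_eq, pdQ4]; simp [Nat.factorial]; ring
  · intro p _ hp
    rcases p with _ | _ | p
    · simp [pd_one]
    · have := pd4 1 0 i j k l 1
      rw [mul_one] at this
      rw [zero_add, pow_one, Q_eq, this]
      simp [pd_one]
    · rw [pd_Qj _ _ (by simp; omega), mul_zero]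
  · intro h; simp at h; omega

lemma pdQ6 {n : ℕ} (i j k : Fin n) : pd [i, i, j, j, k, k] (qpoly 1 0 ^ 3 : MvPolynomial (Fin n) ℝ) =
    48 * (1 + 2 * dl i j + 2 * dl i k + 2 * dl j k + 8 * dl i j * dl j k) := by
  have d : ∀ x : Fin n, dl x x = 1 := fun x => by simp [dl]
  rw [pow_succ', pd6 _ _ _ _ _ _ (Or.inr rfl)]
  simp only [pdQ4, Pi.one_apply, d]
  by_cases h1 : i = j
  · subst h1
    by_cases h2 : i = k
    · subst h2; simp only [d]; ring
    · simp [dl, h2]; ring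
  · by_cases h2 : i = k
    · subst h2; simp [dl, h1, Ne.symm h1]; ring
    · by_cases h3 : j = k
      · subst h3; simp [dl, h1]; ring
      · simp [dl, h1, h2, h3]; ring

lemma pd_PT6 {n : ℕ} (γ : Measure (E n)) (ε : ℝ) (i j k : Fin n) :
    pd [i, i, j, j, k, k] (PT γ ε 6) = 64 * ε ^ 6 * mom γ [i, i, j, j, k, k] -
      8 * ε ^ 6 * (1 + 2 * dl i j + 2 * dl i k + 2 * dl j k + 8 * dl i j * dl j k) := by
  rw [pd_PT _ _ _ _ (by simp), Finset.sum_eq_single 3]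
  · simp only [Q_eq, pdQ6]; simp [Nat.factorial]; ring
  · intro p hp1 hp
    have : p = 0 ∨ p = 1 ∨ p = 2 := by simp at hp1; omega
    rcases this with rfl | rfl | rfl
    · simp [pd_one]
    · rw [pd_of_deg, mul_zero]
      have : (qpoly 1 0 : MvPolynomial (Fin n) ℝ).totalDegree ≤ 2 := by
        rw [← Q_eq]; apply totalDegree_finsetSum_le; intro i _; rw [totalDegree_X_pow]
      rw [pow_one, Q_eq]; simp; omega
    · rw [pd_of_deg, mul_zero]
      have : (qpoly 1 0 : MvPolynomial (Fin n) ℝ).totalDegree ≤ 2 := by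
        rw [← Q_eq]; apply totalDegree_finsetSum_le; intro i _; rw [totalDegree_X_pow]
      rw [Q_eq]
      have := totalDegree_pow (qpoly 1 0 : MvPolynomial (Fin n) ℝ) 2
      simp; omega
  · intro h; simp at h
end

section
open MvPolynomial Asymptotics

lemma abs_list_le {n : ℕ} (s : List (Fin n)) (z : E n) :
    |(s.map (fun i => z i)).prod| ≤ ‖z‖ ^ s.length := by
  rw [cnt_prod, ← cnt_sum]; exact abs_mono_le _ z

lemma GS.int_list {n m : ℕ} {S : Set (E n)} {ε : ℝ} {γ : Measure (E n)} (h : GS m S ε γ)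
    (s : List (Fin n)) : Integrable (fun z : E n => (s.map (fun i => z i)).prod) γ := by
  simp_rw [cnt_prod]; exact h.int_mono _

lemma GS.mom_bound {n m : ℕ} {S : Set (E n)} {ε : ℝ} {γ : Measure (E n)} (h : GS m S ε γ)
    (s : List (Fin n)) : |mom γ s| ≤ Mke m s.length 0 := by
  rw [← h.nval, mom, ← Real.norm_eq_abs]
  apply norm_integral_le_of_norm_le (h.nint _ _)
  exact Eventually.of_forall fun z => by simpa using abs_list_le s z

lemma GS.mom_norm {n m : ℕ} {S : Set (E n)} {ε : ℝ} {γ : Measure (E n)} (h : GS m S ε γ)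
    (s : List (Fin n)) : ∑ k, mom γ (k :: k :: s) =
      ∫ z : E n, ‖z‖ ^ 2 * (s.map (fun i => z i)).prod ∂γ := by
  unfold mom
  rw [← integral_finsetSum _ (fun k _ => h.int_list _)]
  congr 1; ext z
  rw [EuclideanSpace.norm_sq_eq, Finset.sum_mul]
  apply Finset.sum_congr rfl; intro k _
  simp; ring

lemma GS.mom_supp {n m : ℕ} {S : Set (E n)} {ε : ℝ} (hε : 0 < ε) {γ : Measure (E n)}
    (h : GS m S ε γ) (a b : Fin n → ℝ) (hq : ∀ x ∈ S, eval x.ofLp (qpoly a b) = 0)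
    (s : List (Fin n)) :
    ∑ k, a k * mom γ (k :: k :: s) + ε * ∑ k, b k * mom γ (k :: s) = 0 := by
  unfold mom
  simp_rw [← integral_const_mul]
  rw [← integral_finsetSum _ (fun k _ => (h.int_list _).const_mul _),
    ← integral_finsetSum _ (fun k _ => (h.int_list _).const_mul _), ← integral_const_mul,
    ← integral_add (integrable_finsetSum _ (fun k _ => (h.int_list _).const_mul _))
      ((integrable_finsetSum _ (fun k _ => (h.int_list _).const_mul _)).const_mul _)]
  rw [← integral_zero (E n) ℝ (μ := γ)]
  apply integral_congr_ae
  filter_upwards [h.supp] with z hz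
  have := hq _ hz
  simp only [qpoly, map_add, map_sum, map_mul, eval_C, map_pow, eval_X, PiLp.smul_apply,
    smul_eq_mul] at this
  have e1 : ∑ k, a k * (ε⁻¹ * z k) ^ 2 = (ε⁻¹) ^ 2 * ∑ k, a k * z k ^ 2 := by
    rw [Finset.mul_sum]; apply Finset.sum_congr rfl; intro k _; ring
  have e2 : ∑ k, b k * (ε⁻¹ * z k) = ε⁻¹ * ∑ k, b k * z k := by
    rw [Finset.mul_sum]; apply Finset.sum_congr rfl; intro k _; ring
  rw [e1, e2] at this
  have e3 : ∑ k, a k * z k ^ 2 + ε * ∑ k, b k * z k = 0 := by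
    field_simp at this
    linarith
  simp only [List.map_cons, List.prod_cons]
  have e4 : ∑ k, a k * (z k * (z k * (s.map (fun i => z i)).prod)) =
      (∑ k, a k * z k ^ 2) * (s.map (fun i => z i)).prod := by
    rw [Finset.sum_mul]; apply Finset.sum_congr rfl; intro k _; ring
  have e5 : ∑ k, b k * (z k * (s.map (fun i => z i)).prod) =
      (∑ k, b k * z k) * (s.map (fun i => z i)).prod := by
    rw [Finset.sum_mul]; apply Finset.sum_congr rfl; intro k _; ring
  rw [e4, e5, ← mul_assoc, ← add_mul, e3, zero_mul]

/-- weight polynomial -/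
def PW {n : ℕ} (m : ℕ) (γ : Measure (E n)) (ε : ℝ) : MvPolynomial (Fin n) ℝ :=
  ∑ i, C (2 * ε * (∑ k, mom γ [k, k, i] - mom γ [i])) * X i +
  ∑ i, ∑ j, C (2 * ε ^ 2 * (∑ k, mom γ [k, k, i, j] - 2 * mom γ [i, j])) * (X i * (X j * 1)) +
  C (ε ^ 2 * (1 - m / 2)) * qpoly 1 0

lemma PW_pd1 {n m : ℕ} (γ : Measure (E n)) (ε : ℝ) (i : Fin n) :
    pd [i] (PW m γ ε) = 2 * ε * (∑ k, mom γ [k, k, i] - mom γ [i]) := by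
  have h1 := pd1 1 0 i 1
  rw [mul_one] at h1
  simp only [PW, pd_add, pd_sum, pd_C_mul, h1]
  have : ∀ j : Fin n, pd [i] (X j) = dl j i := by
    intro j
    have := pd_Xmul j i [] 1
    rw [mul_one, pd_Xnil] at this
    rw [this]; simp [pd]
  simp only [this, pd_Xmul, pd_Xnil]
  simp [dl]

lemma PW_pd2 {n m : ℕ} (γ : Measure (E n)) (ε : ℝ) (i j : Fin n) :
    pd [i, j] (PW m γ ε) = 4 * ε ^ 2 * (∑ k, mom γ [k, k, i, j] - 2 * mom γ [i, j]) +
      2 * ε ^ 2 * (1 - m / 2) * dl i j := by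
  simp only [PW, pd_add, pd_sum, pd_C_mul, pdQ2]
  have h1 : ∀ k : Fin n, pd [i, j] (X k : MvPolynomial (Fin n) ℝ) = 0 := by
    intro k; apply pd_of_deg; simp
  have h2 : ∀ k l : Fin n, pd [i, j] (X k * (X l * 1) : MvPolynomial (Fin n) ℝ) =
      dl k i * dl l j + dl k j * dl l i := by
    intro k l
    have := pd_Xmul l i [] 1
    rw [pd_Xnil] at this
    simp only [pd_Xmul, pd_Xnil]
    rw [show pd [] ((pderiv i) (X l * 1)) = pd [i] (X l * 1 : MvPolynomial (Fin n) ℝ) from rfl, this]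
    simp [pd]
  simp only [h1, h2]
  simp only [dl, mul_add, Finset.sum_add_distrib, mul_ite, mul_one, mul_zero,
    Finset.sum_ite_eq', Finset.mem_univ, if_true, Finset.sum_const_zero]
  simp
  have e : mom γ [j, i] = mom γ [i, j] := mom_perm (List.Perm.swap _ _ _) _
  have e2 : ∀ k, mom γ [k, k, j, i] = mom γ [k, k, i, j] := fun k =>
    mom_perm (((List.Perm.swap _ _ _).cons _).cons _) _
  simp only [e, e2]
  split_ifs <;> ring

lemma PW_deg {n m : ℕ} (γ : Measure (E n)) (ε : ℝ) : (PW m γ ε).totalDegree ≤ 2 := by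
  have h : ∀ (c : ℝ) (p : MvPolynomial (Fin n) ℝ) (_ : p.totalDegree ≤ 2),
      (C c * p).totalDegree ≤ 2 := by
    intro c p hp
    refine (totalDegree_mul _ _).trans ?_
    rw [totalDegree_C, zero_add]; exact hp
  refine (totalDegree_add _ _).trans (max_le ((totalDegree_add _ _).trans (max_le ?_ ?_)) ?_)
  · apply totalDegree_finsetSum_le; intro i _; apply h; simp
  · apply totalDegree_finsetSum_le; intro i _
    apply totalDegree_finsetSum_le; intro j _; apply h
    refine (totalDegree_mul _ _).trans ?_
    simp
  · apply h
    rw [← Q_eq]; apply totalDegree_finsetSum_le; intro i _; rw [totalDegree_X_pow]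

lemma PW_eval {n m : ℕ} {S : Set (E n)} {ε : ℝ} {γ : Measure (E n)} (h : GS m S ε γ)
    (x : E n) : eval x.ofLp (PW m γ ε) =
      ∫ z : E n, ((‖z‖ ^ 2 - 1) * (2 * ε * ⟪z, x⟫) + (‖z‖ ^ 2 / 2 - 1) * (2 * ε * ⟪z, x⟫) ^ 2) ∂γ
      + ε ^ 2 * (1 - m / 2) * ‖x‖ ^ 2 := by
  have := h.prob
  have hin : ∀ z : E n, ⟪z, x⟫ = ∑ i, z i * x i := by
    intro z; simp [PiLp.inner_apply, mul_comm]
  have hI : ∀ s : List (Fin n), Integrable (fun z : E n => ‖z‖ ^ 2 * (s.map (fun i => z i)).prod) γ := by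
    intro s
    have hc : Continuous (fun z : E n => (s.map (fun i => z i)).prod) := by
      simp_rw [cnt_prod]; fun_prop
    apply h.int_of_le (by fun_prop) (2 + s.length) 0 1
    intro z
    rw [abs_mul, abs_of_nonneg (by positivity), one_mul, zero_mul, Real.exp_zero, mul_one, pow_add]
    gcongr
    exact abs_list_le s z
  have e1 : ∀ z : E n, ((‖z‖ ^ 2 - 1) * (2 * ε * ⟪z, x⟫) +
      (‖z‖ ^ 2 / 2 - 1) * (2 * ε * ⟪z, x⟫) ^ 2) =
      ∑ i, 2 * ε * x i * (‖z‖ ^ 2 * ([i].map (fun i => z i)).prod - ([i].map (fun i => z i)).prod) +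
      ∑ i, ∑ j, 2 * ε ^ 2 * (x i * x j) * (‖z‖ ^ 2 * ([i, j].map (fun i => z i)).prod -
        2 * ([i, j].map (fun i => z i)).prod) := by
    intro z
    have f1 : ∑ i, 2 * ε * x i * (‖z‖ ^ 2 * ([i].map (fun i => z i)).prod -
        ([i].map (fun i => z i)).prod) = 2 * ε * (‖z‖ ^ 2 - 1) * ∑ i, z i * x i := by
      rw [Finset.mul_sum]; apply Finset.sum_congr rfl; intro i _; simp; ring
    have f2 : ∑ i, ∑ j, 2 * ε ^ 2 * (x i * x j) * (‖z‖ ^ 2 * ([i, j].map (fun i => z i)).prod -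
        2 * ([i, j].map (fun i => z i)).prod) =
        2 * ε ^ 2 * (‖z‖ ^ 2 - 2) * ((∑ i, z i * x i) * ∑ j, z j * x j) := by
      rw [Finset.sum_mul_sum, Finset.mul_sum]; apply Finset.sum_congr rfl; intro i _
      rw [Finset.mul_sum]; apply Finset.sum_congr rfl; intro j _
      simp; ring
    rw [f1, f2, hin]; ring
  have i1 : ∀ i, Integrable (fun z : E n => 2 * ε * x i * (‖z‖ ^ 2 * ([i].map (fun i => z i)).prod -
      ([i].map (fun i => z i)).prod)) γ := fun i => ((hI _).sub (h.int_list _)).const_mul _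
  have i2 : ∀ i j, Integrable (fun z : E n => 2 * ε ^ 2 * (x i * x j) *
      (‖z‖ ^ 2 * ([i, j].map (fun i => z i)).prod - 2 * ([i, j].map (fun i => z i)).prod)) γ :=
    fun i j => ((hI _).sub ((h.int_list _).const_mul _)).const_mul _
  rw [integral_congr_ae (Eventually.of_forall e1), integral_add
    (integrable_finsetSum _ fun i _ => i1 i)
    (integrable_finsetSum _ fun i _ => integrable_finsetSum _ fun j _ => i2 i j),
    integral_finsetSum _ (fun i _ => i1 i), integral_finsetSum _
    (fun i _ => integrable_finsetSum _ fun j _ => i2 i j)]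
  simp_rw [integral_finsetSum _ (fun j _ => i2 _ j), integral_const_mul]
  simp only [PW, map_add, map_sum, map_mul, eval_C, eval_X, h.mom_norm]
  congr 1
  · congr 1
    · apply Finset.sum_congr rfl; intro i _
      rw [integral_sub (hI _) (h.int_list _)]
      simp only [mom]; ring
    · apply Finset.sum_congr rfl; intro i _
      apply Finset.sum_congr rfl; intro j _
      rw [integral_sub (hI _) ((h.int_list _).const_mul _), integral_const_mul]
      simp only [mom, map_one]; ring
  · rw [← Q_eq, EuclideanSpace.norm_sq_eq]; simp

lemma PW_bigO {n m : ℕ} {S : Set (E n)} {γ : ℝ → Measure (E n)}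
    (h : ∀ ε, 0 < ε → GS m S ε (γ ε)) {x : E n} (hx : x ∈ S) :
    (fun ε => eval x.ofLp (PW m (γ ε) ε)) =O[𝓝[>] 0] (fun ε => ε ^ 3) := by
  set N := ‖x‖ with hN
  set C1 := (2 * N) ^ 3 * Mke m 5 (2 * N) + (2 * N) ^ 3 * Mke m 3 (2 * N) +
    N ^ 2 * (2 * N) * Mke m 1 (2 * N)
  set C2 := (m / 2 : ℝ) * (N ^ 4 * Real.exp (N ^ 2))
  apply IsBigO.of_bound (C1 + C2)
  have : ∀ᶠ ε : ℝ in 𝓝[>] 0, ε ∈ Ioo (0:ℝ) 1 := Ioo_mem_nhdsGT one_pos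
  filter_upwards [this] with ε hε
  have hε0 := hε.1
  have hN0 : 0 ≤ N := norm_nonneg x
  have G := h ε hε0
  have := G.prob
  rw [PW_eval G]
  have h4 := G.g4 x hx
  have hle : ∀ z : E n, |2 * ε * ⟪z, x⟫| ≤ (2 * ε * N) * ‖z‖ := by
    intro z
    rw [abs_mul, abs_of_pos (by positivity : 0 < 2 * ε)]
    have := abs_real_inner_le_norm z x
    nlinarith [hε0]
  have hle2 : ∀ z : E n, Real.exp |2 * ε * ⟪z, x⟫| ≤ Real.exp (2 * N * ‖z‖) := by
    intro z
    apply Real.exp_le_exp.2 ((hle z).trans ?_)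
    gcongr
    nlinarith [hε.2]
  have ie : ∀ k : ℕ, Integrable (fun z : E n => ‖z‖ ^ k * Real.exp (2 * ε * ⟪z, x⟫)) (γ ε) := by
    intro k
    apply G.int_of_le (by fun_prop) k (2 * N) 1
    intro z
    rw [one_mul, abs_mul, abs_of_nonneg (by positivity), abs_of_pos (Real.exp_pos _)]
    exact mul_le_mul_of_nonneg_left ((Real.exp_le_exp.2 (le_abs_self _)).trans (hle2 z))
      (by positivity)
  have ii : Integrable (fun z : E n => (‖z‖ ^ 2 - 2 * ε * ⟪z, x⟫ + ε ^ 2 * N ^ 2) *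
      Real.exp (2 * ε * ⟪z, x⟫)) (γ ε) := by
    have j1 : Integrable (fun z : E n => (2 * ε * ⟪z, x⟫) * Real.exp (2 * ε * ⟪z, x⟫)) (γ ε) := by
      apply G.int_of_le (by fun_prop) 1 (2 * N) (2 * ε * N)
      intro z
      rw [abs_mul, abs_of_pos (Real.exp_pos _), pow_one, ← mul_assoc]
      exact mul_le_mul (hle z) ((Real.exp_le_exp.2 (le_abs_self _)).trans (hle2 z))
        (by positivity) (by positivity)
    refine (((ie 2).sub j1).add ((ie 0).const_mul (ε ^ 2 * N ^ 2))).congr ?_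
    filter_upwards with z
    simp only [Pi.add_apply, Pi.sub_apply]; ring
  have i2 : Integrable (fun z : E n => ‖z‖ ^ 2) (γ ε) := G.int_pow 2
  have iL : Integrable (fun z : E n => (‖z‖ ^ 2 - 1) * (2 * ε * ⟪z, x⟫) +
      (‖z‖ ^ 2 / 2 - 1) * (2 * ε * ⟪z, x⟫) ^ 2) (γ ε) := by
    have j : ∀ k l : ℕ, Integrable (fun z : E n => ‖z‖ ^ k * (2 * ε * ⟪z, x⟫) ^ l) (γ ε) := by
      intro k l
      apply G.int_of_le (by fun_prop) (k + l) 0 ((2 * ε * N) ^ l)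
      intro z
      rw [abs_mul, abs_pow, abs_pow, abs_norm, zero_mul, Real.exp_zero, mul_one]
      calc _ ≤ ‖z‖ ^ k * ((2 * ε * N) * ‖z‖) ^ l := by gcongr; exact hle z
        _ = _ := by ring
    refine ((((j 2 1).sub (j 0 1)).add ((j 2 2).const_mul (1/2))).sub (j 0 2)).congr ?_
    filter_upwards with z
    simp only [Pi.add_apply, Pi.sub_apply]; ring
  have key : ∀ z : E n, ‖(‖z‖ ^ 2 - 2 * ε * ⟪z, x⟫ + ε ^ 2 * N ^ 2) * Real.exp (2 * ε * ⟪z, x⟫) -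
      (‖z‖ ^ 2 + ε ^ 2 * N ^ 2 + ((‖z‖ ^ 2 - 1) * (2 * ε * ⟪z, x⟫) +
      (‖z‖ ^ 2 / 2 - 1) * (2 * ε * ⟪z, x⟫) ^ 2))‖ ≤
      ε ^ 3 * ((2 * N) ^ 3 * (‖z‖ ^ 5 * Real.exp (2 * N * ‖z‖)) +
        (2 * N) ^ 3 * (‖z‖ ^ 3 * Real.exp (2 * N * ‖z‖)) +
        N ^ 2 * (2 * N) * (‖z‖ ^ 1 * Real.exp (2 * N * ‖z‖))) := by
    intro z
    have l1 := hle z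
    have l2 := hle2 z
    generalize 2 * ε * ⟪z, x⟫ = t at l1 l2 ⊢
    set ex := Real.exp (2 * N * ‖z‖)
    have t1 := exp_taylor_le t 1
    have t2 := exp_taylor_le t 2
    have t3 := exp_taylor_le t 3
    simp only [Finset.sum_range_succ, Finset.sum_range_zero, Nat.factorial] at t1 t2 t3
    norm_num at t1 t2 t3
    have b : ∀ k : ℕ, |t| ^ k * Real.exp |t| ≤ ((2 * ε * N) * ‖z‖) ^ k * ex := by
      intro k; gcongr
    have b1 := t1.trans (by simpa using b 1)
    have b2 := t2.trans (by simpa using b 2)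
    have b3 := t3.trans (b 3)
    have e : (‖z‖ ^ 2 - t + ε ^ 2 * N ^ 2) * Real.exp t -
      (‖z‖ ^ 2 + ε ^ 2 * N ^ 2 + ((‖z‖ ^ 2 - 1) * t + (‖z‖ ^ 2 / 2 - 1) * t ^ 2)) =
      ‖z‖ ^ 2 * (Real.exp t - (1 + t + t ^ 2 / 2)) - t * (Real.exp t - (1 + t)) +
        ε ^ 2 * N ^ 2 * (Real.exp t - 1) := by ring
    rw [e, Real.norm_eq_abs]
    refine (abs_add_le _ _).trans ((add_le_add_left (abs_sub _ _) _).trans ?_)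
    rw [abs_mul, abs_mul, abs_mul (ε ^ 2 * N ^ 2), abs_of_nonneg (by positivity : 0 ≤ ‖z‖ ^ 2),
      abs_of_nonneg (by positivity : 0 ≤ ε ^ 2 * N ^ 2)]
    calc _ ≤ ‖z‖ ^ 2 * ((2 * ε * N * ‖z‖) ^ 3 * ex) + (2 * ε * N * ‖z‖) *
          ((2 * ε * N * ‖z‖) ^ 2 * ex) + ε ^ 2 * N ^ 2 * ((2 * ε * N * ‖z‖) * ex) := by gcongr
      _ = _ := by ring
  have i3 : Integrable (fun z : E n => ‖z‖ ^ 2 + ε ^ 2 * N ^ 2) (γ ε) :=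
    i2.add (integrable_const _)
  have i4 : Integrable (fun z : E n => ‖z‖ ^ 2 + ε ^ 2 * N ^ 2 + ((‖z‖ ^ 2 - 1) * (2 * ε * ⟪z, x⟫) +
      (‖z‖ ^ 2 / 2 - 1) * (2 * ε * ⟪z, x⟫) ^ 2)) (γ ε) := i3.add iL
  have k5 := (G.nint 5 (2*N)).const_mul ((2 * N) ^ 3)
  have k3 := (G.nint 3 (2*N)).const_mul ((2 * N) ^ 3)
  have k1 := (G.nint 1 (2*N)).const_mul (N ^ 2 * (2 * N))
  have k53 : Integrable (fun z : E n => (2 * N) ^ 3 * (‖z‖ ^ 5 * Real.exp (2 * N * ‖z‖)) +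
        (2 * N) ^ 3 * (‖z‖ ^ 3 * Real.exp (2 * N * ‖z‖))) (γ ε) := k5.add k3
  have k531 : Integrable (fun z : E n => (2 * N) ^ 3 * (‖z‖ ^ 5 * Real.exp (2 * N * ‖z‖)) +
        (2 * N) ^ 3 * (‖z‖ ^ 3 * Real.exp (2 * N * ‖z‖)) + N ^ 2 * (2 * N) *
        (‖z‖ ^ 1 * Real.exp (2 * N * ‖z‖))) (γ ε) := k53.add k1
  have F := norm_integral_le_of_norm_le (k531.const_mul (ε ^ 3)) (Eventually.of_forall key)
  rw [integral_sub ii i4, h4, integral_add i3 iL, integral_add i2 (integrable_const _),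
    integral_const_mul (ε ^ 3), integral_add k53 k1, integral_add k5 k3] at F
  simp only [integral_const_mul, G.nval, G.m2, integral_const, probReal_univ, one_smul] at F
  rw [Real.norm_eq_abs, ← hN] at F
  have B : |Real.exp (ε ^ 2 * N ^ 2) - (1 + ε ^ 2 * N ^ 2)| ≤ N ^ 4 * Real.exp (N ^ 2) * ε ^ 3 := by
    have := exp_taylor_le (ε ^ 2 * N ^ 2) 2
    simp only [Finset.sum_range_succ, Finset.sum_range_zero, Nat.factorial] at this
    norm_num at this
    refine this.trans ?_
    have h1 : ε ^ 4 ≤ ε ^ 3 := pow_le_pow_of_le_one hε0.le hε.2.le (by omega)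
    have h2 : Real.exp (ε ^ 2 * N ^ 2) ≤ Real.exp (N ^ 2) := by
      apply Real.exp_le_exp.2
      have : ε ^ 2 ≤ 1 := pow_le_one₀ hε0.le hε.2.le
      nlinarith [sq_nonneg N]
    calc _ = ε ^ 4 * N ^ 4 * Real.exp (ε ^ 2 * N ^ 2) := by ring
      _ ≤ ε ^ 3 * N ^ 4 * Real.exp (N ^ 2) := by gcongr
      _ = _ := by ring
  rw [Real.norm_eq_abs, Real.norm_eq_abs, abs_of_nonneg (by positivity : 0 ≤ ε ^ 3)]
  rw [abs_le] at *
  have hm : (0:ℝ) ≤ m / 2 := by positivity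
  have B1 := mul_le_mul_of_nonneg_left B.1 hm
  have B2 := mul_le_mul_of_nonneg_left B.2 hm
  simp only [C1, C2]
  constructor <;> nlinarith [F.1, F.2, B1, B2]
end

section
open MvPolynomial Asymptotics

lemma ultra_lim {α : Type*} (U : Ultrafilter α) {f : α → ℝ} {B : ℝ} (h : ∀ᶠ x in U, |f x| ≤ B) :
    ∃ c, Tendsto f U (𝓝 c) := by
  have : (U.map f : Filter ℝ) ≤ 𝓟 (Icc (-B) B) := by
    rw [le_principal_iff]
    exact h.mono fun x hx => abs_le.1 hx
  obtain ⟨c, -, hc⟩ := isCompact_Icc.ultrafilter_le_nhds _ this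
  exact ⟨c, hc⟩

lemma ultra_bigO {U : Ultrafilter ℝ} (hU : (U : Filter ℝ) ≤ 𝓝[>] 0) {f : ℝ → ℝ} {k : ℕ}
    (h : f =O[𝓝[>] 0] (fun ε => ε ^ k)) : ∃ c, Tendsto (fun ε => f ε / ε ^ k) U (𝓝 c) := by
  obtain ⟨B, hB⟩ := (h.mono hU).bound
  have h0 : ∀ᶠ ε : ℝ in U, 0 < ε := hU self_mem_nhdsWithin
  apply ultra_lim U (B := B)
  filter_upwards [hB, h0] with ε h1 h2
  rw [abs_div, div_le_iff₀ (by positivity)]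
  simpa using h1

lemma lim_id {Y : Type*} [TopologicalSpace Y] {U : Ultrafilter ℝ} {F : ℝ → Y} {y : Y}
    (hF : Tendsto F U (𝓝 y)) {P : Y → ℝ} (hP : Continuous P) (h : ∀ᶠ ε in U, P (F ε) = 0) :
    P y = 0 := by
  have h1 := (hP.tendsto y).comp hF
  have h2 : Tendsto (P ∘ F) U (𝓝 0) := by
    refine Tendsto.congr' ?_ tendsto_const_nhds
    filter_upwards [h] with ε hε; exact hε.symm
  exact tendsto_nhds_unique h1 h2

lemma pd_bigO {n : ℕ} {k : ℕ} {p q : ℝ → MvPolynomial (Fin n) ℝ}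
    (h : ∀ d, (fun ε => coeff d (p ε) - coeff d (q ε)) =O[𝓝[>] 0] (fun ε => ε ^ k))
    (s : List (Fin n)) : (fun ε => pd s (p ε) - pd s (q ε)) =O[𝓝[>] (0:ℝ)] (fun ε => ε ^ k) := by
  simp_rw [pd_eq, ← mul_sub]
  exact (h _).const_mul_left _

lemma sum_dl {n : ℕ} (f : Fin n → ℝ) (i : Fin n) : ∑ k, f k * dl k i = f i := by
  simp [dl]

/-- Data: asymptotic expansions along an ultrafilter. -/
structure ASY (n m : ℕ) (a b : Fin n → ℝ) (U : Ultrafilter ℝ) (M : List (Fin n) → ℝ → ℝ)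
    (u0 eta : ℝ → ℝ) (u1 : Fin n → ℝ → ℝ) (u2 : Fin n → Fin n → ℝ → ℝ)
    (e w : List (Fin n) → ℝ → ℝ) : Prop where
  pos : ∀ᶠ ε : ℝ in U, 0 < ε
  lim0 : Tendsto (fun ε : ℝ => ε) U (𝓝 0)
  Mlim : ∀ s, ∃ c, Tendsto (M s) U (𝓝 c)
  elim : ∀ s, ∃ c, Tendsto (e s) U (𝓝 c)
  wlim : ∀ s, ∃ c, Tendsto (w s) U (𝓝 c)
  symm : ∀ i j ε, u2 i j ε = u2 j i ε
  E1 : ∀ i, ∀ᶠ ε : ℝ in U, 2 * ε * M [i] ε = b i * u0 ε + ε ^ 5 * e [i] ε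
  E2 : ∀ i j, ∀ᶠ ε : ℝ in U, 4 * ε ^ 2 * M [i, j] ε - 2 * ε ^ 2 * dl i j =
    2 * a i * dl i j * u0 ε + b i * u1 j ε + b j * u1 i ε + ε ^ 5 * e [i, j] ε
  E3 : ∀ i j k, ∀ᶠ ε : ℝ in U, 8 * ε ^ 3 * M [i, j, k] ε = 2 * a i * dl i j * u1 k ε +
    2 * a i * dl i k * u1 j ε + 2 * a j * dl j k * u1 i ε + b i * u2 j k ε + b j * u2 i k ε +
      b k * u2 i j ε + ε ^ 5 * e [i, j, k] ε
  E4 : ∀ i j k l, ∀ᶠ ε : ℝ in U, 16 * ε ^ 4 * M [i, j, k, l] ε -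
      4 * ε ^ 4 * (dl i j * dl k l + dl i k * dl j l + dl i l * dl j k) =
      2 * a i * dl i j * u2 k l ε + 2 * a i * dl i k * u2 j l ε + 2 * a i * dl i l * u2 j k ε +
      2 * a j * dl j k * u2 i l ε + 2 * a j * dl j l * u2 i k ε + 2 * a k * dl k l * u2 i j ε +
      ε ^ 5 * e [i, j, k, l] ε
  SU : ∀ s, ∀ᶠ ε : ℝ in U, ∑ k, a k * M (k :: k :: s) ε + ε * ∑ k, b k * M (k :: s) ε = 0
  T2 : ∀ᶠ ε : ℝ in U, ∑ k, M [k, k] ε = m / 2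
  T4 : ∀ᶠ ε : ℝ in U, ∑ i, ∑ k, M [k, k, i, i] ε = m / 2 * (m / 2 + 1)
  W1 : ∀ i, ∀ᶠ ε : ℝ in U, 2 * ε * (∑ k, M [k, k, i] ε - M [i] ε) = b i * eta ε + ε ^ 3 * w [i] ε
  W2 : ∀ i, ∀ᶠ ε : ℝ in U, 4 * ε ^ 2 * (∑ k, M [k, k, i, i] ε - 2 * M [i, i] ε) +
    2 * ε ^ 2 * (1 - m / 2) = 2 * a i * eta ε + ε ^ 3 * w [i, i] ε

lemma exists_ultra : ∃ U : Ultrafilter ℝ, (U : Filter ℝ) ≤ 𝓝[>] 0 :=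
  Ultrafilter.exists_le _

lemma ASY_exists {n m : ℕ} {S : Set (E n)} {γ : ℝ → Measure (E n)}
    (h : ∀ ε, 0 < ε → GS m S ε (γ ε)) (a b : Fin n → ℝ) (hdeg : (qpoly a b).totalDegree = 2)
    (hq : ∀ x ∈ S, eval x.ofLp (qpoly a b) = 0)
    (hdiv : ∀ p : MvPolynomial (Fin n) ℝ, (∀ x ∈ S, eval x.ofLp p = 0) → qpoly a b ∣ p) :
    ∃ U M u0 eta u1 u2 e w, ASY n m a b U M u0 eta u1 u2 e w := by
  obtain ⟨U, hU⟩ := exists_ultra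
  have hpos : ∀ᶠ ε : ℝ in U, 0 < ε := hU self_mem_nhdsWithin
  obtain ⟨ℓ, hℓ1, hℓ2⟩ := division_bigO (K := 4) (l := 𝓝[>] 0) (qpoly a b) hdeg hdiv
    (fun ε => PT (γ ε) ε 4) (fun ε => PT_totalDegree _ _ _) (fun x hx => PT_bigO h 4 hx)
  obtain ⟨η, hη1, hη2⟩ := division_bigO (K := 2) (l := 𝓝[>] 0) (qpoly a b) hdeg hdiv
    (fun ε => PW m (γ ε) ε) (fun ε => PW_deg _ _) (fun x hx => PW_bigO h hx)
  have d : ∀ x : Fin n, dl x x = 1 := fun x => by simp [dl]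
  refine ⟨U, fun s ε => mom (γ ε) s, fun ε => pd [] (ℓ ε), fun ε => pd [] (η ε),
    fun i ε => pd [i] (ℓ ε), fun i j ε => pd [i, j] (ℓ ε),
    fun s ε => (pd s (PT (γ ε) ε 4) - pd s (qpoly a b * ℓ ε)) / ε ^ 5,
    fun s ε => (pd s (PW m (γ ε) ε) - pd s (qpoly a b * η ε)) / ε ^ 3, hpos, ?_, ?_, ?_, ?_,
    ?_, ?_, ?_, ?_, ?_, ?_, ?_, ?_, ?_, ?_⟩
  · exact tendsto_id.mono_left (hU.trans nhdsWithin_le_nhds)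
  · intro s
    apply ultra_lim U
    filter_upwards [hpos] with ε hε using (h ε hε).mom_bound s
  · intro s; exact ultra_bigO hU (pd_bigO hℓ2 s)
  · intro s; exact ultra_bigO hU (pd_bigO hη2 s)
  · intro i j ε; exact pd_perm (List.Perm.swap _ _ _) _
  · intro i
    filter_upwards [hpos] with ε hε
    rw [mul_div_cancel₀ _ (by positivity), pd_PT1 _ _ _ (by norm_num), pd1]; ring
  · intro i j
    filter_upwards [hpos] with ε hε
    rw [mul_div_cancel₀ _ (by positivity), pd_PT2 _ _ _ (by norm_num), pd2]; ring
  · intro i j k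
    filter_upwards [hpos] with ε hε
    rw [mul_div_cancel₀ _ (by positivity), pd_PT3 _ _ _ (by norm_num), pd3]; ring
  · intro i j k l
    filter_upwards [hpos] with ε hε
    have h3 : ∀ i j k : Fin n, pd [i, j, k] (ℓ ε) = 0 := by
      intro i j k; apply pd_of_deg; have := hℓ1 ε; simp at this ⊢; omega
    rw [mul_div_cancel₀ _ (by positivity), pd_PT4 _ _ _ (by norm_num), pd4]
    simp only [h3]; ring
  · intro s
    filter_upwards [hpos] with ε hε using (h ε hε).mom_supp hε a b hq s
  · filter_upwards [hpos] with ε hε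
    rw [(h ε hε).mom_norm, ← (h ε hε).m2]; simp
  · filter_upwards [hpos] with ε hε
    have G := h ε hε
    have i4 := fun (i k : Fin n) => G.int_list [k, k, i, i]
    unfold mom
    rw [← G.m4]
    simp_rw [← integral_finsetSum _ (fun k _ => i4 _ k)]
    rw [← integral_finsetSum _ (fun i _ => integrable_finsetSum _ (fun k _ => i4 i k))]
    congr 1; ext z
    rw [show ‖z‖ ^ 4 = ‖z‖ ^ 2 * ‖z‖ ^ 2 by ring, EuclideanSpace.norm_sq_eq, Finset.sum_mul_sum]
    apply Finset.sum_congr rfl; intro i _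
    apply Finset.sum_congr rfl; intro k _
    simp; ring
  · intro i
    filter_upwards [hpos] with ε hε
    rw [mul_div_cancel₀ _ (by positivity), PW_pd1, pd1]; ring
  · intro i
    filter_upwards [hpos] with ε hε
    have h3 : ∀ i : Fin n, pd [i] (η ε) = 0 := by
      intro i; apply pd_of_deg; have := hη1 ε; simp at this ⊢; omega
    rw [mul_div_cancel₀ _ (by positivity), PW_pd2, pd2, h3, d]; ring
end

section
open MvPolynomial Asymptotics

def Tm (U : Ultrafilter ℝ) (f : ℝ → ℝ) : Prop := ∃ c, Tendsto f U (𝓝 c)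

lemma Tm.add {U : Ultrafilter ℝ} {f g : ℝ → ℝ} (hf : Tm U f) (hg : Tm U g) :
    Tm U (fun ε => f ε + g ε) := ⟨_, hf.choose_spec.add hg.choose_spec⟩
lemma Tm.sub {U : Ultrafilter ℝ} {f g : ℝ → ℝ} (hf : Tm U f) (hg : Tm U g) :
    Tm U (fun ε => f ε - g ε) := ⟨_, hf.choose_spec.sub hg.choose_spec⟩
lemma Tm.mul {U : Ultrafilter ℝ} {f g : ℝ → ℝ} (hf : Tm U f) (hg : Tm U g) :
    Tm U (fun ε => f ε * g ε) := ⟨_, hf.choose_spec.mul hg.choose_spec⟩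
lemma Tm.const (U : Ultrafilter ℝ) (c : ℝ) : Tm U (fun _ => c) := ⟨c, tendsto_const_nhds⟩
lemma Tm.sum {U : Ultrafilter ℝ} {n : ℕ} {f : Fin n → ℝ → ℝ} (h : ∀ k, Tm U (f k)) :
    Tm U (fun ε => ∑ k, f k ε) :=
  ⟨_, tendsto_finsetSum _ (fun k _ => (h k).choose_spec)⟩
lemma Tm.of {U : Ultrafilter ℝ} {f g : ℝ → ℝ} (c : ℝ) (hc : c ≠ 0) (hg : Tm U g)
    (h : ∀ᶠ ε in U, c * f ε = g ε) : Tm U f := by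
  refine ⟨c⁻¹ * hg.choose, (hg.choose_spec.const_mul c⁻¹).congr' ?_⟩
  filter_upwards [h] with ε h
  rw [← h]; field_simp

/-- the limit equations -/
structure LIM (n m : ℕ) (a b : Fin n → ℝ) (L l : Fin n → ℝ) : Prop where
  e1 : ∑ i, a i ^ 2 = 1
  e2 : ∀ i, (1 + 4 * a i ^ 2) * L i = 1 - 2 * a i - (∑ k, a k * L k) * a i
  e3 : ∀ i, (4 * a i - 1) * L i = (m + 2 - ∑ k, L k) * a i - 1
  e4 : ∀ i, (1 + 2 * a i ^ 2) * l i + b i * (∑ k, a k * L k + 2 * a i * L i) + 2 * b i +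
    2 * a i * b i = 0
  e5 : ∀ i, (2 * a i - 1) * l i + b i * (∑ k, L k) + 2 * b i * L i = m * b i
  e6 : ∑ i, b i * l i * (1 + a i) + ∑ i, b i ^ 2 = 0

set_option maxHeartbeats 1600000 in
lemma ASY.lim {n m : ℕ} {a b : Fin n → ℝ} {U M u0 eta u1 u2 e w}
    (h : ASY n m a b U M u0 eta u1 u2 e w) (hn : n = m + 1) (ha : ∑ i, a i = -1)
    (i0 : Fin n) (hi0 : a i0 ≠ 0) : ∃ L l, LIM n m a b L l := by
  have hpos := h.pos
  have hn' : (n : ℝ) = m + 1 := by rw [hn]; push_cast; rfl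
  have dd : ∀ x : Fin n, dl x x = 1 := fun x => by simp [dl]
  have dn : ∀ x y : Fin n, x ≠ y → dl x y = 0 := fun x y h => by simp [dl, h]
  have dsy : ∀ x y : Fin n, dl x y = dl y x := fun x y => by simp [dl, eq_comm]
  have hid : Tm U (fun ε => ε) := ⟨0, h.lim0⟩
  have hS : 0 < ∑ k, a k ^ 2 :=
    lt_of_lt_of_le (by positivity : 0 < a i0 ^ 2)
      (Finset.single_le_sum (f := fun k => a k ^ 2) (fun k _ => sq_nonneg _) (Finset.mem_univ i0))
  -- v2 tame
  have F4 : ∀ i j k l, ∀ᶠ ε : ℝ in U, 16 * M [i, j, k, l] ε -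
      4 * (dl i j * dl k l + dl i k * dl j l + dl i l * dl j k) =
      2 * a i * dl i j * (u2 k l ε / ε ^ 4) + 2 * a i * dl i k * (u2 j l ε / ε ^ 4) +
      2 * a i * dl i l * (u2 j k ε / ε ^ 4) +
      2 * a j * dl j k * (u2 i l ε / ε ^ 4) + 2 * a j * dl j l * (u2 i k ε / ε ^ 4) +
      2 * a k * dl k l * (u2 i j ε / ε ^ 4) + ε * e [i, j, k, l] ε := by
    intro i j k l
    filter_upwards [h.E4 i j k l, hpos] with ε h1 h2
    field_simp
    linear_combination h1
  have Mt : ∀ s, Tm U (M s) := h.Mlim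
  have et : ∀ s, Tm U (e s) := h.elim
  have wt : ∀ s, Tm U (w s) := h.wlim
  have t00 : Tm U (fun ε => u2 i0 i0 ε / ε ^ 4) := by
    refine Tm.of (12 * a i0) (by simpa using hi0)
      ((((Tm.const U 16).mul (Mt [i0, i0, i0, i0])).sub (Tm.const U 12)).sub (hid.mul (et [i0, i0, i0, i0]))) ?_
    filter_upwards [F4 i0 i0 i0 i0] with ε h1
    simp only [dd] at h1
    linear_combination -h1
  have t0j : ∀ j, Tm U (fun ε => u2 i0 j ε / ε ^ 4) := by
    intro j
    by_cases hj : i0 = j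
    · subst hj; exact t00
    refine Tm.of (6 * a i0) (by simpa using hi0)
      (((Tm.const U 16).mul (Mt [i0, i0, i0, j])).sub (hid.mul (et [i0, i0, i0, j]))) ?_
    filter_upwards [F4 i0 i0 i0 j] with ε h1
    simp only [dd, dn _ _ hj] at h1
    linear_combination -h1
  have v2t : ∀ i j, Tm U (fun ε => u2 i j ε / ε ^ 4) := by
    intro i j
    refine Tm.of (2 * a i0) (by simpa using hi0)
      (((((((Tm.const U 16).mul (Mt [i0, i0, i, j])).sub
        (Tm.const U (4 * (dl i j + 2 * dl i0 i * dl i0 j)))).sub (hid.mul (et [i0, i0, i, j]))).sub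
        ((Tm.const U (4 * a i0 * dl i0 i)).mul (t0j j))).sub
        ((Tm.const U (4 * a i0 * dl i0 j)).mul (t0j i))).sub
        ((Tm.const U (2 * a i * dl i j)).mul t00)) ?_
    filter_upwards [F4 i0 i0 i j] with ε h1
    simp only [dd] at h1
    linear_combination -h1
  -- v1 tame
  have F3 : ∀ i, ∀ᶠ ε : ℝ in U, (2 * ∑ k, a k ^ 2 + 4 * a i ^ 2) * (u1 i ε / ε ^ 4) =
      -8 * (∑ k, b k * M [k, i] ε) - 2 * (∑ k, a k * b k * (u2 k i ε / ε ^ 4)) -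
      b i * (∑ k, a k * (u2 k k ε / ε ^ 4)) - ε * ∑ k, a k * e [k, k, i] ε := by
    intro i
    have := eventually_all.2 (fun k => h.E3 k k i)
    filter_upwards [this, h.SU [i], hpos] with ε h1 h2 h3
    have h4 := Finset.sum_congr (s₁ := Finset.univ) rfl (fun k _ => congrArg (a k * ·) (h1 k))
    have e1 : ∑ k, a k * (8 * ε ^ 3 * M [k, k, i] ε) = 8 * ε ^ 3 * ∑ k, a k * M [k, k, i] ε := by
      rw [Finset.mul_sum]; exact Finset.sum_congr rfl fun k _ => by ring
    have e2 : ∑ k, a k * (2 * a k * dl k k * u1 i ε +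
        2 * a k * dl k i * u1 k ε + 2 * a k * dl k i * u1 k ε + b k * u2 k i ε + b k * u2 k i ε +
      b i * u2 k k ε + ε ^ 5 * e [k, k, i] ε) = 2 * (∑ k, a k ^ 2) * u1 i ε +
       4 * a i ^ 2 * u1 i ε + 2 * (∑ k, a k * b k * u2 k i ε) + b i * (∑ k, a k * u2 k k ε)
        + ε ^ 5 * ∑ k, a k * e [k, k, i] ε := by
      rw [← sum_dl (fun k => 4 * a k ^ 2 * u1 k ε) i]
      simp only [dd, Finset.mul_sum, Finset.sum_mul, ← Finset.sum_add_distrib]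
      exact Finset.sum_congr rfl fun k _ => by ring
    rw [e1, e2] at h4
    simp only [mul_div_assoc', ← Finset.sum_div]
    field_simp
    linear_combination -h4 + 8 * ε ^ 3 * h2
  have v1t : ∀ i, Tm U (fun ε => u1 i ε / ε ^ 4) := by
    intro i
    refine Tm.of (2 * ∑ k, a k ^ 2 + 4 * a i ^ 2) (by positivity)
      (((((Tm.const U (-8)).mul (Tm.sum fun k => (Tm.const U (b k)).mul (Mt _))).sub
      ((Tm.const U 2).mul (Tm.sum fun k => (Tm.const U (a k * b k)).mul (v2t _ _)))).sub
      ((Tm.const U (b i)).mul (Tm.sum fun k => (Tm.const U (a k)).mul (v2t _ _)))).sub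
      (hid.mul (Tm.sum fun k => (Tm.const U (a k)).mul (et _)))) (F3 i)
  -- u0
  have F0 : ∀ᶠ ε : ℝ in U, u0 ε / ε ^ 2 = 1 + ε ^ 2 * ∑ k, b k * (u1 k ε / ε ^ 4) +
      ε ^ 3 * ((∑ k, e [k, k] ε) / 2) := by
    have := eventually_all.2 (fun k => h.E2 k k)
    filter_upwards [this, h.T2, hpos] with ε h1 h2 h3
    have h4 := Finset.sum_congr (s₁ := Finset.univ) rfl (fun k _ => h1 k)
    have e1 : ∑ k, (4 * ε ^ 2 * M [k, k] ε - 2 * ε ^ 2 * dl k k) =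
        4 * ε ^ 2 * (m / 2) - 2 * ε ^ 2 * n := by
      rw [← h2]; simp [dd, Finset.mul_sum, mul_comm]
    have e2 : ∑ k, (2 * a k * dl k k * u0 ε + b k * u1 k ε + b k * u1 k ε + ε ^ 5 * e [k, k] ε)
        = 2 * (-1) * u0 ε + 2 * (∑ k, b k * u1 k ε) + ε ^ 5 * ∑ k, e [k, k] ε := by
      rw [← ha]
      simp only [dd, Finset.mul_sum, Finset.sum_mul, ← Finset.sum_add_distrib]
      exact Finset.sum_congr rfl fun k _ => by ring
    rw [e1, e2, hn'] at h4
    simp only [mul_div_assoc', ← Finset.sum_div]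
    field_simp
    linear_combination h4
  have v0l : Tendsto (fun ε => u0 ε / ε ^ 2) U (𝓝 1) := by
    obtain ⟨c1, hc1⟩ := Tm.sum fun k => (Tm.const U (b k)).mul (v1t k)
    obtain ⟨c2, hc2⟩ := Tm.sum fun k => et [k, k]
    have := (((h.lim0.pow 2).mul hc1).const_add 1).add ((h.lim0.pow 3).mul (hc2.div_const 2))
    norm_num at this
    refine this.congr' ?_
    filter_upwards [F0] with ε h; exact h.symm
  have Fη : ∀ᶠ ε : ℝ in U, eta ε / ε ^ 2 = m / 2 - 1 + ε * ((∑ k, w [k, k] ε) / 2) := by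
    have := eventually_all.2 (fun k => h.W2 k)
    filter_upwards [this, h.T2, h.T4, hpos] with ε h1 h2 h5 h3
    have h4 := Finset.sum_congr (s₁ := Finset.univ) rfl (fun k _ => h1 k)
    have e1 : ∑ i, (4 * ε ^ 2 * (∑ k, M [k, k, i, i] ε - 2 * M [i, i] ε) +
    2 * ε ^ 2 * (1 - m / 2)) = 4 * ε ^ 2 * (m / 2 * (m / 2 + 1) - 2 * (m / 2)) +
        2 * ε ^ 2 * (1 - m / 2) * n := by
      rw [Finset.sum_add_distrib, ← Finset.mul_sum, Finset.sum_sub_distrib, ← Finset.mul_sum, h2,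
        h5]
      simp [mul_comm]
    have e2 : ∑ i, (2 * a i * eta ε + ε ^ 3 * w [i, i] ε)
        = 2 * (-1) * eta ε + ε ^ 3 * ∑ k, w [k, k] ε := by
      rw [← ha]
      simp only [Finset.mul_sum, Finset.sum_mul, ← Finset.sum_add_distrib]
    rw [e1, e2, hn'] at h4
    field_simp
    linear_combination h4
  have vηl : Tendsto (fun ε => eta ε / ε ^ 2) U (𝓝 (m / 2 - 1)) := by
    obtain ⟨c2, hc2⟩ := Tm.sum fun k => wt [k, k]
    have := (h.lim0.mul (hc2.div_const 2)).const_add ((m:ℝ) / 2 - 1)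
    norm_num at this
    refine this.congr' ?_
    filter_upwards [Fη] with ε h; exact h.symm
  choose T hT using Mt
  choose e' he' using et
  choose w' hw' using wt
  choose Λ hΛ using v2t
  choose lam hlam using v1t
  let F : ℝ → ℝ × (Fin n → Fin n → ℝ) × (Fin n → ℝ) × ℝ × ℝ × (List (Fin n) → ℝ) ×
    (List (Fin n) → ℝ) × (List (Fin n) → ℝ) := fun ε => (ε, fun i j => u2 i j ε / ε ^ 4,
      fun i => u1 i ε / ε ^ 4, u0 ε / ε ^ 2, eta ε / ε ^ 2, fun s => M s ε, fun s => e s ε,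
      fun s => w s ε)
  have hF : Tendsto F U (𝓝 (0, Λ, lam, 1, (m:ℝ) / 2 - 1, T, e', w')) := by
    refine h.lim0.prodMk_nhds ((tendsto_pi_nhds.2 fun i => tendsto_pi_nhds.2 fun j => hΛ i j).prodMk_nhds
      ((tendsto_pi_nhds.2 hlam).prodMk_nhds (v0l.prodMk_nhds (vηl.prodMk_nhds
      ((tendsto_pi_nhds.2 hT).prodMk_nhds ((tendsto_pi_nhds.2 he').prodMk_nhds
        (tendsto_pi_nhds.2 hw')))))))
  have key : ∀ P : ℝ → (Fin n → Fin n → ℝ) → (Fin n → ℝ) → ℝ → ℝ → (List (Fin n) → ℝ) →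
    (List (Fin n) → ℝ) → (List (Fin n) → ℝ) → ℝ,
    Continuous (fun y : ℝ × (Fin n → Fin n → ℝ) × (Fin n → ℝ) × ℝ × ℝ × (List (Fin n) → ℝ) ×
    (List (Fin n) → ℝ) × (List (Fin n) → ℝ) => P y.1 y.2.1 y.2.2.1 y.2.2.2.1 y.2.2.2.2.1
      y.2.2.2.2.2.1 y.2.2.2.2.2.2.1 y.2.2.2.2.2.2.2) →
    (∀ᶠ ε in U, P ε (fun i j => u2 i j ε / ε ^ 4)
      (fun i => u1 i ε / ε ^ 4) (u0 ε / ε ^ 2) (eta ε / ε ^ 2) (fun s => M s ε) (fun s => e s ε)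
      (fun s => w s ε) = 0) → P 0 Λ lam 1 (m / 2 - 1) T e' w' = 0 := by
    intro P hP hP'
    exact lim_id hF hP hP'
  have L4 : ∀ i j k l, 16 * T [i, j, k, l] -
      4 * (dl i j * dl k l + dl i k * dl j l + dl i l * dl j k) =
      2 * a i * dl i j * Λ k l + 2 * a i * dl i k * Λ j l +
      2 * a i * dl i l * Λ j k +
      2 * a j * dl j k * Λ i l + 2 * a j * dl j l * Λ i k +
      2 * a k * dl k l * Λ i j := by
    intro i j k l
    have := key (fun ε v2 v1 v0 h M e w => 16 * M [i, j, k, l] -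
      4 * (dl i j * dl k l + dl i k * dl j l + dl i l * dl j k) -
      (2 * a i * dl i j * v2 k l + 2 * a i * dl i k * v2 j l +
      2 * a i * dl i l * v2 j k +
      2 * a j * dl j k * v2 i l + 2 * a j * dl j l * v2 i k +
      2 * a k * dl k l * v2 i j + ε * e [i, j, k, l])) (by fun_prop) (by
        filter_upwards [F4 i j k l] with ε h1
        linear_combination h1)
    linear_combination this
  have LS : ∀ s, ∑ k, a k * T (k :: k :: s) = 0 := by
    intro s
    have := key (fun ε v2 v1 v0 h M e w => ∑ k, a k * M (k :: k :: s) + ε * ∑ k, b k * M (k :: s))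
      (by fun_prop) (h.SU s)
    simpa using this
  have L2 : ∀ i j, 4 * T [i, j] - 2 * dl i j = 2 * a i * dl i j := by
    intro i j
    have := key (fun ε v2 v1 v0 h M e w => 4 * M [i, j] - 2 * dl i j - (2 * a i * dl i j * v0
      + ε ^ 2 * (b i * v1 j + b j * v1 i) + ε ^ 3 * e [i, j]))
      (by fun_prop) (by
        filter_upwards [h.E2 i j, hpos] with ε h1 h2
        field_simp
        linear_combination h1)
    linear_combination this
  have LW : ∀ i, 4 * (∑ k, T [k, k, i, i] - 2 * T [i, i]) + 2 * (1 - (m:ℝ) / 2) =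
      2 * a i * (m / 2 - 1) := by
    intro i
    have := key (fun ε v2 v1 v0 h M e w => 4 * (∑ k, M [k, k, i, i] - 2 * M [i, i]) +
      2 * (1 - (m:ℝ) / 2) - (2 * a i * h + ε * w [i, i]))
      (by fun_prop) (by
        filter_upwards [h.W2 i, hpos] with ε h1 h2
        field_simp
        linear_combination h1)
    linear_combination this
  have S1 : ∑ i, a i ^ 2 = 1 := by
    have h1 := LS []
    have : ∑ k, a k * T [k, k] = ∑ k, (a k + a k ^ 2) / 2 :=
      Finset.sum_congr rfl fun k _ => by have := L2 k k; rw [dd] at this; linear_combination a k / 4 * this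
    rw [this, ← Finset.sum_div, Finset.sum_add_distrib, ha] at h1
    linarith
  have sΛ : ∀ i j, Λ i j = Λ j i := by
    intro i j
    refine tendsto_nhds_unique (hΛ i j) ((hΛ j i).congr fun ε => ?_)
    rw [h.symm]
  have K4 : ∀ k i j, 16 * T [k, k, i, j] = 4 * (dl i j + 2 * dl k i * dl k j) + 2 * a k * Λ i j +
      2 * a i * dl i j * Λ k k + 4 * a k * dl k i * Λ k j + 4 * a k * dl k j * Λ k i := by
    intro k i j
    have := L4 k k i j
    rw [dd] at this
    linear_combination this
  -- off diagonal
  have off : ∀ i j, i ≠ j → Λ i j = 0 := by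
    intro i j hij
    have h1 := LS [i, j]
    have : ∑ k, a k * T [k, k, i, j] = ((2 * ∑ k, a k ^ 2) * Λ i j + 4 * a i ^ 2 * Λ i j +
      4 * a j ^ 2 * Λ j i) / 16 := by
      rw [← sum_dl (fun k => 4 * a k ^ 2 * Λ k j) i, ← sum_dl (fun k => 4 * a k ^ 2 * Λ k i) j]
      simp only [Finset.mul_sum, Finset.sum_mul, ← Finset.sum_add_distrib, Finset.sum_div]
      refine Finset.sum_congr rfl fun k _ => ?_
      have h2 := K4 k i j
      have h3 : dl k i * dl k j = 0 := by
        by_cases hk : k = i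
        · subst hk; rw [dn _ _ hij]; simp
        · rw [dn _ _ hk]; simp
      rw [dn _ _ hij] at h2
      linear_combination a k / 16 * h2 + a k / 2 * h3
    rw [this, S1, sΛ j i] at h1
    have : (2 + 4 * a i ^ 2 + 4 * a j ^ 2) * Λ i j = 0 := by linear_combination 16 * h1
    rcases mul_eq_zero.1 this with h | h
    · nlinarith [sq_nonneg (a i), sq_nonneg (a j)]
    · exact h
  -- first order
  have LG : ∀ i, (m : ℝ) / 2 * b i = 2 * ((2 * ∑ k, a k) * lam i + 4 * a i * lam i +
      2 * b i * Λ i i + b i * ∑ k, Λ k k) / 8 := by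
    intro i
    have := key (fun ε v2 v1 v0 h M e w => 2 * ((2 * ∑ k, a k) * v1 i + 4 * a i * v1 i +
      2 * ∑ k, b k * v2 k i + b i * ∑ k, v2 k k + ε * ∑ k, e [k, k, i]) / 8
      - (b i * v0 + ε ^ 3 * e [i]) - (b i * h + ε * w [i]))
      (by fun_prop) (by
        filter_upwards [h.W1 i, h.E1 i, eventually_all.2 (fun k => h.E3 k k i), hpos] with ε h1 h2 h3 h4
        have h5 := Finset.sum_congr (s₁ := Finset.univ) rfl (fun k _ => h3 k)
        have e2 : ∑ k, (2 * a k * dl k k * u1 i ε +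
          2 * a k * dl k i * u1 k ε + 2 * a k * dl k i * u1 k ε + b k * u2 k i ε + b k * u2 k i ε +
          b i * u2 k k ε + ε ^ 5 * e [k, k, i] ε) = 2 * (∑ k, a k) * u1 i ε +
          4 * a i * u1 i ε + 2 * (∑ k, b k * u2 k i ε) + b i * (∑ k, u2 k k ε)
          + ε ^ 5 * ∑ k, e [k, k, i] ε := by
          rw [← sum_dl (fun k => 4 * a k * u1 k ε) i]
          simp only [dd, Finset.mul_sum, Finset.sum_mul, ← Finset.sum_add_distrib]
          exact Finset.sum_congr rfl fun k _ => by ring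
        rw [← Finset.mul_sum, e2] at h5
        simp only [mul_div_assoc', ← Finset.sum_div]
        field_simp
        linear_combination 8 * ε ^ 2 * h1 + 8 * ε ^ 2 * h2 - 2 * h5)
    have e3 : ∑ k, b k * Λ k i = b i * Λ i i :=
      Finset.sum_eq_single i (fun k _ hk => by rw [off _ _ hk, mul_zero]) (by simp)
    simp only [e3] at this
    linear_combination -this
  have LH : ∀ i, (2 * ∑ k, a k ^ 2 + 4 * a i ^ 2) * lam i =
      -8 * (b i * T [i, i]) - 2 * (a i * b i * Λ i i) - b i * ∑ k, a k * Λ k k := by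
    intro i
    have := key (fun ε v2 v1 v0 h M e w => (2 * ∑ k, a k ^ 2 + 4 * a i ^ 2) * v1 i -
      (-8 * (∑ k, b k * M [k, i]) - 2 * (∑ k, a k * b k * v2 k i) -
      b i * (∑ k, a k * v2 k k) - ε * ∑ k, a k * e [k, k, i])) (by fun_prop) (by
        filter_upwards [F3 i] with ε h1
        linear_combination h1)
    have e3 : ∑ k, a k * b k * Λ k i = a i * b i * Λ i i :=
      Finset.sum_eq_single i (fun k _ hk => by rw [off _ _ hk, mul_zero]) (by simp)
    have e4 : ∑ k, b k * T [k, i] = b i * T [i, i] :=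
      Finset.sum_eq_single i (fun k _ hk => by
        have := L2 k i; rw [dn _ _ hk] at this
        have h0 : T [k, i] = 0 := by linarith
        rw [h0, mul_zero]) (by simp)
    simp only [e3, e4] at this
    linear_combination this
  have L6 : ∑ i, b i * lam i * (1 + a i) + ∑ i, b i ^ 2 = 0 := by
    have := key (fun ε v2 v1 v0 h M e w => 2 * (∑ k, b k * v1 k) + ε * (∑ k, e [k, k]) +
      2 * (∑ k, a k * b k * v1 k) + ε * (∑ k, a k * e [k, k]) + 2 * v0 * (∑ k, b k ^ 2) +
      2 * ε ^ 3 * (∑ k, b k * e [k])) (by fun_prop) (by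
        filter_upwards [F0, h.SU [], eventually_all.2 (fun k => h.E2 k k),
          eventually_all.2 h.E1, hpos] with ε h0 h1 h2 h3 h4
        have e1 : 4 * ε ^ 2 * ∑ k, a k * M [k, k] ε = 2 * ε ^ 2 * (-1) + 2 * (∑ k, a k ^ 2) * u0 ε +
            2 * (∑ k, a k * b k * u1 k ε) + ε ^ 5 * ∑ k, a k * e [k, k] ε := by
          rw [← ha]
          simp only [Finset.mul_sum, Finset.sum_mul, ← Finset.sum_add_distrib]
          refine Finset.sum_congr rfl fun k _ => ?_
          have := h2 k
          rw [dd] at this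
          linear_combination a k * this
        have e2 : 2 * ε * ∑ k, b k * M [k] ε = (∑ k, b k ^ 2) * u0 ε + ε ^ 5 * ∑ k, b k * e [k] ε := by
          simp only [Finset.mul_sum, Finset.sum_mul, ← Finset.sum_add_distrib]
          exact Finset.sum_congr rfl fun k _ => by linear_combination b k * h3 k
        rw [S1] at e1
        simp only [mul_div_assoc', ← Finset.sum_div] at h0 ⊢
        field_simp at h0 ⊢
        linear_combination 4 * ε ^ 2 * h1 - e1 - 2 * ε ^ 2 * e2 - h0)
    have e3 : ∑ i, b i * lam i * (1 + a i) = ∑ k, b k * lam k + ∑ k, a k * b k * lam k := by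
      rw [← Finset.sum_add_distrib]; exact Finset.sum_congr rfl fun k _ => by ring
    rw [e3]
    linear_combination this / 2
  have T2 : ∀ i, T [i, i] = (1 + a i) / 2 := by
    intro i; have := L2 i i; rw [dd] at this; linarith
  refine ⟨fun i => Λ i i / 2, lam, S1, ?_, ?_, ?_, ?_, L6⟩
  · intro i
    have h1 := LS [i, i]
    have : ∑ k, a k * T [k, k, i, i] = (4 * (∑ k, a k) + 2 * (∑ k, a k ^ 2) * Λ i i +
      2 * a i * (∑ k, a k * Λ k k) + 8 * a i + 8 * a i ^ 2 * Λ i i) / 16 := by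
      have s1 := sum_dl (fun k => 8 * a k) i
      have s2 := sum_dl (fun k => 8 * a k ^ 2 * Λ k i) i
      rw [← s1, ← s2]
      simp only [Finset.mul_sum, Finset.sum_mul, ← Finset.sum_add_distrib, Finset.sum_div]
      refine Finset.sum_congr rfl fun k _ => ?_
      have h2 := K4 k i i
      have h3 : dl k i * dl k i = dl k i := by
        by_cases hk : k = i
        · subst hk; rw [dd]; simp
        · rw [dn _ _ hk]; simp
      rw [dd] at h2
      linear_combination a k / 16 * h2 + a k / 2 * h3
    rw [this, ha, S1] at h1
    simp only [mul_div_assoc', ← Finset.sum_div]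
    linear_combination 4 * h1
  · intro i
    have h1 := LW i
    have : ∑ k, T [k, k, i, i] = (4 * n + 2 * (∑ k, a k) * Λ i i +
      2 * a i * (∑ k, Λ k k) + (8 + 8 * a i * Λ i i)) / 16 := by
      have s2 := sum_dl (fun k => 8 + 8 * a k * Λ k i) i
      have s3 : (4:ℝ) * n = ∑ k : Fin n, (4:ℝ) := by simp [mul_comm]
      rw [s3, ← s2]
      simp only [Finset.mul_sum, Finset.sum_mul, ← Finset.sum_add_distrib, Finset.sum_div]
      refine Finset.sum_congr rfl fun k _ => ?_
      have h2 := K4 k i i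
      have h3 : dl k i * dl k i = dl k i := by
        by_cases hk : k = i
        · subst hk; rw [dd]; simp
        · rw [dn _ _ hk]; simp
      rw [dd] at h2
      linear_combination 1 / 16 * h2 + 1 / 2 * h3
    rw [this, ha, T2, hn'] at h1
    simp only [← Finset.sum_div]
    linear_combination h1
  · intro i
    have h1 := LH i
    rw [S1, T2] at h1
    simp only [mul_div_assoc', ← Finset.sum_div]
    linear_combination h1 / 2
  · intro i
    have h1 := LG i
    rw [ha] at h1
    simp only [← Finset.sum_div]
    linear_combination -2 * h1
end

section
open MvPolynomial Asymptotics

lemma dioph (N k : ℕ) (hN : 0 < N) (h : k ^ 2 * (N ^ 2 + 112 * N + 112) = ((N + 2) * (N + 4)) ^ 2) :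
    N = 1 ∨ N = 4 ∨ N = 76 := by
  have hk : 0 < k := by
    rcases Nat.eq_zero_or_pos k with h0 | h0
    · subst h0; have : 0 < ((N + 2) * (N + 4)) ^ 2 := by positivity
      omega
    · exact h0
  have hd : k ∣ (N + 2) * (N + 4) := by
    rw [← Nat.pow_dvd_pow_iff (n := 2) (by norm_num)]; exact Dvd.intro _ h
  obtain ⟨w, hw⟩ := hd
  have hw2 : N ^ 2 + 112 * N + 112 = w ^ 2 := by
    rw [hw, mul_pow] at h; exact Nat.eq_of_mul_eq_mul_left (by positivity) h
  have hlt : w < N + 56 := by nlinarith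
  obtain ⟨u, hu⟩ := Nat.exists_eq_add_of_lt hlt
  have huv : (u + 1) * (2 * w + u + 1) = 3024 := by
    have : N = w + u + 1 - 56 := by omega
    have h2 : N + 56 = w + u + 1 := by omega
    have : (N + 56) ^ 2 = w ^ 2 + 3024 := by rw [← hw2]; ring
    rw [h2] at this
    nlinarith
  have hu54 : u < 55 := by
    by_contra hc
    push Not at hc
    nlinarith
  have hN2 : N = w + u + 1 - 56 := by omega
  have hw4 : w = (3024 / (u + 1) - (u + 1)) / 2 := by
    rw [← huv, Nat.mul_div_cancel_left _ (by omega)]; omega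
  clear h hw2 hlt hu
  interval_cases u <;> first
    | omega
    | (norm_num at hw4; subst hw4; norm_num at hN2; subst hN2; omega)

open Classical in
lemma LIM.class {n m : ℕ} {a b L l : Fin n → ℝ} (h : LIM n m a b L l) (hn : n = m + 1)
    (ha : ∑ i, a i = -1) :
    (∃ i0, a i0 = -1 ∧ (∀ i, i ≠ i0 → a i = 0) ∧ ∀ i, b i = 0) ∨
    ((∀ i, a i = 0 ∨ a i = -1 / 2 ∨ a i = 1 / 2) ∧
      (Finset.univ.filter (fun i => a i = -1 / 2)).card = 3 ∧
      (Finset.univ.filter (fun i => a i = 1 / 2)).card = 1 ∧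
      (∀ i, a i = 0 → b i = 0) ∧ ∑ i, a i * b i ^ 2 = 0) ∨
    ((∀ i, a i = 0 ∨ a i = -1 / 16 ∨ a i = 1 / 4) ∧
      (Finset.univ.filter (fun i => a i = -1 / 16)).card = 64 ∧
      (Finset.univ.filter (fun i => a i = 1 / 4)).card = 12) := by
  obtain ⟨g, hg⟩ : ∃ g, g = (m : ℝ) + 2 - ∑ k, L k := ⟨_, rfl⟩
  obtain ⟨κ, hκ⟩ : ∃ κ, κ = ∑ k, a k * L k := ⟨_, rfl⟩
  have hn' : (n : ℝ) = m + 1 := by rw [hn]; push_cast; rfl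
  have hτ : ∑ k, L k = m + 2 - g := by linarith
  have e2 := h.e2; have e3 := h.e3; have e4 := h.e4; have e5 := h.e5; have e6 := h.e6
  rw [← hκ] at e2 e4
  simp only [hτ] at e3 e5
  have hk : κ = (1 - 2 * g) / 4 := by
    have h1 := Finset.sum_congr (s₁ := Finset.univ) rfl (fun k _ => e3 k)
    have h2 : ∑ i, (4 * a i - 1) * L i = 4 * κ - (m + 2 - g) := by
      rw [hκ, ← hτ, Finset.mul_sum, ← Finset.sum_sub_distrib]
      exact Finset.sum_congr rfl fun k _ => by ring
    have h3 : ∑ i, (((m:ℝ) + 2 - (m + 2 - g)) * a i - 1) = -g - n := by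
      rw [Finset.sum_sub_distrib, ← Finset.mul_sum, ha]; simp
    rw [h2, h3, hn'] at h1
    linarith
  have quad : ∀ i, a i ≠ 0 → 4 * g * a i ^ 2 + (5 - 2 * g) * a i + (6 * g - 25) / 4 = 0 := by
    intro i hi
    have h1 := e2 i; have h2 := e3 i
    rw [hk] at h1
    have : a i * (4 * g * a i ^ 2 + (5 - 2 * g) * a i + (6 * g - 25) / 4) = 0 := by
      linear_combination (4 * a i - 1) * h1 - (1 + 4 * a i ^ 2) * h2
    exact (mul_eq_zero.1 this).resolve_left hi
  set s := Finset.univ.filter (fun i => a i ≠ 0) with hs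
  have sa : ∑ i ∈ s, a i = -1 := by
    rw [← ha, hs]; exact Finset.sum_filter_of_ne fun i _ h => h
  have sa2 : ∑ i ∈ s, a i ^ 2 = 1 := by
    rw [← h.e1, hs]; exact Finset.sum_filter_of_ne fun i _ h => by
      intro h0; rw [h0] at h; simp at h
  have mem : ∀ i ∈ s, a i ≠ 0 := fun i hi => (Finset.mem_filter.1 hi).2
  obtain ⟨N, hN⟩ : ∃ N, N = s.card := ⟨_, rfl⟩
  have hN0 : 0 < N := by
    rw [hN, Finset.card_pos]
    by_contra hc
    rw [Finset.not_nonempty_iff_eq_empty] at hc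
    rw [hc] at sa; simp at sa
  have hgN : g * (24 + 6 * N) = 20 + 25 * N := by
    have h1 : ∑ i ∈ s, (4 * g * a i ^ 2 + (5 - 2 * g) * a i + (6 * g - 25) / 4) = 0 :=
      Finset.sum_eq_zero fun i hi => quad i (mem i hi)
    rw [Finset.sum_add_distrib, Finset.sum_add_distrib, ← Finset.mul_sum, ← Finset.mul_sum, sa,
      sa2, Finset.sum_const, ← hN, nsmul_eq_mul] at h1
    linarith
  have hN1 : (0:ℝ) < N := by exact_mod_cast hN0
  have hge : g = (20 + 25 * N) / (24 + 6 * N) := by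
    rw [eq_div_iff (by positivity)]; exact hgN
  have hNc : N = 1 ∨ N = 4 ∨ N = 76 := by
    obtain ⟨D, hD⟩ : ∃ D, D = 25 + 80 * g - 20 * g ^ 2 := ⟨_, rfl⟩
    have hs2 : ∀ i ∈ s, (8 * g * a i + 5 - 2 * g) ^ 2 = D := by
      intro i hi
      linear_combination 16 * g * quad i (mem i hi) - hD
    have hD' : D = 100 * (N ^ 2 + 112 * N + 112) / (9 * (N + 4) ^ 2) := by
      rw [hD, hge]; field_simp; ring
    have hD0 : 0 ≤ D := by rw [hD']; positivity
    have hsum : ∑ i ∈ s, (8 * g * a i + 5 - 2 * g) = -(10 * (N + 2) / 3) := by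
      rw [Finset.sum_sub_distrib, Finset.sum_add_distrib, ← Finset.mul_sum, sa, Finset.sum_const,
        Finset.sum_const, ← hN, nsmul_eq_mul, nsmul_eq_mul, hge]
      field_simp; ring
    have hint : ∃ k : ℤ, ∑ i ∈ s, (8 * g * a i + 5 - 2 * g) = k * Real.sqrt D := by
      refine ⟨∑ i ∈ s, if 8 * g * a i + 5 - 2 * g = Real.sqrt D then 1 else -1, ?_⟩
      push_cast
      rw [Finset.sum_mul]
      refine Finset.sum_congr rfl fun i hi => ?_
      split_ifs with h1
      · rw [one_mul, h1]
      · have h2 : (8 * g * a i + 5 - 2 * g) ^ 2 = Real.sqrt D ^ 2 := by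
          rw [hs2 i hi, Real.sq_sqrt hD0]
        rcases sq_eq_sq_iff_eq_or_eq_neg.1 h2 with h3 | h3
        · exact absurd h3 h1
        · rw [h3]; ring
    obtain ⟨k, hk⟩ := hint
    rw [hsum] at hk
    have h3 : (10 * ((N:ℝ) + 2) / 3) ^ 2 = k ^ 2 * D := by
      rw [← Real.sq_sqrt hD0, ← mul_pow, ← hk]; ring
    rw [hD'] at h3
    apply dioph N k.natAbs hN0
    have h4 : ((k.natAbs : ℝ)) ^ 2 = (k:ℝ) ^ 2 := by
      have : ((k.natAbs : ℤ) : ℝ) = |(k:ℝ)| := by rw [Int.natCast_natAbs]; push_cast; rfl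
      rw [← sq_abs (k:ℝ), ← this]; simp
    have h5 : (k.natAbs : ℝ) ^ 2 * ((N:ℝ) ^ 2 + 112 * N + 112) = ((N + 2) * (N + 4)) ^ 2 := by
      rw [h4]
      field_simp at h3
      linear_combination -h3 / 900
    exact_mod_cast h5
  have null : ∀ i, a i = 0 → b i = 0 := by
    intro i hi
    have h2 := e2 i; have h4 := e4 i; have h5 := e5 i
    rw [hi] at h2 h4 h5
    have hL : L i = 1 := by linarith
    rw [hL, hk] at h4; rw [hL] at h5
    have : b i * (25 - 6 * g) = 0 := by linear_combination 4 * h4 + 4 * h5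
    rcases mul_eq_zero.1 this with h | h
    · exact h
    · have : g = 25 / 6 := by linarith
      rw [this] at hgN; linarith
  have cnt : ∀ x y : ℝ, x ≠ 0 → y ≠ 0 → x ≠ y → (∀ i, a i = 0 ∨ a i = x ∨ a i = y) →
      ((Finset.univ.filter (fun i => a i = x)).card * x +
        (Finset.univ.filter (fun i => a i = y)).card * y = -1) ∧
      ((Finset.univ.filter (fun i => a i = x)).card * x ^ 2 +
        (Finset.univ.filter (fun i => a i = y)).card * y ^ 2 = 1) := by
    intro x y hx hy hxy hall
    rw [← ha, ← h.e1]
    simp only [Finset.card_filter, Nat.cast_sum, Finset.sum_mul, ← Finset.sum_add_distrib]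
    constructor <;> refine Finset.sum_congr rfl fun i _ => ?_ <;>
      rcases hall i with h | h | h <;> simp [h, hx.symm, hy.symm, hxy, hxy.symm]
  rcases hNc with h1 | h1 | h1
  · left
    rw [h1] at hN
    obtain ⟨i0, hi0⟩ := Finset.card_eq_one.1 hN.symm
    rw [hi0, Finset.sum_singleton] at sa
    have hz : ∀ i, i ≠ i0 → a i = 0 := by
      intro i hi
      by_contra hc
      have : i ∈ s := Finset.mem_filter.2 ⟨Finset.mem_univ _, hc⟩
      rw [hi0] at this; exact hi (Finset.mem_singleton.1 this)
    refine ⟨i0, sa, hz, ?_⟩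
    have hb : ∀ i, i ≠ i0 → b i = 0 := fun i hi => null i (hz i hi)
    intro i
    by_cases hi : i = i0
    · rw [Finset.sum_eq_single i0 (fun j _ hj => by rw [hb j hj]; ring) (by simp),
        Finset.sum_eq_single i0 (fun j _ hj => by rw [hb j hj]; ring) (by simp), sa] at e6
      rw [hi]
      have : b i0 ^ 2 = 0 := by linarith
      exact pow_eq_zero_iff (by norm_num) |>.1 this
    · exact hb i hi
  · right; left
    have hg' : g = 5 / 2 := by rw [hge, h1]; norm_num
    have hall : ∀ i, a i = 0 ∨ a i = -1 / 2 ∨ a i = 1 / 2 := by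
      intro i
      by_cases h0 : a i = 0
      · exact Or.inl h0
      right
      have h2 := quad i h0
      rw [hg'] at h2
      have : (a i - -1 / 2) * (a i - 1 / 2) = 0 := by linear_combination h2 / 10
      rcases mul_eq_zero.1 this with h | h
      · left; linarith
      · right; linarith
    obtain ⟨c1, c2⟩ := cnt (-1 / 2) (1 / 2) (by norm_num) (by norm_num) (by norm_num) hall
    refine ⟨hall, ?_, ?_, null, ?_⟩
    · have : ((Finset.univ.filter (fun i => a i = -1 / 2)).card : ℝ) = 3 := by linarith
      exact_mod_cast this
    · have : ((Finset.univ.filter (fun i => a i = 1 / 2)).card : ℝ) = 1 := by linarith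
      exact_mod_cast this
    · have : ∑ i, b i * l i * (1 + a i) + ∑ i, b i ^ 2 = -(5 / 2) * ∑ i, a i * b i ^ 2 := by
        rw [Finset.mul_sum, ← Finset.sum_add_distrib]
        refine Finset.sum_congr rfl fun i _ => ?_
        have f3 := e3 i; have f4 := e4 i; have f5 := e5 i
        rw [hg'] at f3 f5; rw [hk, hg'] at f4
        rcases hall i with h | h | h
        · rw [null i h, h]; ring
        · rw [h] at f3 f5 ⊢
          have hL : L i = 3 / 4 := by linarith
          rw [hL] at f5
          have : l i = b i / 2 := by linarith
          rw [this]; ring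
        · rw [h] at f3 f4 ⊢
          have hL : L i = 1 / 4 := by linarith
          rw [hL] at f4
          have : l i = -(3 / 2) * b i := by linarith
          rw [this]; ring
      rw [this] at e6; linarith
  · right; right
    have hg' : g = 4 := by rw [hge, h1]; norm_num
    have hall : ∀ i, a i = 0 ∨ a i = -1 / 16 ∨ a i = 1 / 4 := by
      intro i
      by_cases h0 : a i = 0
      · exact Or.inl h0
      right
      have h2 := quad i h0
      rw [hg'] at h2
      have : (a i - -1 / 16) * (a i - 1 / 4) = 0 := by linear_combination h2 / 16
      rcases mul_eq_zero.1 this with h | h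
      · left; linarith
      · right; linarith
    obtain ⟨c1, c2⟩ := cnt (-1 / 16) (1 / 4) (by norm_num) (by norm_num) (by norm_num) hall
    refine ⟨hall, ?_, ?_⟩
    · have : ((Finset.univ.filter (fun i => a i = -1 / 16)).card : ℝ) = 64 := by linarith
      exact_mod_cast this
    · have : ((Finset.univ.filter (fun i => a i = 1 / 4)).card : ℝ) = 12 := by linarith
      exact_mod_cast this

end

section
open MvPolynomial Asymptotics

lemma contract3 {n : ℕ} (a : Fin n → ℝ) (t : Fin n → Fin n → Fin n → ℝ) (W : Fin n → Fin n → ℝ)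
    (h : ∀ i j k, 8 * t i j k = 1 + 2 * dl i j + 2 * dl i k + 2 * dl j k + 8 * dl i j * dl j k +
      a i * W j k + a j * W i k + a k * W i j + 4 * a i * dl i j * W i k + 4 * a i * dl i k * W i j
      + 4 * a j * dl j k * W i j) (f g l : Fin n → ℝ) :
    8 * ∑ i, ∑ j, ∑ k, f i * g j * l k * t i j k =
      (∑ i, f i) * (∑ i, g i) * (∑ i, l i) + 2 * (∑ i, f i * g i) * (∑ i, l i) +
      2 * (∑ i, f i * l i) * (∑ i, g i) + 2 * (∑ i, g i * l i) * (∑ i, f i) +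
      8 * (∑ i, f i * g i * l i) + (∑ i, a i * f i) * (∑ j, ∑ k, g j * l k * W j k) +
      (∑ i, a i * g i) * (∑ j, ∑ k, f j * l k * W j k) +
      (∑ i, a i * l i) * (∑ j, ∑ k, f j * g k * W j k) +
      4 * (∑ j, ∑ k, (a j * f j * g j) * l k * W j k) +
      4 * (∑ j, ∑ k, (a j * f j * l j) * g k * W j k) +
      4 * (∑ j, ∑ k, f j * (a k * g k * l k) * W j k) := by
  have s1 : ∀ (u : Fin n → ℝ) i, ∑ k, u k * dl i k = u i := by
    intro u i; simp [dl]
  have e : ∀ i j k, 8 * (f i * g j * l k * t i j k) = f i * g j * l k + 2 * (f i * l k * (g j * dl i j))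
      + 2 * (f i * g j * (l k * dl i k)) + 2 * (f i * g j * (l k * dl j k)) +
      8 * (f i * (g j * dl i j * (l k * dl j k))) + (a i * f i) * (g j * l k * W j k) +
      (a j * g j) * (f i * l k * W i k) + (f i * g j * W i j) * (a k * l k) +
      4 * ((a i * f i * l k * W i k) * (g j * dl i j)) +
      4 * ((a i * f i * g j * W i j) * (l k * dl i k)) +
      4 * ((f i * (a j * g j) * W i j) * (l k * dl j k)) := by
    intro i j k; linear_combination (f i * g j * l k) * h i j k
  simp only [Finset.mul_sum (a := (8:ℝ)), e]
  simp only [Finset.sum_add_distrib, ← Finset.mul_sum, s1]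
  have c1 : ∑ i, ∑ j, f i * g j * ∑ k, l k = (∑ i, f i) * (∑ i, g i) * (∑ i, l i) := by
    simp only [← Finset.sum_mul, ← Finset.mul_sum]
  have c2 : ∑ i, ∑ j, (f i * ∑ k, l k) * (g j * dl i j) = (∑ i, f i * g i) * (∑ i, l i) := by
    simp only [← Finset.mul_sum, s1, Finset.sum_mul]
    exact Finset.sum_congr rfl fun i _ => by ring
  have c2' : ∑ i, ∑ j, ∑ k, f i * l k * (g j * dl i j) = (∑ i, f i * g i) * (∑ i, l i) := by
    rw [← c2]; simp only [← Finset.mul_sum, ← Finset.sum_mul]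
  have c5 : ∑ i, ∑ j, (a j * g j) * ∑ k, f i * l k * W i k =
      (∑ i, a i * g i) * (∑ j, ∑ k, f j * l k * W j k) := by
    simp only [← Finset.sum_mul, ← Finset.mul_sum]
  have c6 : ∑ i, ∑ j, ∑ k, (a i * f i * l k * W i k) * (g j * dl i j) =
      ∑ j, ∑ k, (a j * f j * g j) * l k * W j k := by
    refine Finset.sum_congr rfl fun i _ => ?_
    rw [Finset.sum_comm]
    simp only [← Finset.mul_sum, s1]
    exact Finset.sum_congr rfl fun i _ => by ring
  have c3 : ∑ i, ∑ j, f i * g j * l i = (∑ i, f i * l i) * (∑ i, g i) := by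
    simp only [← Finset.sum_mul, ← Finset.mul_sum]
    rw [Finset.sum_mul]; exact Finset.sum_congr rfl fun i _ => by ring
  have c4 : ∑ i, ∑ j, f i * g j * l j = (∑ i, g i * l i) * (∑ i, f i) := by
    simp only [mul_assoc, ← Finset.sum_mul, ← Finset.mul_sum]; ring
  have c7 : ∑ i, f i * ∑ j, g j * dl i j * l j = ∑ i, f i * g i * l i := by
    refine Finset.sum_congr rfl fun i _ => ?_
    rw [show ∑ j, g j * dl i j * l j = ∑ j, g j * l j * dl i j from
      Finset.sum_congr rfl fun j _ => by ring, s1]; ring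
  have c8 : ∑ i, (a i * f i) * ∑ j, ∑ k, g j * l k * W j k =
     (∑ i, a i * f i) * ∑ j, ∑ k, g j * l k * W j k := by rw [Finset.sum_mul]
  have c9 : ∑ i, ∑ j, f i * g j * W i j * ∑ k, a k * l k =
    (∑ i, a i * l i) * (∑ j, ∑ k, f j * g k * W j k) := by
    simp only [← Finset.sum_mul]; ring
  have c10 : ∑ i, ∑ j, a i * f i * g j * W i j * l i =
     ∑ j, ∑ k, (a j * f j * l j) * g k * W j k :=
    Finset.sum_congr rfl fun i _ => Finset.sum_congr rfl fun j _ => by ring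
  have c11 : ∑ i, ∑ j, f i * (a j * g j) * W i j * l j =
     ∑ j, ∑ k, f j * (a k * g k * l k) * W j k :=
    Finset.sum_congr rfl fun i _ => Finset.sum_congr rfl fun j _ => by ring
  rw [c1, c2', c3, c4, c7, c8, c5, c9, c6, c10, c11]
  ring

lemma exotic_alg {n m : ℕ} (hn : n = m + 1) (a : Fin n → ℝ) (t : Fin n → Fin n → Fin n → ℝ)
    (W : Fin n → Fin n → ℝ) (hW : ∀ i j, W i j = W j i) (ht1 : ∀ i j k, t i j k = t j i k)
    (ht2 : ∀ i j k, t i j k = t i k j)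
    (h : ∀ i j k, 8 * t i j k = 1 + 2 * dl i j + 2 * dl i k + 2 * dl j k + 8 * dl i j * dl j k +
      a i * W j k + a j * W i k + a k * W i j + 4 * a i * dl i j * W i k + 4 * a i * dl i k * W i j
      + 4 * a j * dl j k * W i j)
    (hs : ∀ j k, ∑ i, a i * t i j k = 0)
    (htot : ∑ i, ∑ j, ∑ k, t i j k = (m:ℝ) / 2 * (m / 2 + 1) * (m / 2 + 2))
    (P Q Z : Fin n → ℝ) (hP : ∀ i, P i = 0 ∨ P i = 1) (hQ : ∀ i, Q i = 0 ∨ Q i = 1)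
    (hPQ : ∀ i, P i * Q i = 0) (hZ : ∀ i, Z i = 1 - P i - Q i)
    (haPQ : ∀ i, a i = -1 / 16 * P i + 1 / 4 * Q i) (cP : ∑ i, P i = 64) (cQ : ∑ i, Q i = 12) :
    False := by
  have PP : ∀ i, P i * P i = P i := fun i => by rcases hP i with h | h <;> simp [h]
  have QQ : ∀ i, Q i * Q i = Q i := fun i => by rcases hQ i with h | h <;> simp [h]
  have QP : ∀ i, Q i * P i = 0 := fun i => by rw [mul_comm, hPQ]
  have ZZ : ∀ i, Z i * Z i = Z i := fun i => by
    rw [hZ]; linear_combination PP i + QQ i + 2 * hPQ i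
  have PZ : ∀ i, P i * Z i = 0 := fun i => by rw [hZ]; linear_combination - PP i - hPQ i
  have QZ : ∀ i, Q i * Z i = 0 := fun i => by rw [hZ]; linear_combination - QQ i - hPQ i
  have aP : ∀ i, a i * P i = -1 / 16 * P i := fun i => by
    rw [haPQ]; linear_combination -1 / 16 * PP i + 1 / 4 * hPQ i
  have aQ : ∀ i, a i * Q i = 1 / 4 * Q i := fun i => by
    rw [haPQ]; linear_combination 1 / 4 * QQ i - 1 / 16 * hPQ i
  have aZ : ∀ i, a i * Z i = 0 := fun i => by
    rw [haPQ]; linear_combination -1 / 16 * PZ i + 1 / 4 * QZ i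
  obtain ⟨d, hd⟩ : ∃ d, d = ∑ i, Z i := ⟨_, rfl⟩
  have hmd : (m:ℝ) = 75 + d := by
    have : d = n - 64 - 12 := by
      rw [hd]; simp only [hZ, Finset.sum_sub_distrib, cP, cQ]; simp
    rw [hn] at this; push_cast at this; linarith
  have C := contract3 a t W h
  let T := fun f g l : Fin n → ℝ => ∑ i, ∑ j, ∑ k, f i * g j * l k * t i j k
  let V := fun f g : Fin n → ℝ => ∑ j, ∑ k, f j * g k * W j k
  have T12 : ∀ f g l, T f g l = T g f l := by
    intro f g l
    simp only [T]; rw [Finset.sum_comm]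
    exact Finset.sum_congr rfl fun i _ => Finset.sum_congr rfl fun j _ =>
      Finset.sum_congr rfl fun k _ => by rw [ht1]; ring
  have T23 : ∀ f g l, T f g l = T f l g := by
    intro f g l
    simp only [T]
    refine Finset.sum_congr rfl fun i _ => ?_
    rw [Finset.sum_comm]
    exact Finset.sum_congr rfl fun j _ =>
      Finset.sum_congr rfl fun k _ => by rw [ht2]; ring
  have V12 : ∀ f g, V f g = V g f := by
    intro f g
    simp only [V]; rw [Finset.sum_comm]
    exact Finset.sum_congr rfl fun i _ => Finset.sum_congr rfl fun j _ => by rw [hW]; ring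
  have sup : ∀ g l, T P g l = 4 * T Q g l := by
    intro g l
    have : T a g l = 0 := by
      simp only [T]
      rw [Finset.sum_comm]
      refine Finset.sum_eq_zero fun j _ => ?_
      rw [Finset.sum_comm]
      refine Finset.sum_eq_zero fun k _ => ?_
      have : ∑ i, a i * g j * l k * t i j k = g j * l k * ∑ i, a i * t i j k := by
        rw [Finset.mul_sum]; exact Finset.sum_congr rfl fun i _ => by ring
      rw [this, hs, mul_zero]
    have h2 : T a g l = -1 / 16 * T P g l + 1 / 4 * T Q g l := by
      simp only [T, Finset.mul_sum, ← Finset.sum_add_distrib]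
      exact Finset.sum_congr rfl fun i _ => Finset.sum_congr rfl fun j _ =>
        Finset.sum_congr rfl fun k _ => by rw [haPQ]; ring
    linarith
  have tot : ∑ i, ∑ j, ∑ k, t i j k = T P P P + T Q Q Q + T Z Z Z + 3 * T P P Q + 3 * T Q Q P +
      3 * T P P Z + 3 * T P Z Z + 3 * T Q Q Z + 3 * T Q Z Z + 6 * T P Q Z := by
    have h0 : ∑ i, ∑ j, ∑ k, t i j k = T P P P + T P P Q + T P P Z + T P Q P + T P Q Q + T P Q Z +
      T P Z P + T P Z Q + T P Z Z + T Q P P + T Q P Q + T Q P Z + T Q Q P + T Q Q Q + T Q Q Z +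
      T Q Z P + T Q Z Q + T Q Z Z + T Z P P + T Z P Q + T Z P Z + T Z Q P + T Z Q Q + T Z Q Z +
      T Z Z P + T Z Z Q + T Z Z Z := by
      simp only [T, ← Finset.sum_add_distrib]
      exact Finset.sum_congr rfl fun i _ => Finset.sum_congr rfl fun j _ =>
        Finset.sum_congr rfl fun k _ => by rw [hZ, hZ, hZ]; ring
    rw [h0, T23 P Q P, T12 P Q Q, T23 Q P Q, T23 P Z P, T12 Q P P, T23 P Q P, T23 P Z Q, T12 Q P Z,
      T23 Q Z P, T12 Q P Z, T23 Q Z Q, T12 Z P P, T23 P Z P, T12 Z P Q, T23 P Z Q, T12 Z P Z,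
      T12 Z Q P, T23 Q Z P, T12 Q P Z, T12 Z Q Q, T23 Q Z Q, T12 Z Q Z, T23 Z Z P, T12 Z P Z,
      T23 Z Z Q, T12 Z Q Z]
    ring
  rw [tot, hmd] at htot
  have z1 : ∀ g, V (fun _ => 0) g = 0 := fun g => by simp [V]
  have z2 : ∀ g, V g (fun _ => 0) = 0 := fun g => by simp [V]
  have sm : ∀ (c : ℝ) f g, V (fun i => c * f i) g = c * V f g := by
    intro c f g; simp only [V, Finset.mul_sum]
    exact Finset.sum_congr rfl fun i _ => Finset.sum_congr rfl fun j _ => by ring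
  have sm2 : ∀ (c : ℝ) f g, V g (fun i => c * f i) = c * V g f := by
    intro c f g; rw [V12, sm, V12]
  have C' : ∀ f g l : Fin n → ℝ, 8 * T f g l =
      (∑ i, f i) * (∑ i, g i) * (∑ i, l i) + 2 * (∑ i, f i * g i) * (∑ i, l i) +
      2 * (∑ i, f i * l i) * (∑ i, g i) + 2 * (∑ i, g i * l i) * (∑ i, f i) +
      8 * (∑ i, f i * g i * l i) + (∑ i, a i * f i) * V g l +
      (∑ i, a i * g i) * V f l + (∑ i, a i * l i) * V f g +
      4 * V (fun j => a j * f j * g j) l + 4 * V (fun j => a j * f j * l j) g +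
      4 * V f (fun k => a k * g k * l k) := C
  have q1 := C' P P P; have q2 := C' Q Q Q; have q3 := C' Z Z Z; have q4 := C' P P Q
  have q5 := C' Q Q P; have q6 := C' P P Z; have q7 := C' P Z Z; have q8 := C' Q Q Z
  have q9 := C' Q Z Z; have q10 := C' P Q Z
  simp only [PP, QQ, ZZ, hPQ, QP, PZ, QZ, aP, aQ, aZ, mul_assoc, ← Finset.mul_sum, cP, cQ, ← hd, z1,
    z2, sm, sm2, Finset.sum_const_zero, mul_zero, zero_mul, add_zero]
    at q1 q2 q3 q4 q5 q6 q7 q8 q9 q10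
  have u1 := sup P P; have u2 := sup P Q; have u3 := sup Q Q; have u4 := sup P Z
  have u5 := sup Q Z; have u6 := sup Z Z
  have r1 : T Q P P = T P P Q := by rw [T12, T23]
  have r2 : T Q P Q = T Q Q P := T23 _ _ _
  have r3 : T Q P Z = T P Q Z := T12 _ _ _
  have r4 : T P Q Q = T Q Q P := by rw [T12, T23]
  rw [V12 Q P] at *
  linarith

open Classical in
lemma no_exotic {n m : ℕ} {S : Set (E n)} {γ : ℝ → Measure (E n)} (hn : n = m + 1)
    (h : ∀ ε, 0 < ε → GS m S ε (γ ε)) (a b : Fin n → ℝ) (hdeg : (qpoly a b).totalDegree = 2)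
    (hq : ∀ x ∈ S, eval x.ofLp (qpoly a b) = 0)
    (hdiv : ∀ p : MvPolynomial (Fin n) ℝ, (∀ x ∈ S, eval x.ofLp p = 0) → qpoly a b ∣ p)
    (hall : ∀ i, a i = 0 ∨ a i = -1 / 16 ∨ a i = 1 / 4)
    (c1 : (Finset.univ.filter (fun i => a i = -1 / 16)).card = 64)
    (c2 : (Finset.univ.filter (fun i => a i = 1 / 4)).card = 12) : False := by
  obtain ⟨U, hU⟩ := exists_ultra
  have hpos : ∀ᶠ ε : ℝ in U, 0 < ε := hU self_mem_nhdsWithin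
  obtain ⟨ℓ, hℓ1, hℓ2⟩ := division_bigO (K := 6) (l := 𝓝[>] 0) (qpoly a b) hdeg hdiv
    (fun ε => PT (γ ε) ε 6) (fun ε => PT_totalDegree _ _ _) (fun x hx => PT_bigO h 6 hx)
  have dd : ∀ x : Fin n, dl x x = 1 := fun x => by simp [dl]
  have dn : ∀ x y : Fin n, x ≠ y → dl x y = 0 := fun x y h => by simp [dl, h]
  obtain ⟨i0, hi0⟩ : ∃ i0, a i0 ≠ 0 := by
    have : (Finset.univ.filter (fun i => a i = 1 / 4)).Nonempty := by
      rw [← Finset.card_pos, c2]; norm_num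
    obtain ⟨i, hi⟩ := this
    exact ⟨i, by rw [(Finset.mem_filter.1 hi).2]; norm_num⟩
  have hid : Tendsto (fun ε : ℝ => ε) U (𝓝 0) :=
    tendsto_id.mono_left (hU.trans nhdsWithin_le_nhds)
  have hidT : Tm U (fun ε => ε) := ⟨0, hid⟩
  have Mt : ∀ s, Tm U (fun ε => mom (γ ε) s) := by
    intro s
    apply ultra_lim U
    filter_upwards [hpos] with ε hε using (h ε hε).mom_bound s
  have et : ∀ s, Tm U (fun ε => (pd s (PT (γ ε) ε 6) - pd s (qpoly a b * ℓ ε)) / ε ^ 7) :=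
    fun s => ultra_bigO hU (pd_bigO hℓ2 s)
  have sw1 : ∀ (i j k : Fin n) ε, dl i j * pd [i, j, k, k] (ℓ ε) = dl i j * pd [i, i, k, k] (ℓ ε) := by
    intro i j k ε
    by_cases hij : i = j
    · subst hij; rfl
    · rw [dn _ _ hij]; simp
  have sw2 : ∀ (i j k : Fin n) ε, dl i k * pd [i, j, j, k] (ℓ ε) = dl i k * pd [i, i, j, j] (ℓ ε) := by
    intro i j k ε
    by_cases hij : i = k
    · subst hij; congr 1; exact pd_perm (by
        refine List.Perm.cons _ ?_
        exact (List.perm_append_comm (l₁ := [j, j]) (l₂ := [i]))) _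
    · rw [dn _ _ hij]; simp
  have sw3 : ∀ (i j k : Fin n) ε, dl j k * pd [i, i, j, k] (ℓ ε) = dl j k * pd [i, i, j, j] (ℓ ε) := by
    intro i j k ε
    by_cases hij : j = k
    · subst hij; rfl
    · rw [dn _ _ hij]; simp
  have F : ∀ i j k : Fin n, ∀ᶠ ε : ℝ in U, 8 * mom (γ ε) [i, i, j, j, k, k] =
      1 + 2 * dl i j + 2 * dl i k + 2 * dl j k + 8 * dl i j * dl j k +
      a i * (pd [j, j, k, k] (ℓ ε) / (4 * ε ^ 6)) + a j * (pd [i, i, k, k] (ℓ ε) / (4 * ε ^ 6)) +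
      a k * (pd [i, i, j, j] (ℓ ε) / (4 * ε ^ 6)) +
      4 * a i * dl i j * (pd [i, i, k, k] (ℓ ε) / (4 * ε ^ 6)) +
      4 * a i * dl i k * (pd [i, i, j, j] (ℓ ε) / (4 * ε ^ 6)) +
      4 * a j * dl j k * (pd [i, i, j, j] (ℓ ε) / (4 * ε ^ 6)) + ε * ((1 / 8) *
      ((pd [i, i, j, j, k, k] (PT (γ ε) ε 6) -
        pd [i, i, j, j, k, k] (qpoly a b * ℓ ε)) / ε ^ 7)) := by
    intro i j k
    filter_upwards [hpos] with ε hε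
    rw [pd_PT6, pd6 _ _ _ _ _ _ (Or.inl (by have := hℓ1 ε; simp at this; omega))]
    field_simp
    linear_combination (32 * a i) * sw1 i j k ε + 32 * a i * sw2 i j k ε + 32 * a j * sw3 i j k ε
  have hsym : ∀ (i j : Fin n) ε, pd [i, i, j, j] (ℓ ε) = pd [j, j, i, i] (ℓ ε) := fun i j ε =>
    pd_perm (List.perm_append_comm (l₁ := [i, i]) (l₂ := [j, j])) _
  have t00 : Tm U (fun ε => pd [i0, i0, i0, i0] (ℓ ε) / (4 * ε ^ 6)) := by
    refine Tm.of (15 * a i0) (by simpa using hi0)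
      ((((Tm.const U 8).mul (Mt [i0, i0, i0, i0, i0, i0])).sub (Tm.const U 15)).sub
        (hidT.mul ((Tm.const U (1/8)).mul (et [i0, i0, i0, i0, i0, i0])))) ?_
    filter_upwards [F i0 i0 i0] with ε h1
    simp only [dd] at h1
    linear_combination -h1
  have t0j : ∀ j, Tm U (fun ε => pd [i0, i0, j, j] (ℓ ε) / (4 * ε ^ 6)) := by
    intro j
    by_cases hj : i0 = j
    · subst hj; exact t00
    refine Tm.of (6 * a i0) (by simpa using hi0)
      (((((Tm.const U 8).mul (Mt [i0, i0, i0, i0, j, j])).sub (Tm.const U 3)).sub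
        ((Tm.const U (a j)).mul t00)).sub
        (hidT.mul ((Tm.const U (1/8)).mul (et [i0, i0, i0, i0, j, j])))) ?_
    filter_upwards [F i0 i0 j] with ε h1
    simp only [dd, dn _ _ hj] at h1
    linear_combination -h1
  have v2t : ∀ i j, Tm U (fun ε => pd [i, i, j, j] (ℓ ε) / (4 * ε ^ 6)) := by
    intro i j
    refine Tm.of (a i0) hi0
      ((((((Tm.const U 8).mul (Mt [i0, i0, i, i, j, j])).sub
        (Tm.const U (1 + 2 * dl i0 i + 2 * dl i0 j + 2 * dl i j + 8 * dl i0 i * dl i j))).sub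
        ((Tm.const U (a i + 4 * a i0 * dl i0 i)).mul (t0j j))).sub
        ((Tm.const U (a j + 4 * a i0 * dl i0 j + 4 * a i * dl i j)).mul (t0j i))).sub
        (hidT.mul ((Tm.const U (1/8)).mul (et [i0, i0, i, i, j, j])))) ?_
    filter_upwards [F i0 i j] with ε h1
    linear_combination -h1
  choose T hT using Mt
  choose W hW using v2t
  have hS : ∀ s t : List (Fin n), s.Perm t → T s = T t := by
    intro s t hst
    exact tendsto_nhds_unique (hT s) ((hT t).congr fun ε => (mom_perm hst _).symm)
  have inst := Classical.decEq (Fin n)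
  refine exotic_alg hn a (fun i j k => T [i, i, j, j, k, k]) W ?_ ?_ ?_ ?_ ?_ ?_
    (fun i => if a i = -1 / 16 then 1 else 0) (fun i => if a i = 1 / 4 then 1 else 0)
    (fun i => 1 - (if a i = -1 / 16 then 1 else 0) - (if a i = 1 / 4 then 1 else 0))
    ?_ ?_ ?_ (fun i => rfl) ?_ ?_ ?_
  · intro i j
    exact tendsto_nhds_unique (hW i j) ((hW j i).congr fun ε => by rw [hsym])
  · intro i j k
    exact hS _ _ ((List.perm_append_comm (l₁ := [i, i]) (l₂ := [j, j])).append_right [k, k])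
  · intro i j k
    exact hS _ _ ((List.perm_append_comm (l₁ := [j, j]) (l₂ := [k, k])).append_left [i, i])
  · intro i j k
    obtain ⟨c, hc⟩ := et [i, i, j, j, k, k]
    have R := (((((((tendsto_const_nhds (x := 1 + 2 * dl i j + 2 * dl i k + 2 * dl j k +
      8 * dl i j * dl j k)).add
      ((hW j k).const_mul (a i))).add ((hW i k).const_mul (a j))).add
      ((hW i j).const_mul (a k))).add ((hW i k).const_mul (4 * a i * dl i j))).add
      ((hW i j).const_mul (4 * a i * dl i k))).add ((hW i j).const_mul (4 * a j * dl j k))).add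
      (hid.mul (hc.const_mul (1 / 8)))
    have := tendsto_nhds_unique ((hT [i, i, j, j, k, k]).const_mul 8) (R.congr' (by
      filter_upwards [F i j k] with ε h1
      rw [h1]))
    linear_combination this
  · intro j k
    obtain ⟨c, hc⟩ := Tm.sum fun i => (Tm.const U (b i)).mul ⟨_, hT [i, j, j, k, k]⟩
    have R := (tendsto_finsetSum Finset.univ fun i _ =>
      (hT [i, i, j, j, k, k]).const_mul (a i)).add (hid.mul hc)
    rw [zero_mul, add_zero] at R
    refine tendsto_nhds_unique R (tendsto_const_nhds.congr' ?_)
    filter_upwards [hpos] with ε hε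
    exact ((h ε hε).mom_supp hε a b hq [j, j, k, k]).symm
  · have R := tendsto_finsetSum Finset.univ fun i _ => tendsto_finsetSum Finset.univ fun j _ =>
      tendsto_finsetSum Finset.univ fun k _ => hT [i, i, j, j, k, k]
    refine tendsto_nhds_unique R (tendsto_const_nhds.congr' ?_)
    filter_upwards [hpos] with ε hε
    have G := h ε hε
    have i6 := fun (i j k : Fin n) => G.int_list [i, i, j, j, k, k]
    unfold mom
    rw [← G.m6]
    simp_rw [← integral_finsetSum _ (fun k _ => i6 _ _ k)]
    simp_rw [← integral_finsetSum _ (fun j _ => integrable_finsetSum _ (fun k _ => i6 _ j k))]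
    rw [← integral_finsetSum _ (fun i _ => integrable_finsetSum _ (fun j _ =>
      integrable_finsetSum _ (fun k _ => i6 i j k)))]
    congr 1; ext z
    rw [show ‖z‖ ^ 6 = ‖z‖ ^ 2 * (‖z‖ ^ 2 * ‖z‖ ^ 2) by ring, EuclideanSpace.norm_sq_eq,
      Finset.sum_mul_sum, Finset.sum_mul_sum]
    apply Finset.sum_congr rfl; intro i _
    apply Finset.sum_congr rfl; intro j _
    rw [Finset.mul_sum]
    apply Finset.sum_congr rfl; intro k _
    simp; ring
  · intro i; split_ifs <;> simp
  · intro i; split_ifs <;> simp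
  · intro i
    rcases hall i with h | h | h <;> simp only [h] <;> norm_num
  · intro i
    rcases hall i with h | h | h <;> simp only [h] <;> norm_num
  · rw [Finset.sum_boole, c1]; norm_num
  · rw [Finset.sum_boole, c2]; norm_num
end

section
open MvPolynomial Asymptotics

/-- continuous and separately analytic -/
def SA {m : ℕ} (f : (Fin m → ℝ) → ℝ) : Prop :=
  Continuous f ∧ ∀ x i, AnalyticOnNhd ℝ (fun t : ℝ => f (Function.update x i t)) univ

lemma an_null {f : ℝ → ℝ} (hf : AnalyticOnNhd ℝ f univ) (h : volume {t | f t = 0} ≠ 0) (x : ℝ) :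
    f x = 0 := by
  by_contra hx
  have h1 := hf.preimage_zero_mem_codiscrete hx
  have h2 := ae_restrict_le_codiscreteWithin (μ := (volume : Measure ℝ)) MeasurableSet.univ h1
  rw [Measure.restrict_univ, mem_ae_iff] at h2
  apply h
  convert h2 using 2
  ext t; simp

lemma SA.null {m : ℕ} {f : (Fin m → ℝ) → ℝ} (hf : SA f) (h : volume {x | f x = 0} ≠ 0)
    (x : Fin m → ℝ) : f x = 0 := by
  induction m with
  | zero =>
    obtain ⟨y, hy⟩ := nonempty_of_measure_ne_zero h
    rw [Subsingleton.elim x y]; exact hy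
  | succ m ih =>
    let e := MeasurableEquiv.piFinSuccAbove (fun _ : Fin (m + 1) => ℝ) 0
    have he := volume_preserving_piFinSuccAbove (fun _ : Fin (m + 1) => ℝ) 0
    have hm : MeasurableSet {x | f x = 0} := (isClosed_eq hf.1 continuous_const).measurableSet
    have hc : ∀ t : ℝ, ∀ y : Fin m → ℝ, e.symm (t, y) = Fin.cons t y := fun t y => by
      simp [e, MeasurableEquiv.piFinSuccAbove]; rfl
    have h2 : (volume.prod volume) (e.symm ⁻¹' {x | f x = 0}) ≠ 0 := by
      have := (he.symm _).measure_preimage (s := {x | f x = 0}) hm.nullMeasurableSet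
      rw [← this] at h
      exact h
    rw [Ne, Measure.measure_prod_null (e.symm.measurable hm)] at h2
    have hs : ∀ t : ℝ, SA (fun y : Fin m → ℝ => f (Fin.cons t y)) := by
      intro t
      refine ⟨hf.1.comp (Continuous.finCons continuous_const continuous_id), fun y i => ?_⟩
      have := hf.2 (Fin.cons t y) i.succ
      simpa [Fin.cons_update] using this
    have h3 : volume {t : ℝ | ∀ y : Fin m → ℝ, f (Fin.cons t y) = 0} ≠ 0 := by
      intro h0
      apply h2
      rw [← compl_mem_ae_iff] at h0
      filter_upwards [h0] with t ht
      by_contra hne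
      refine ht fun y => ih (hs t) ?_ y
      intro h0
      apply hne
      rw [Pi.zero_apply, ← h0]
      congr 1
      ext z; simp [hc]
    have h4 := hf.2 x 0
    have := an_null h4 (fun h0 => h3 (measure_mono_null (fun t ht => ?_) h0)) (x 0)
    · simpa using this
    · have := ht (Fin.tail x)
      rw [mem_ofPred_eq, ← this]
      congr 1
      funext i
      refine Fin.cases ?_ (fun j => ?_) i <;> simp [Fin.tail]

lemma poly_SA {m : ℕ} (p : MvPolynomial (Fin m) ℝ) : SA (fun x => eval x p) := by
  refine ⟨MvPolynomial.continuous_eval p, fun x i => ?_⟩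
  have := AnalyticOnNhd.aeval_mvPolynomial (𝕜 := ℝ) (s := univ)
    (f := fun t : ℝ => Function.update x i t) (fun j => ?_) p
  · simpa using this
  · by_cases hj : j = i
    · subst hj; simp only [Function.update_self]; exact analyticOnNhd_id
    · simp only [Function.update_of_ne hj]; exact analyticOnNhd_const

lemma poly_null {m : ℕ} {p : MvPolynomial (Fin m) ℝ} (hp : p ≠ 0) :
    volume {x | eval x p = 0} = 0 := by
  by_contra h
  exact hp (MvPolynomial.funext fun x => by simpa using (poly_SA p).null h x)

lemma IsUnif.le_haus {n m : ℕ} {ν : Measure (E n)} (h : IsUnif m ν) :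
    ν ≤ Measure.hausdorffMeasure (m : ℝ) := by
  refine Measure.le_hausdorffMeasure _ ν 1 one_pos fun s hs => ?_
  by_cases hx : ∃ x ∈ s, x ∈ msupp ν
  · obtain ⟨x, hxs, hx⟩ := hx
    have hfin : ediam s ≠ ⊤ := ne_top_of_le_ne_top ENNReal.one_ne_top hs
    set D := (ediam s).toReal with hD
    have hb : ∀ r : ℝ, D < r → ν s ≤ ENNReal.ofReal (r ^ m) := by
      intro r hr
      have hr0 : 0 < r := lt_of_le_of_lt ENNReal.toReal_nonneg hr
      rw [← h x hx r hr0]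
      apply measure_mono
      intro y hy
      rw [mem_closedBall, dist_edist]
      exact (ENNReal.toReal_mono hfin (edist_le_ediam_of_mem hy hxs)).trans hr.le
    have : ediam s ^ (m:ℝ) = ENNReal.ofReal (D ^ m) := by
      rw [ENNReal.rpow_natCast, ENNReal.ofReal_pow ENNReal.toReal_nonneg, ENNReal.ofReal_toReal hfin]
    rw [this]
    have hc : Tendsto (fun r : ℝ => ENNReal.ofReal (r ^ m)) (𝓝[>] D) (𝓝 (ENNReal.ofReal (D ^ m))) :=
      ((ENNReal.continuous_ofReal.comp (continuous_pow m)).tendsto D).mono_left nhdsWithin_le_nhds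
    exact ge_of_tendsto hc (by filter_upwards [self_mem_nhdsWithin] with r hr using hb r hr)
  · have : ν s = 0 := measure_mono_null (fun y hy => fun hy' => hx ⟨y, hy, hy'⟩)
      (mem_ae_iff.1 (msupp_ae ν))
    rw [this]; exact zero_le

/-- dropping the coordinate `i` -/
def tl {m : ℕ} (i : Fin (m + 1)) (x : E (m + 1)) : Fin m → ℝ := fun j => x (i.succAbove j)

lemma null_piece {m : ℕ} (i : Fin (m + 1)) {A S : Set (E (m + 1))} (hSA : S ⊆ A) {K : NNReal}
    (hK : ∀ x ∈ A, ∀ y ∈ A, dist x y ≤ K * dist (tl i x) (tl i y)) (hS : volume (tl i '' S) = 0) :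
    Measure.hausdorffMeasure (m : ℝ) S = 0 := by
  have h1 : AntilipschitzWith K (fun x : S => tl i x.1) := by
    refine AntilipschitzWith.of_le_mul_dist fun x y => ?_
    exact hK _ (hSA x.2) _ (hSA y.2)
  have h2 := h1.le_hausdorffMeasure_image (d := m) (by positivity) univ
  have h3 : (fun x : S => tl i x.1) '' univ = tl i '' S := by
    ext z; simp
  have h4 : (Measure.hausdorffMeasure (m:ℝ) : Measure (Fin m → ℝ)) = volume := by
    have := hausdorffMeasure_pi_real (ι := Fin m); simpa using this
  rw [h3, h4, hS, mul_zero] at h2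
  have h5 := (isometry_subtype_coe (s := S)).hausdorffMeasure_image (d := m) (Or.inl (by positivity)) univ
  simp only [image_univ, Subtype.range_coe] at h5
  rw [h5]; exact le_antisymm h2 zero_le

lemma dist_tl {m : ℕ} (i : Fin (m + 1)) (x y : E (m + 1)) :
    dist x y ≤ |x i - y i| + m * dist (tl i x) (tl i y) := by
  have h1 : dist x y ≤ ∑ j, |x j - y j| := by
    rw [EuclideanSpace.dist_eq]
    refine Real.sqrt_le_iff.2 ⟨by positivity, ?_⟩
    simp only [Real.dist_eq]
    exact Finset.sum_sq_le_sq_sum_of_nonneg fun j _ => abs_nonneg _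
  refine h1.trans ?_
  rw [Fin.sum_univ_succAbove _ i]
  gcongr
  calc _ ≤ ∑ j : Fin m, dist (tl i x) (tl i y) := by
        gcongr with j; exact dist_le_pi_dist (tl i x) (tl i y) j
    _ = _ := by simp

lemma NULL {m : ℕ} {ν : Measure (E (m + 1))} (h : IsUnif m ν) (i : Fin (m + 1)) (c : ℝ)
    {g : (Fin m → ℝ) → ℝ} (hg : ContDiff ℝ 1 g) {S : Set (E (m + 1))}
    (hS : ∀ x ∈ S, (x i + c) ^ 2 = g (tl i x)) (h0 : volume (tl i '' S) = 0) : ν S = 0 := by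
  have hz : Measure.hausdorffMeasure (m:ℝ) S = 0 := by
    have main : ∀ k : ℕ, ∀ σ : ℝ, σ ^ 2 = 1 → Measure.hausdorffMeasure (m:ℝ)
        (S ∩ {x | ‖tl i x‖ ≤ k ∧ 1 ≤ k * (σ * (x i + c))}) = 0 := by
      intro k σ hσ
      obtain ⟨L, hL⟩ := hg.contDiffOn.exists_lipschitzOnWith one_ne_zero (convex_closedBall (0:Fin m → ℝ) k)
        (isCompact_closedBall _ _)
      refine null_piece i (K := k * L + m) subset_rfl (fun x hx y hy => ?_)
        (measure_mono_null (image_mono inter_subset_left) h0)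
      refine (dist_tl i x y).trans ?_
      have h1 := hL.dist_le_mul (tl i x) (by simpa using hx.2.1) (tl i y) (by simpa using hy.2.1)
      rw [← hS x hx.1, ← hS y hy.1, Real.dist_eq] at h1
      have e : (x i + c)^2 - (y i + c)^2 = (x i - y i) * (σ * (σ * (x i + c) + σ * (y i + c))) := by
        linear_combination (-((x i + c)^2 - (y i + c)^2)) * hσ
      rw [e, abs_mul, abs_mul] at h1
      have hs1 : |σ| = 1 := by
        have := sq_abs σ; rw [hσ] at this
        nlinarith [abs_nonneg σ]
      have hk : 1 ≤ k * |σ * (x i + c) + σ * (y i + c)| := by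
        have h2 := hx.2.2
        have h3 := hy.2.2
        have := le_abs_self (σ * (x i + c) + σ * (y i + c))
        have hk0 : (0:ℝ) ≤ k := by positivity
        nlinarith [mul_le_mul_of_nonneg_left this hk0]
      rw [hs1, one_mul] at h1
      have : |x i - y i| ≤ k * L * dist (tl i x) (tl i y) := by
        have h5 := mul_le_mul_of_nonneg_left hk (abs_nonneg (x i - y i))
        have hk0 : (0:ℝ) ≤ k := by positivity
        nlinarith [mul_le_mul_of_nonneg_left h1 hk0]
      push_cast
      linarith
    have m0 : Measure.hausdorffMeasure (m:ℝ) (S ∩ {x | x i + c = 0}) = 0 := by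
      refine null_piece i (K := m) subset_rfl (fun x hx y hy => ?_)
        (measure_mono_null (image_mono inter_subset_left) h0)
      refine (dist_tl i x y).trans ?_
      have h1 : x i + c = 0 := hx.2
      have h2 : y i + c = 0 := hy.2
      rw [show x i - y i = 0 by linarith]; simp
    refine measure_mono_null (t := (⋃ k : ℕ, (S ∩ {x | ‖tl i x‖ ≤ k ∧ 1 ≤ k * (1 * (x i + c))}) ∪
      (S ∩ {x | ‖tl i x‖ ≤ k ∧ 1 ≤ k * ((-1) * (x i + c))})) ∪ (S ∩ {x | x i + c = 0})) ?_ ?_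
    · intro x hx
      by_cases h1 : x i + c = 0
      · exact Or.inr ⟨hx, h1⟩
      left
      obtain ⟨k, hk⟩ := exists_nat_ge (max ‖tl i x‖ (1 / |x i + c|))
      have h2 : 0 < |x i + c| := abs_pos.2 h1
      have hk1 := (le_max_left _ _).trans hk
      have hk2 := (div_le_iff₀ h2).1 ((le_max_right _ _).trans hk)
      refine mem_iUnion.2 ⟨k, ?_⟩
      rcases abs_cases (x i + c) with h3 | h3
      · left; refine ⟨hx, hk1, ?_⟩; rw [h3.1] at hk2; simpa using hk2
      · right; refine ⟨hx, hk1, ?_⟩; rw [h3.1] at hk2; simpa using hk2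
    · refine measure_union_null (measure_iUnion_null fun k => measure_union_null ?_ ?_) m0
      · exact main k 1 (by norm_num)
      · exact main k (-1) (by norm_num)
  exact le_antisymm (by simpa [hz] using h.le_haus S) zero_le
end

section
open MvPolynomial Asymptotics

lemma affine_eval {m : ℕ} {d : MvPolynomial (Fin m) ℝ} (hd : d.totalDegree ≤ 1) :
    ∃ d0 : ℝ, ∃ w : Fin m → ℝ, ∀ y, eval y d = d0 + ∑ j, w j * y j := by
  refine ⟨coeff 0 d, fun j => coeff (Finsupp.single j 1) d, fun y => ?_⟩
  have : d = C (coeff 0 d) + ∑ j, C (coeff (Finsupp.single j 1) d) * X j := by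
    ext s
    rw [coeff_add, coeff_C, coeff_sum]
    simp only [coeff_C_mul, coeff_X, mul_ite, mul_one, mul_zero]
    by_cases hs : s.degree ≤ 1
    · rcases Nat.le_one_iff_eq_zero_or_eq_one.1 hs with h0 | h1
      · rw [Finsupp.degree_eq_zero_iff] at h0
        subst h0
        rw [Finset.sum_eq_zero]; · simp
        intro j _
        rw [if_neg]; intro h; have := DFunLike.congr_fun h j; simp at this
      · obtain ⟨i, rfl⟩ := (Finsupp.sum_eq_one_iff s).1 h1
        rw [if_neg, zero_add, Finset.sum_eq_single i]
        · simp
        · intro j _ hj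
          rw [if_neg]; intro h; exact hj (Finsupp.single_left_injective one_ne_zero h)
        · simp
        · intro h; have := DFunLike.congr_fun h i; simp at this
    · have h0 : coeff s d = 0 := by
        by_contra h
        exact hs ((le_totalDegree (mem_support_iff.2 h)).trans hd)
      rw [h0, if_neg, Finset.sum_eq_zero]; · simp
      · intro j _
        rw [if_neg]; rintro rfl; simp at hs
      · rintro rfl; simp at hs
  conv_lhs => rw [this]
  simp

lemma poly_contDiff {m : ℕ} (p : MvPolynomial (Fin m) ℝ) : ContDiff ℝ 1 (fun x => eval x p) := by
  induction p using MvPolynomial.induction_on with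
  | C a => simp only [eval_C]; exact contDiff_const
  | add p q hp hq => simp only [map_add]; exact hp.add hq
  | mul_X p i hp => simp only [map_mul, eval_X]; exact hp.mul (contDiff_apply ℝ ℝ i)

lemma cons_tl {m : ℕ} (x : E (m + 1)) : x.ofLp = Fin.cons (x 0) (tl 0 x) := by
  funext i
  refine Fin.cases ?_ (fun j => ?_) i <;> simp [tl]

lemma vanish_poly {m : ℕ} {ν : Measure (E (m + 1))} (h : IsUnif m ν) (hne : (msupp ν).Nonempty)
    (i : Fin (m + 1)) (c : ℝ) {g : (Fin m → ℝ) → ℝ} (hg : ContDiff ℝ 1 g)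
    (hS : ∀ x ∈ msupp ν, (x i + c) ^ 2 = g (tl i x)) {p : MvPolynomial (Fin m) ℝ}
    (hp : ∀ x ∈ msupp ν, eval (tl i x) p = 0) : p = 0 := by
  by_contra hp0
  have h1 : ν (msupp ν) = 0 := NULL h i c hg hS (measure_mono_null (by
    rintro _ ⟨x, hx, rfl⟩; exact hp x hx) (poly_null hp0))
  obtain ⟨x, hx⟩ := hne
  have h2 : ν univ = 0 := by
    rw [← union_compl_self (msupp ν)]
    exact measure_union_null h1 (mem_ae_iff.1 (msupp_ae ν))
  have := h x hx 1 one_pos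
  rw [measure_mono_null (subset_univ _) h2] at this
  simp at this

lemma DIV {m : ℕ} {ν : Measure (E (m + 1))} (h : IsUnif m ν) (h0 : (0 : E (m + 1)) ∈ msupp ν)
    (a b : Fin (m + 1) → ℝ) (ha : a 0 ≠ 0) (hq : ∀ x ∈ msupp ν, eval x.ofLp (qpoly a b) = 0)
    (hnh : ¬ ∃ v : E (m + 1), v ≠ 0 ∧ ∀ x ∈ msupp ν, ⟪v, x⟫ = 0)
    (p : MvPolynomial (Fin (m + 1)) ℝ) (hp : ∀ x ∈ msupp ν, eval x.ofLp p = 0) :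
    qpoly a b ∣ p := by
  obtain ⟨c, hc⟩ : ∃ c, c = b 0 / (2 * a 0) := ⟨_, rfl⟩
  obtain ⟨g, hgd⟩ : ∃ g : MvPolynomial (Fin m) ℝ, g = C (c ^ 2) - ∑ k : Fin m,
    (C (a k.succ / a 0) * X k ^ 2 + C (b k.succ / a 0) * X k) := ⟨_, rfl⟩
  set Q : Polynomial (MvPolynomial (Fin m) ℝ) := (Polynomial.X + Polynomial.C (C c)) ^ 2 -
    Polynomial.C g with hQ
  have hqQ : finSuccEquiv ℝ m (qpoly a b) = Polynomial.C (C (a 0)) * Q := by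
    rw [hQ, hgd]
    simp only [qpoly, Fin.sum_univ_succ, map_add, map_sum, map_mul, map_pow, finSuccEquiv_X_zero,
      finSuccEquiv_X_succ, map_sub]
    have hCC : ∀ r : ℝ, finSuccEquiv ℝ m (C r) = Polynomial.C (C r) := by
      intro r; simp [finSuccEquiv_apply]
    simp only [hCC]
    have e1 : ∀ r, (Polynomial.C (C r) : Polynomial (MvPolynomial (Fin m) ℝ)) =
      Polynomial.C (C (a 0)) * Polynomial.C (C (r / a 0)) := by
      intro r; rw [← map_mul, ← map_mul]; congr 2; field_simp
    have e2 : (Polynomial.C (C (b 0)) : Polynomial (MvPolynomial (Fin m) ℝ)) =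
      Polynomial.C (C (a 0)) * (2 * Polynomial.C (C c)) := by
      rw [← map_ofNat (Polynomial.C.comp (C : ℝ →+* MvPolynomial (Fin m) ℝ)) 2]
      simp only [RingHom.comp_apply]
      rw [← map_mul, ← map_mul, ← map_mul, ← map_mul]; congr 2; rw [hc]; field_simp
    rw [e2]
    have e3 : ∀ f : Fin m → ℝ, ∀ k : Fin m, (Polynomial.C (C (f k)) : Polynomial (MvPolynomial (Fin m) ℝ)) =
      Polynomial.C (C (a 0)) * Polynomial.C (C (f k / a 0)) := fun f k => e1 _
    simp only [e3 (fun k => a k.succ), e3 (fun k => b k.succ), mul_assoc, ← Finset.mul_sum, Finset.sum_add_distrib]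
    ring
  have hmon : Q.Monic := by
    have h1 : ((Polynomial.X + Polynomial.C (C c)) ^ 2 : Polynomial (MvPolynomial (Fin m) ℝ)).Monic :=
      (Polynomial.monic_X_add_C _).pow 2
    refine h1.sub_of_left ?_
    rw [Polynomial.degree_pow, Polynomial.degree_X_add_C]
    exact lt_of_le_of_lt Polynomial.degree_C_le (by norm_num)
  have hQdeg : Q.natDegree = 2 := by
    rw [hQ, Polynomial.natDegree_sub_C, Polynomial.natDegree_pow, Polynomial.natDegree_X_add_C]
  set P := finSuccEquiv ℝ m p with hP
  have hRd : (P %ₘ Q).natDegree ≤ 1 := by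
    have := Polynomial.natDegree_modByMonic_lt P hmon (by
      intro h1; rw [h1] at hQdeg; simp at hQdeg)
    omega
  obtain ⟨r1, r0, hR⟩ := Polynomial.exists_eq_X_add_C_of_natDegree_le_one hRd
  have hdm := Polynomial.modByMonic_add_div P Q
  have hS : ∀ x ∈ msupp ν, (x 0 + c) ^ 2 = eval (tl 0 x) g := by
    intro x hx
    have := hq x hx
    rw [cons_tl, eval_eq_eval_mv_eval', hqQ, hQ] at this
    simp [ha] at this
    linarith
  have hpe : ∀ x ∈ msupp ν, eval (tl 0 x) r1 * x 0 + eval (tl 0 x) r0 = 0 := by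
    intro x hx
    have := hp x hx
    rw [cons_tl, eval_eq_eval_mv_eval', ← hP, ← hdm, hR, hQ] at this
    simpa [hS x hx] using this
  have hid : (r0 - r1 * C c) ^ 2 - r1 ^ 2 * g = 0 := by
    refine vanish_poly h ⟨0, h0⟩ 0 c (poly_contDiff g) hS fun x hx => ?_
    simp only [map_sub, map_pow, map_mul, eval_C]
    linear_combination (eval (tl 0 x) r0 - eval (tl 0 x) r1 * c - eval (tl 0 x) r1 * (x 0 + c)) * hpe x hx
      + (eval (tl 0 x) r1)^2 * hS x hx
  have hr1 : r1 = 0 := by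
    by_contra hr1
    have hdv : r1 ∣ (r0 - r1 * C c) := by
      rw [← IsIntegrallyClosed.pow_dvd_pow_iff (n := 2) two_ne_zero]
      exact ⟨g, by linear_combination hid⟩
    obtain ⟨d, hd⟩ := hdv
    have hdg : d * d = g := by
      have : r1 ^ 2 * (d * d - g) = 0 := by rw [hd] at hid; linear_combination hid
      rcases mul_eq_zero.1 this with h1 | h1
      · exact absurd (pow_eq_zero_iff two_ne_zero |>.1 h1) hr1
      · linear_combination h1
    have hgdeg : g.totalDegree ≤ 2 := by
      rw [hgd]
      refine (totalDegree_sub _ _).trans (max_le (by rw [totalDegree_C]; omega) ?_)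
      refine (totalDegree_finsetSum_le fun k _ => ?_)
      refine (totalDegree_add _ _).trans (max_le ?_ ?_)
      · refine (totalDegree_mul _ _).trans ?_
        simp [totalDegree_X_pow]
      · refine (totalDegree_mul _ _).trans ?_
        simp [totalDegree_X]
    have hdd : d.totalDegree ≤ 1 := by
      by_cases hd0 : d = 0
      · simp [hd0]
      rw [← hdg, totalDegree_mul_of_isDomain hd0 hd0] at hgdeg
      omega
    obtain ⟨d0, w, hw⟩ := affine_eval hdd
    have hcl : msupp ν ⊆ {x : E (m + 1) | x 0 + c + (d0 + ∑ j : Fin m, w j * x j.succ) = 0} := by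
      refine msupp_subset ν (isClosed_eq (by fun_prop) continuous_const) ?_
      have hnull : ν (msupp ν ∩ {x | eval (tl 0 x) r1 = 0}) = 0 := by
        refine NULL h 0 c (poly_contDiff g) (fun x hx => hS x hx.1) (measure_mono_null ?_ (poly_null hr1))
        rintro _ ⟨x, hx, rfl⟩; exact hx.2
      rw [← compl_mem_ae_iff] at hnull
      filter_upwards [hnull, msupp_ae ν] with x hx hxs
      have hx1 : eval (tl 0 x) r1 ≠ 0 := fun h1 => hx ⟨hxs, h1⟩
      have h1 := hpe x hxs
      have h2 := congrArg (eval (tl 0 x)) hd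
      simp only [map_sub, map_mul, eval_C, hw] at h2
      apply mul_left_cancel₀ hx1
      have h3 : ∀ j : Fin m, tl 0 x j = x j.succ := fun j => by simp [tl]
      simp only [h3] at h2
      rw [mul_zero]
      linear_combination h1 - h2
    apply hnh
    refine ⟨WithLp.toLp 2 (Fin.cons 1 w), fun hv => ?_, fun x hx => ?_⟩
    · have := congrArg (fun v : E (m+1) => v 0) hv
      simp at this
    · have h1 := hcl hx
      have h2 := hcl h0
      simp at h1 h2
      simp [PiLp.inner_apply, Fin.sum_univ_succ]
      have : ∑ j : Fin m, x j.succ * w j = ∑ j, w j * x j.succ := by simp only [mul_comm]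
      linarith
  have hr0 : r0 = 0 := by
    rw [hr1] at hid; simpa using hid
  have hdvd : finSuccEquiv ℝ m (qpoly a b) ∣ P := by
    rw [hqQ, ← hdm, hR, hr1, hr0]
    refine ⟨Polynomial.C (C (a 0)⁻¹) * (P /ₘ Q), ?_⟩
    have : (Polynomial.C (C (a 0)) * Polynomial.C (C (a 0)⁻¹) : Polynomial (MvPolynomial (Fin m) ℝ)) = 1 := by
      rw [← map_mul, ← map_mul, mul_inv_cancel₀ ha]; simp
    simp only [map_zero, zero_mul, zero_add]
    linear_combination (-(Q * (P /ₘ Q))) * this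
  exact (map_dvd_iff (finSuccEquiv ℝ m)).1 hdvd
end

section
open MvPolynomial Asymptotics
set_option linter.unusedSimpArgs false

lemma quad_eval {n : ℕ} (w : MvPolynomial (Fin n) ℝ) (hw : w.totalDegree ≤ 2) (x : Fin n → ℝ) :
    eval x w = pd [] w + ∑ i, pd [i] w * x i + 1 / 2 * ∑ i, ∑ j, pd [i, j] w * (x i * x j) := by
  have px : ∀ i k : Fin n, pderiv k (X i : MvPolynomial (Fin n) ℝ) = C (dl i k) := by
    intro i k
    rw [pderiv_X, dl]
    by_cases hik : i = k
    · subst hik; simp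
    · simp [hik, Pi.single_apply, Ne.symm hik]
  have sd : ∀ (i : Fin n) (f : Fin n → ℝ), ∑ k, dl i k * f k = f i := by
    intro i f; simp [dl]
  have mono : ∀ d : Fin n →₀ ℕ, ∀ a : ℝ, d.degree ≤ 2 → eval x (monomial d a) = pd [] (monomial d a) +
      ∑ i, pd [i] (monomial d a) * x i +
      1 / 2 * ∑ i, ∑ j, pd [i, j] (monomial d a) * (x i * x j) := by
    intro d a hd
    by_cases h0 : d = 0
    · subst h0
      simp [pd]
    obtain ⟨i, hi⟩ : ∃ i, d i ≠ 0 := by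
      by_contra h; push Not at h; exact h0 (Finsupp.ext h)
    obtain ⟨d1, rfl⟩ : ∃ d1, d = d1 + Finsupp.single i 1 :=
      ⟨d - Finsupp.single i 1, by
        rw [tsub_add_cancel_of_le]; rw [Finsupp.single_le_iff]; omega⟩
    rw [map_add, Finsupp.degree_single] at hd
    rw [← mul_one a, ← monomial_mul, show monomial (Finsupp.single i 1) (1:ℝ) = X i from rfl]
    by_cases h1 : d1 = 0
    · subst h1
      simp only [pd, ← constantCoeff_eq, ← C_apply, px, Derivation.leibniz, pderiv_C, map_add, map_mul,
        constantCoeff_X, constantCoeff_C, smul_eq_mul, eval_C, eval_X, mul_zero, map_zero, add_zero,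
        zero_mul, Finset.sum_const_zero, mul_assoc, ← Finset.mul_sum, sd]
      ring
    obtain ⟨j, hj⟩ : ∃ i, d1 i ≠ 0 := by
      by_contra h; push Not at h; exact h1 (Finsupp.ext h)
    obtain ⟨d2, rfl⟩ : ∃ d2, d1 = d2 + Finsupp.single j 1 :=
      ⟨d1 - Finsupp.single j 1, by
        rw [tsub_add_cancel_of_le]; rw [Finsupp.single_le_iff]; omega⟩
    rw [map_add, Finsupp.degree_single] at hd
    rw [← mul_one a, ← monomial_mul, show monomial (Finsupp.single j 1) (1:ℝ) = X j from rfl]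
    have h2 : d2 = 0 := by
      rw [← Finsupp.degree_eq_zero_iff]; omega
    subst h2
    simp only [pd, ← constantCoeff_eq, ← C_apply, px, Derivation.leibniz, pderiv_C, map_add, map_mul,
      constantCoeff_X, constantCoeff_C, smul_eq_mul, eval_C, eval_X, mul_zero, map_zero, add_zero,
      zero_mul, zero_add, Finset.sum_const_zero, add_mul, Finset.sum_add_distrib, mul_add]
    have e1 : ∀ u v : Fin n, ∑ k, ∑ l, dl u k * (a * dl v l) * (x k * x l) = a * (x u * x v) := by
      intro u v
      have : ∀ k l, dl u k * (a * dl v l) * (x k * x l) = a * (dl u k * x k * (dl v l * x l)) :=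
        fun k l => by ring
      simp only [this, ← Finset.mul_sum, ← Finset.sum_mul, sd]
    have e2 : ∀ u v : Fin n, ∑ k, ∑ l, a * dl u k * dl v l * (x k * x l) = a * (x u * x v) := by
      intro u v; rw [← e1 u v]
      exact Finset.sum_congr rfl fun k _ => Finset.sum_congr rfl fun l _ => by ring
    simp only [e1, e2]
    ring
  conv_lhs => rw [w.as_sum]
  conv_rhs => rw [w.as_sum]
  simp only [map_sum, pd_sum]
  rw [Finset.sum_congr rfl (fun d hd => mono d (coeff d w) ((le_totalDegree hd).trans hw))]
  simp only [Finset.sum_add_distrib, Finset.mul_sum, Finset.sum_mul]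
  congr 1
  · congr 1; exact Finset.sum_comm
  · rw [Finset.sum_comm]
    exact Finset.sum_congr rfl fun i _ => Finset.sum_comm

lemma msupp_map {n : ℕ} (ν : Measure (E n)) (e : E n ≃ᵢ E n) (x : E n) :
    x ∈ msupp (ν.map e) ↔ e.symm x ∈ msupp ν := by
  simp only [msupp, mem_ofPred_eq]
  refine forall₂_congr fun r _ => ?_
  rw [Measure.map_apply e.continuous.measurable measurableSet_closedBall]
  have : e ⁻¹' closedBall x r = closedBall (e.symm x) r := by
    ext z
    rw [mem_preimage, mem_closedBall, mem_closedBall, ← e.symm.dist_eq]; simp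
  rw [this]

lemma IsUnif.map {n m : ℕ} {ν : Measure (E n)} (h : IsUnif m ν) (e : E n ≃ᵢ E n) :
    IsUnif m (ν.map e) := by
  intro x hx r hr
  rw [msupp_map] at hx
  rw [← h _ hx r hr, Measure.map_apply e.continuous.measurable measurableSet_closedBall]
  congr 1
  ext z
  rw [mem_preimage, mem_closedBall, mem_closedBall, ← e.symm.dist_eq]; simp

lemma QUAD {m : ℕ} (hm : 1 ≤ m) {ν : Measure (E (m + 1))} (h : IsUnif m ν)
    (h0 : (0 : E (m + 1)) ∈ msupp ν) : ∃ f : E (m + 1) ≃ₗᵢ[ℝ] E (m + 1), ∃ a b : Fin (m + 1) → ℝ,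
      ∑ i, a i = -1 ∧ a 0 ≠ 0 ∧ ∀ x ∈ msupp ν, eval (f x).ofLp (qpoly a b) = 0 := by
  have hG : ∀ ε : ℝ, 0 < ε → GS m (msupp ν) ε (gam m ν ε) := fun ε hε => gam_GS hm h h0 hε
  obtain ⟨w, hw2, hw, htr⟩ : ∃ w : MvPolynomial (Fin (m + 1)) ℝ, w.totalDegree ≤ 2 ∧
      (∀ x ∈ msupp ν, eval x.ofLp w = 0) ∧ ∑ i, pd [i, i] w ≠ 0 := by
    by_contra hcon
    push Not at hcon
    let φ : restrictTotalDegree (Fin (m + 1)) ℝ 2 →ₗ[ℝ] ℝ :=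
      { toFun := fun w => ∑ i, pd [i, i] w.1
        map_add' := fun u v => by simp [pd_add, Finset.sum_add_distrib]
        map_smul' := fun c u => by
          simp [smul_eq_C_mul, pd_C_mul, Finset.mul_sum] }
    have := functional_bigO (S := msupp ν) (l := 𝓝[>] 0) (g := fun ε => ε ^ 3)
      (fun ε => ⟨PT (gam m ν ε) ε 2, (mem_restrictTotalDegree _ _ _).2 (PT_totalDegree _ _ _)⟩)
      (fun x hx => PT_bigO hG 2 hx) φ
      (fun w hw => hcon w.1 ((mem_restrictTotalDegree _ _ _).1 w.2) hw)
    have hval : (fun ε => φ ⟨PT (gam m ν ε) ε 2, (mem_restrictTotalDegree _ _ _).2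
        (PT_totalDegree _ _ _)⟩) =ᶠ[𝓝[>] 0] fun ε => -2 * ε ^ 2 := by
      filter_upwards [self_mem_nhdsWithin] with ε hε
      have hg := hG ε hε
      have h2 : ∑ i : Fin (m + 1), mom (gam m ν ε) [i, i] = m / 2 := by
        rw [← hg.m2]
        simp only [mom, EuclideanSpace.norm_sq_eq]
        rw [integral_finsetSum]
        · refine Finset.sum_congr rfl fun i _ => integral_congr_ae (Eventually.of_forall fun z => ?_)
          simp [sq]
        · intro i _
          have := hg.prob
          refine Integrable.mono' (by simpa using hg.nint 2 0) (by fun_prop)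
            (Eventually.of_forall fun z => ?_)
          simp only [norm_pow, norm_norm]
          gcongr; exact PiLp.norm_apply_le z i
      show ∑ i, pd [i, i] (PT (gam m ν ε) ε 2) = _
      simp only [pd_PT2 _ _ 2 le_rfl]
      rw [Finset.sum_sub_distrib, ← Finset.mul_sum, ← Finset.mul_sum, h2]
      simp [dl]; ring
    have h3 := this.congr' hval EventuallyEq.rfl
    have h4 : (fun ε : ℝ => ε ^ 3) =o[𝓝[>] 0] fun ε => -2 * ε ^ 2 := by
      refine (isLittleO_const_mul_right_iff (by norm_num)).2 ?_
      exact (isLittleO_pow_pow (by norm_num : 2 < 3)).mono nhdsWithin_le_nhds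
    have h5 := h3.trans_isLittleO h4
    refine isLittleO_irrefl (Eventually.frequently ?_) h5
    filter_upwards [self_mem_nhdsWithin] with ε hε
    have : (0:ℝ) < ε := hε
    have : ε ^ 2 ≠ 0 := by positivity
    simpa using this
  set τ := ∑ i, pd [i, i] w with hτ
  let A : Matrix (Fin (m + 1)) (Fin (m + 1)) ℝ := fun i j => -τ⁻¹ * pd [i, j] w
  have hA : A.IsHermitian := by
    ext i j
    rw [Matrix.conjTranspose_apply, star_trivial]
    show -τ⁻¹ * _ = -τ⁻¹ * _
    rw [pd_perm (List.Perm.swap i j []) w]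
  have htrA : A.trace = -1 := by
    simp only [Matrix.trace, Matrix.diag, A, ← Finset.mul_sum, ← hτ]
    field_simp
  have hsum : ∑ i, hA.eigenvalues i = -1 := by
    have := hA.trace_eq_sum_eigenvalues; rw [htrA] at this; simpa using this.symm
  obtain ⟨i0, hi0⟩ : ∃ i, hA.eigenvalues i ≠ 0 := by
    by_contra hh; push Not at hh; simp [hh] at hsum
  let σ := Equiv.swap i0 0
  let B := hA.eigenvectorBasis.reindex σ
  let bv : E (m + 1) := WithLp.toLp 2 fun i => -2 * τ⁻¹ * pd [i] w
  refine ⟨B.repr, fun k => hA.eigenvalues (σ.symm k), fun k => B.repr bv k, ?_, ?_, fun x hx => ?_⟩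
  · rw [Equiv.sum_comp σ.symm hA.eigenvalues, hsum]
  · simpa [σ] using hi0
  have hc : pd [] w = 0 := by
    have := hw 0 h0
    rw [quad_eval w hw2] at this
    simpa using this
  have hx0 := hw x hx
  rw [quad_eval w hw2, hc, zero_add] at hx0
  have e1 : ∑ k, B.repr bv k * B.repr x k = ∑ i, -2 * τ⁻¹ * pd [i] w * x i := by
    have h1 := B.repr.inner_map_map bv x
    simp only [PiLp.inner_apply, RCLike.inner_apply, conj_trivial] at h1
    rw [show ∑ k, B.repr bv k * B.repr x k = ∑ k, B.repr x k * B.repr bv k from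
      Finset.sum_congr rfl fun i _ => mul_comm _ _, h1]
    simp only [bv]
    exact Finset.sum_congr rfl fun i _ => by ring
  have e2 : ∑ k, hA.eigenvalues (σ.symm k) * B.repr x k ^ 2 = ∑ i, ∑ j, A i j * (x i * x j) := by
    have h1 : ∑ i, ∑ j, A i j * (x i * x j) = ⟪x, (Matrix.toEuclideanLin A) x⟫ := by
      simp only [PiLp.inner_apply, Matrix.toLpLin_apply, Matrix.mulVec,
        dotProduct, RCLike.inner_apply, conj_trivial, Finset.sum_mul]
      exact Finset.sum_congr rfl fun i _ => Finset.sum_congr rfl fun j _ => by ring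
    rw [h1]
    conv_rhs => rw [← B.sum_repr x]
    have h2 : ∀ k, Matrix.toEuclideanLin A (B k) = hA.eigenvalues (σ.symm k) • B k := by
      intro k
      have := hA.mulVec_eigenvectorBasis (σ.symm k)
      simp only [B, OrthonormalBasis.reindex_apply]
      ext i
      have := congrFun this i
      simpa [Matrix.toLpLin_apply] using this
    simp only [map_sum, map_smul, h2, sum_inner, inner_sum, real_inner_smul_left, real_inner_smul_right,
      B.inner_eq_ite]
    simp
    exact Finset.sum_congr rfl fun i _ => by ring
  simp only [qpoly, map_add, map_sum, map_mul, map_pow, eval_C, eval_X]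
  rw [e1, e2]
  simp only [A, mul_assoc, ← Finset.mul_sum]
  linear_combination (-2 * τ⁻¹) * hx0
end

section
open MvPolynomial Asymptotics

lemma gint {n m : ℕ} (hm : 1 ≤ m) {ν : Measure (E n)} (h : IsUnif m ν) {x : E n}
    (hx : x ∈ msupp ν) {ε : ℝ} (hε : 0 < ε) (A B c M : ℝ) :
    Integrable (fun w => A * (‖w - x‖ + M) *
      Real.exp (B - (ε * ‖w - x‖) ^ 2 + c * ‖w - x‖)) ν := by
  have h0 := h.integrable_rad hm hx hε (radM_gauss_integrable 0 (c / ε))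
  have h1 := h.integrable_rad hm hx hε (radM_gauss_integrable 1 (c / ε))
  refine ((h1.const_mul (A * Real.exp B / ε)).add (h0.const_mul (A * Real.exp B * M))).congr ?_
  filter_upwards with w
  have : Real.exp (B - (ε * ‖w - x‖) ^ 2 + c * ‖w - x‖) = Real.exp B *
      Real.exp (-(ε * ‖w - x‖) ^ 2 + c / ε * (ε * ‖w - x‖)) := by
    rw [← Real.exp_add]; congr 1; field_simp; ring
  simp only [Pi.add_apply]
  rw [this]; field_simp

lemma sum_norm_le {n : ℕ} (v : E n) (k : Fin n) : |v k| ≤ ‖v‖ := by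
  simpa using PiLp.norm_apply_le v k

lemma ker_bound {n : ℕ} {ε M : ℝ} (w x : E n) (z : Fin n → ℂ)
    (hz : ∀ k, ‖z k - x k‖ ≤ M) :
    ‖Complex.exp (-(ε:ℂ) ^ 2 * ∑ k, ((w k : ℂ) - z k) ^ 2)‖ ≤
      Real.exp (n * ε ^ 2 * M ^ 2 - (ε * ‖w - x‖) ^ 2 + (2 * n * ε ^ 2 * M) * ‖w - x‖) := by
  rw [Complex.norm_exp]
  apply Real.exp_le_exp.2
  have e1 : (-(ε:ℂ) ^ 2 * ∑ k, ((w k : ℂ) - z k) ^ 2).re =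
      -ε ^ 2 * ∑ k, ((w k - (z k).re) ^ 2 - (z k).im ^ 2) := by
    have : (-(ε:ℂ) ^ 2) = ((-ε ^ 2 : ℝ) : ℂ) := by push_cast; ring
    rw [this, Complex.re_ofReal_mul, Complex.re_sum]
    congr 1; apply Finset.sum_congr rfl; intro k _
    simp [sq]
  have e2 : ‖w - x‖ ^ 2 = ∑ k, (w k - x k) ^ 2 := by
    rw [EuclideanSpace.norm_sq_eq]; simp
  have e3 : ∀ k, (w k - x k) ^ 2 - 2 * M * ‖w - x‖ - M ^ 2 ≤ (w k - (z k).re) ^ 2 - (z k).im ^ 2 := by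
    intro k
    have a1 := (Complex.abs_re_le_norm (z k - x k)).trans (hz k)
    have a2 := (Complex.abs_im_le_norm (z k - x k)).trans (hz k)
    simp only [Complex.sub_re, Complex.sub_im, Complex.ofReal_re, Complex.ofReal_im, sub_zero] at a1 a2
    have a3 : |w k - x k| ≤ ‖w - x‖ := sum_norm_le (w - x) k
    have a4 : |(w k - x k) * ((z k).re - x k)| ≤ ‖w - x‖ * M := by
      rw [abs_mul]; exact mul_le_mul a3 a1 (abs_nonneg _) (norm_nonneg _)
    have a5 := (abs_le.1 a4).2
    have a6 : (z k).im ^ 2 ≤ M ^ 2 := sq_le_sq' (by linarith [(abs_le.1 a2).1]) (abs_le.1 a2).2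
    nlinarith [sq_nonneg ((z k).re - x k)]
  have e4 := Finset.sum_le_sum fun k (_ : k ∈ Finset.univ) => e3 k
  rw [Finset.sum_sub_distrib, Finset.sum_sub_distrib, ← e2] at e4
  simp only [Finset.sum_const, Finset.card_univ, Fintype.card_fin, nsmul_eq_mul] at e4
  rw [e1]
  nlinarith [mul_le_mul_of_nonneg_left e4 (sq_nonneg ε)]

def Gs {n : ℕ} (ν : Measure (E n)) (ε : ℝ) (x : E n) : ℝ := ∫ w, Real.exp (-(ε * ‖w - x‖) ^ 2) ∂ν

lemma ker_real {n : ℕ} (ε : ℝ) (w x : E n) :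
    Complex.exp (-(ε:ℂ) ^ 2 * ∑ k, ((w k : ℂ) - (x k : ℂ)) ^ 2) =
      ((Real.exp (-(ε * ‖w - x‖) ^ 2) : ℝ) : ℂ) := by
  have e2 : ‖w - x‖ ^ 2 = ∑ k, (w k - x k) ^ 2 := by
    rw [EuclideanSpace.norm_sq_eq]; simp
  rw [mul_pow, e2]; push_cast; congr 1; ring

lemma Gs_curve {n m : ℕ} (hm : 1 ≤ m) {ν : Measure (E n)} (h : IsUnif m ν) {x : E n}
    (hx : x ∈ msupp ν) {ε : ℝ} (hε : 0 < ε) (c : Fin n → Polynomial ℝ) :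
    AnalyticOnNhd ℝ (fun t : ℝ => Gs ν ε (WithLp.toLp 2 fun k => (c k).eval t)) univ := by
  let C : Fin n → Polynomial ℂ := fun k => (c k).map (algebraMap ℝ ℂ)
  let F : ℂ → E n → ℂ := fun t w => Complex.exp (-(ε:ℂ) ^ 2 * ∑ k, ((w k : ℂ) - (C k).eval t) ^ 2)
  let F' : ℂ → E n → ℂ := fun t w => F t w *
    (-(ε:ℂ) ^ 2 * ∑ k, (2 * ((w k : ℂ) - (C k).eval t) * (-(C k).derivative.eval t)))
  have hD : Differentiable ℂ (fun t => ∫ w, F t w ∂ν) := by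
    intro t0
    obtain ⟨M, hM⟩ : ∃ M : ℝ, ∀ t ∈ closedBall t0 1, ∀ k, ‖(C k).eval t - x k‖ ≤ M ∧
        ‖(C k).derivative.eval t‖ ≤ M := by
      have hk : ∀ k, ∃ M : ℝ, ∀ t ∈ closedBall t0 1, ‖(C k).eval t - x k‖ +
          ‖(C k).derivative.eval t‖ ≤ M := by
        intro k
        obtain ⟨M, hM⟩ := (isCompact_closedBall t0 1).bddAbove_image
          (f := fun t => ‖(C k).eval t - x k‖ + ‖(C k).derivative.eval t‖)
          (by fun_prop)
        exact ⟨M, fun t ht => hM (mem_image_of_mem _ ht)⟩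
      choose M hM using hk
      refine ⟨∑ k, |M k|, fun t ht k => ?_⟩
      have a1 := hM k t ht
      have a2 : |M k| ≤ ∑ k, |M k| := Finset.single_le_sum (f := fun k => |M k|) (fun _ _ => abs_nonneg _) (Finset.mem_univ k)
      have a3 := le_abs_self (M k)
      have a4 := norm_nonneg ((C k).eval t - x k)
      have a5 := norm_nonneg ((C k).derivative.eval t)
      constructor <;> linarith
    have hM' : ∀ t ∈ closedBall t0 1, ∀ k, ‖(C k).eval t - x k‖ ≤ |M| ∧
        ‖(C k).derivative.eval t‖ ≤ |M| := fun t ht k =>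
      ⟨(hM t ht k).1.trans (le_abs_self _), (hM t ht k).2.trans (le_abs_self _)⟩
    have hN := abs_nonneg M
    generalize |M| = N at hM' hN
    have hF : ∀ t, Continuous (F t) := fun t => by fun_prop
    have hFb : ∀ t ∈ closedBall t0 1, ∀ w, ‖F t w‖ ≤ Real.exp (n * ε ^ 2 * N ^ 2 - (ε * ‖w - x‖) ^ 2
        + (2 * n * ε ^ 2 * N) * ‖w - x‖) := fun t ht w =>
      ker_bound w x (fun k => (C k).eval t) (fun k => (hM' t ht k).1)
    have hF1 : Integrable (F t0) ν := by
      refine (gint hm h hx hε 1 (n * ε ^ 2 * N ^ 2) (2 * n * ε ^ 2 * N) 1).mono'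
        (hF t0).aestronglyMeasurable (Eventually.of_forall fun w => ?_)
      refine (hFb t0 (mem_closedBall_self zero_le_one) w).trans ?_
      refine le_mul_of_one_le_left (Real.exp_pos _).le ?_
      linarith [norm_nonneg (w - x)]
    have := hasDerivAt_integral_of_dominated_loc_of_deriv_le (μ := ν) (F := F) (F' := F') (x₀ := t0)
      (s := closedBall t0 1) (bound := fun w => (ε ^ 2 * n * 2 * N) * (‖w - x‖ + N) *
        Real.exp (n * ε ^ 2 * N ^ 2 - (ε * ‖w - x‖) ^ 2 + (2 * n * ε ^ 2 * N) * ‖w - x‖))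
      (closedBall_mem_nhds t0 one_pos) (Eventually.of_forall fun t => (hF t).aestronglyMeasurable)
      hF1 (by exact (Continuous.aestronglyMeasurable (by fun_prop)))
      (Eventually.of_forall fun w t ht => ?_) (gint hm h hx hε _ _ _ _)
      (Eventually.of_forall fun w t ht => ?_)
    · exact this.2.differentiableAt
    · rw [norm_mul, mul_comm]
      refine mul_le_mul ?_ (hFb t ht w) (norm_nonneg _) (by positivity)
      rw [norm_mul, norm_neg, norm_pow, Complex.norm_real, Real.norm_eq_abs, sq_abs]
      have : ‖∑ k, (2 * ((w k : ℂ) - (C k).eval t) * (-(C k).derivative.eval t))‖ ≤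
          ∑ k : Fin n, 2 * (‖w - x‖ + N) * N := by
        refine norm_sum_le_of_le _ fun k _ => ?_
        rw [norm_mul, norm_neg, norm_mul]
        have a1 : ‖(w k : ℂ) - (C k).eval t‖ ≤ ‖w - x‖ + N := by
          have : (w k : ℂ) - (C k).eval t = ((w k - x k : ℝ) : ℂ) - ((C k).eval t - x k) := by
            push_cast; ring
          rw [this]
          refine (norm_sub_le _ _).trans (add_le_add ?_ (hM' t ht k).1)
          rw [Complex.norm_real]; exact sum_norm_le (w - x) k
        have a2 := (hM' t ht k).2
        have : ‖(2:ℂ)‖ = 2 := by simp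
        rw [this]
        gcongr
      rw [Finset.sum_const, Finset.card_univ, Fintype.card_fin, nsmul_eq_mul] at this
      calc _ ≤ ε ^ 2 * (n * (2 * (‖w - x‖ + N) * N)) := by gcongr
        _ = _ := by ring
    · have hk : ∀ k, HasDerivAt (fun t : ℂ => ((w k : ℂ) - (C k).eval t) ^ 2)
          (2 * ((w k : ℂ) - (C k).eval t) * (-(C k).derivative.eval t)) t := by
        intro k
        have := (((C k).hasDerivAt t).const_sub (w k : ℂ)).fun_pow 2
        simpa only [Nat.cast_ofNat, Nat.add_one_sub_one, pow_one] using this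
      exact ((HasDerivAt.fun_sum fun k _ => hk k).const_mul (-(ε:ℂ) ^ 2)).cexp
  have hA : AnalyticOnNhd ℝ (fun t : ℝ => (∫ w, F (t:ℂ) w ∂ν).re) univ := by
    intro t _
    have a1 : AnalyticAt ℝ (fun t : ℂ => ∫ w, F t w ∂ν) (t:ℂ) := (hD.analyticAt _).restrictScalars
    have a2 : AnalyticAt ℝ (fun t : ℝ => ∫ w, F (t:ℂ) w ∂ν) t :=
      AnalyticAt.comp (g := fun t : ℂ => ∫ w, F t w ∂ν) a1 (Complex.ofRealCLM.analyticAt t)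
    exact (Complex.reCLM.analyticAt _).comp a2
  refine hA.congr isOpen_univ fun t _ => ?_
  have : ∀ w, F (t:ℂ) w = ((Real.exp (-(ε * ‖w - WithLp.toLp 2 fun k => (c k).eval t‖) ^ 2) : ℝ) : ℂ) := by
    intro w
    rw [← ker_real]
    simp only [F, C, Polynomial.eval_map_algebraMap]
    congr 3; funext k
    congr 2
    rw [← Complex.coe_algebraMap, Polynomial.aeval_algebraMap_apply, Complex.coe_algebraMap]
    simp
  simp only [this, Gs]
  have e := integral_ofReal (𝕜 := ℂ) (μ := ν)
    (f := fun w => Real.exp (-(ε * ‖w - WithLp.toLp 2 fun k => (c k).eval t‖) ^ 2))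
  exact (congrArg Complex.re e).trans (Complex.ofReal_re _)

lemma Gs_cont {n m : ℕ} (hm : 1 ≤ m) {ν : Measure (E n)} (h : IsUnif m ν) {x : E n}
    (hx : x ∈ msupp ν) {ε : ℝ} (hε : 0 < ε) : Continuous (Gs ν ε) := by
  rw [continuous_iff_continuousAt]
  intro y
  refine continuousAt_of_dominated (bound := fun w => 1 * (‖w - x‖ + 1) *
    Real.exp (n * ε ^ 2 * (‖y - x‖ + 1) ^ 2 - (ε * ‖w - x‖) ^ 2 +
      (2 * n * ε ^ 2 * (‖y - x‖ + 1)) * ‖w - x‖))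
    (Eventually.of_forall fun z => (Continuous.aestronglyMeasurable (by fun_prop))) ?_
    (gint hm h hx hε _ _ _ _) (Eventually.of_forall fun w => by fun_prop)
  filter_upwards [closedBall_mem_nhds y one_pos] with z hz
  filter_upwards with w
  have := ker_bound (ε := ε) (M := ‖y - x‖ + 1) w x (fun k => (z k : ℂ)) (fun k => by
    rw [← Complex.ofReal_sub, Complex.norm_real]
    refine (sum_norm_le (z - x) k).trans ?_
    rw [mem_closedBall, dist_eq_norm] at hz
    calc ‖z - x‖ = ‖(y - x) + (z - y)‖ := by congr 1; abel
      _ ≤ _ := (norm_add_le _ _).trans (by linarith))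
  rw [ker_real, Complex.norm_real] at this
  exact this.trans (le_mul_of_one_le_left (Real.exp_pos _).le (by linarith [norm_nonneg (w - x)]))

lemma Gs_mem {n m : ℕ} (hm : 1 ≤ m) {ν : Measure (E n)} (h : IsUnif m ν) {x : E n}
    (hx : x ∈ msupp ν) {ε : ℝ} (hε : 0 < ε) :
    Gs ν ε x = (ε ^ m)⁻¹ * ∫ r, Real.exp (-r ^ 2) ∂radM m :=
  h.integral_rad hm hx hε (g := fun r => Real.exp (-r ^ 2)) (by fun_prop)

lemma mem_of_Gs {n m : ℕ} (hm : 1 ≤ m) {ν : Measure (E n)} (h : IsUnif m ν) {x0 : E n}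
    (hx0 : x0 ∈ msupp ν) {x : E n} (hx : ∀ ε, 0 < ε → Gs ν ε x = Gs ν ε x0) : x ∈ msupp ν := by
  by_contra hn
  obtain ⟨δ, hδ, hball⟩ := Metric.isOpen_iff.1 (msupp_closed ν).isOpen_compl x hn
  set I := ∫ r, Real.exp (-r ^ 2) ∂radM m with hI
  have hIpos : 0 < I := by
    have := radM_gauss_moment hm 0
    simp only [mul_zero, pow_zero, one_mul, Nat.cast_zero, add_zero] at this
    rw [hI, this]; exact cg_pos hm
  have key : ∀ ε, 0 < ε → Gs ν ε x ≤ Real.exp (-(3/4 * (ε * δ) ^ 2)) * Gs ν (ε / 2) x := by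
    intro ε hε
    have hi : ∀ ε, 0 < ε → Integrable (fun w => Real.exp (-(ε * ‖w - x‖) ^ 2)) ν := by
      intro ε hε
      by_contra hni
      have := hx ε hε
      rw [Gs, integral_undef hni, Gs_mem hm h hx0 hε] at this
      have : 0 < (ε ^ m)⁻¹ * I := by positivity
      linarith
    simp only [Gs]
    rw [← integral_const_mul]
    refine integral_mono_ae (hi ε hε) ((hi (ε/2) (by positivity)).const_mul _) ?_
    filter_upwards [msupp_ae ν] with w hw
    have : δ ≤ ‖w - x‖ := by
      by_contra hlt
      exact hball (by rw [mem_ball, dist_eq_norm]; linarith) hw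
    rw [← Real.exp_add]
    apply Real.exp_le_exp.2
    have : (ε * δ) ^ 2 ≤ (ε * ‖w - x‖) ^ 2 := by gcongr
    nlinarith
  have key2 : ∀ ε, 0 < ε → 1 ≤ Real.exp (-(3/4 * (ε * δ) ^ 2)) * 2 ^ m := by
    intro ε hε
    have := key ε hε
    rw [hx ε hε, hx _ (half_pos hε), Gs_mem hm h hx0 hε, Gs_mem hm h hx0 (half_pos hε)] at this
    rw [div_pow, inv_div] at this
    have hp : 0 < ε ^ m := by positivity
    have e1 : (ε ^ m)⁻¹ * I * 1 ≤ (ε ^ m)⁻¹ * I * (Real.exp (-(3/4 * (ε * δ) ^ 2)) * 2 ^ m) := by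
      calc _ = (ε ^ m)⁻¹ * I := by ring
        _ ≤ _ := this
        _ = _ := by rw [← hI]; field_simp
    exact le_of_mul_le_mul_left e1 (by positivity)
  have hl : Tendsto (fun ε : ℝ => Real.exp (-(3/4 * (ε * δ) ^ 2)) * 2 ^ m) atTop (𝓝 (0 * 2 ^ m)) := by
    refine Tendsto.mul_const _ (Real.tendsto_exp_neg_atTop_nhds_zero.comp ?_)
    refine Tendsto.const_mul_atTop (by norm_num) ((tendsto_pow_atTop two_ne_zero).comp ?_)
    exact tendsto_id.atTop_mul_const hδ
  have := ge_of_tendsto hl ((eventually_gt_atTop 0).mono key2)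
  norm_num at this

lemma FULLL {n m : ℕ} (hm : 1 ≤ m) {ν : Measure (E n)} (h : IsUnif m ν) {x : E n}
    (hx : ∀ t : ℝ, 0 ≤ t → t • x ∈ msupp ν) (t : ℝ) : t • x ∈ msupp ν := by
  have h0 := hx 0 le_rfl
  refine mem_of_Gs hm h h0 fun ε hε => ?_
  have e : ∀ t : ℝ, (WithLp.toLp 2 fun k => (Polynomial.C (x k) * Polynomial.X).eval t) = t • x := by
    intro t; ext k
    simp only [Polynomial.eval_mul, Polynomial.eval_C, Polynomial.eval_X, PiLp.smul_apply, smul_eq_mul]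
    ring
  have ha : AnalyticOnNhd ℝ (fun t : ℝ => Gs ν ε (t • x) - Gs ν ε ((0:ℝ) • x)) univ := by
    have := (Gs_curve hm h h0 hε fun k => Polynomial.C (x k) * Polynomial.X)
    simp only [e] at this
    exact this.sub analyticOnNhd_const
  refine sub_eq_zero.1 (an_null ha (fun h0' => ?_) t)
  have : Ici (0:ℝ) ⊆ {t | Gs ν ε (t • x) - Gs ν ε ((0:ℝ) • x) = 0} := by
    intro t ht
    show _ = _
    rw [Gs_mem hm h (hx t ht) hε, Gs_mem hm h h0 hε, sub_self]
  have := measure_mono_null this h0'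
  simp at this

lemma FULLP {m : ℕ} {M : ℕ} (hm : 1 ≤ m) {ν : Measure (E M)} (h : IsUnif m ν)
    (φ : Fin M → MvPolynomial (Fin m) ℝ)
    (hv : volume {y : Fin m → ℝ | (WithLp.toLp 2 fun k => eval y (φ k)) ∈ msupp ν} ≠ 0)
    (y : Fin m → ℝ) : (WithLp.toLp 2 fun k => eval y (φ k)) ∈ msupp ν := by
  obtain ⟨y0, hy0⟩ := nonempty_of_measure_ne_zero hv
  refine mem_of_Gs hm h hy0 fun ε hε => ?_
  have hSA : SA (fun y => Gs ν ε (WithLp.toLp 2 fun k => eval y (φ k)) -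
      Gs ν ε (WithLp.toLp 2 fun k => eval y0 (φ k))) := by
    constructor
    · refine Continuous.sub ((Gs_cont hm h hy0 hε).comp ?_) continuous_const
      refine (PiLp.continuous_toLp 2 _).comp (continuous_pi fun k => (poly_contDiff (φ k)).continuous)
    · intro y i
      have := (Gs_curve hm h hy0 hε fun k => aeval (fun j => if j = i then Polynomial.X else
        Polynomial.C (y j)) (φ k))
      have e : ∀ t k, Polynomial.eval t (aeval (fun j => if j = i then Polynomial.X else
        Polynomial.C (y j)) (φ k)) = eval (Function.update y i t) (φ k) := by
        intro t k
        rw [← Polynomial.coe_evalRingHom, aeval_def, hom_eval₂]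
        have : (Polynomial.evalRingHom t).comp (algebraMap ℝ (Polynomial ℝ)) = RingHom.id ℝ := by
          ext; simp
        rw [this, eval₂_id]
        congr 2; funext j
        by_cases hj : j = i
        · subst hj; simp
        · simp [hj]
      simp only [e] at this
      exact this.sub analyticOnNhd_const
  have := hSA.null (fun h0 => hv (measure_mono_null (fun z hz => ?_) h0)) y
  · linarith
  · have hz : _ ∈ msupp ν := hz
    have hy0 : _ ∈ msupp ν := hy0
    simp only [mem_ofPred_eq]
    rw [Gs_mem hm h hz hε, Gs_mem hm h hy0 hε, sub_self]
end

section
open MvPolynomial Asymptotics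

lemma unif_ne {n m : ℕ} {ν : Measure (E n)} (h : IsUnif m ν) {x : E n} (hx : x ∈ msupp ν) :
    ν (msupp ν) ≠ 0 := by
  intro h1
  have h2 : ν univ = 0 := by
    rw [← union_compl_self (msupp ν)]
    exact measure_union_null h1 (mem_ae_iff.1 (msupp_ae ν))
  have := h x hx 1 one_pos
  rw [measure_mono_null (subset_univ _) h2] at this
  simp at this

lemma full_plane {m : ℕ} (hm : 1 ≤ m) {ν : Measure (E (m + 1))} (h : IsUnif m ν) {x : E (m + 1)}
    (hx : x ∈ msupp ν) (hs : ∀ x ∈ msupp ν, x 0 = 0) (y : E (m + 1)) (hy : y 0 = 0) :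
    y ∈ msupp ν := by
  have key : ∀ y : E (m + 1), y 0 = 0 → (WithLp.toLp 2 fun k => eval (tl 0 y)
      ((Fin.cases 0 (fun j => X j) k : MvPolynomial (Fin m) ℝ))) = y := by
    intro y hy
    ext k
    refine Fin.cases ?_ (fun j => ?_) k
    · simp [hy]
    · simp [tl]
  rw [← key y hy]
  refine FULLP hm h _ (fun h0 => unif_ne h hx (NULL h 0 0 (g := fun _ => 0) contDiff_const
    (fun x hx => by simp [hs x hx]) (measure_mono_null ?_ h0))) _
  rintro _ ⟨x, hx, rfl⟩
  simp only [mem_ofPred_eq]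
  rw [key x (hs x hx)]; exact hx

def KPp {k : ℕ} (σ : ℝ) (j : Fin (k + 4)) : MvPolynomial (Fin (k + 3)) ℝ :=
  if j.1 = 0 then 2 * X 0 * X 1 else if j.1 = 1 then 2 * X 0 * X 2 else
  if j.1 = 2 then X 0 ^ 2 - X 1 ^ 2 - X 2 ^ 2 else
  if j.1 = 3 then C σ * (X 0 ^ 2 + X 1 ^ 2 + X 2 ^ 2) else X ⟨j.1 - 1, by omega⟩

lemma kp_param (r x y z : ℝ) (hr : 0 ≤ r) (h : r ^ 2 = x ^ 2 + y ^ 2 + z ^ 2) :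
    ∃ a b c : ℝ, 2 * a * b = x ∧ 2 * a * c = y ∧ a ^ 2 - b ^ 2 - c ^ 2 = z ∧
      a ^ 2 + b ^ 2 + c ^ 2 = r := by
  have h1 : -z ≤ r := by nlinarith [abs_le_of_sq_le_sq' (a := z) (b := r) (by nlinarith) hr]
  rcases h1.lt_or_eq with h2 | h2
  · obtain ⟨a, ha⟩ : ∃ a, a = √((r + z) / 2) := ⟨_, rfl⟩
    have ha0 : 0 < a := by rw [ha]; apply Real.sqrt_pos.2; linarith
    have ha2 : a ^ 2 = (r + z) / 2 := by rw [ha]; exact Real.sq_sqrt (by linarith)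
    have e : (x / (2 * a)) ^ 2 + (y / (2 * a)) ^ 2 = (r - z) / 2 := by
      rw [div_pow, div_pow, ← add_div, div_eq_iff (by positivity)]
      nlinarith
    refine ⟨a, x / (2 * a), y / (2 * a), by field_simp, by field_simp, ?_, ?_⟩ <;> nlinarith
  · have : x ^ 2 + y ^ 2 = 0 := by rw [← h2] at h; nlinarith
    have hx : x = 0 := by nlinarith [sq_nonneg x, sq_nonneg y]
    have hy : y = 0 := by nlinarith [sq_nonneg x, sq_nonneg y]
    refine ⟨0, √r, 0, by simp [hx], by simp [hy], ?_, ?_⟩ <;> rw [Real.sq_sqrt hr] <;> linarith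

lemma KPp_surj {k : ℕ} {σ : ℝ} (hσ : σ = 1 ∨ σ = -1) (x : E (k + 4)) (hx : x ∈ stdKP (k + 4) (by omega))
    (h : 0 ≤ σ * x ⟨3, by omega⟩) : ∃ y, (WithLp.toLp 2 fun j => eval y (KPp (k := k) σ j)) = x := by
  have hσ2 : σ * σ = 1 := by rcases hσ with rfl | rfl <;> norm_num
  obtain ⟨a, b, c, h1, h2, h3, h4⟩ := kp_param _ (x ⟨0, by omega⟩) (x ⟨1, by omega⟩) (x ⟨2, by omega⟩) h
    (by rw [mul_pow, sq σ, hσ2, one_mul]; exact hx)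
  have e3 : x ⟨3, by omega⟩ = σ * (a ^ 2 + b ^ 2 + c ^ 2) := by rw [h4, ← mul_assoc, hσ2, one_mul]
  obtain ⟨y, hy⟩ : ∃ y : Fin (k + 3) → ℝ, y = fun j => if j.1 = 0 then a else if j.1 = 1 then b else
    if j.1 = 2 then c else x j.succ := ⟨_, rfl⟩
  have y0 : y 0 = a := by simp [hy]
  have y1 : y 1 = b := by simp [hy]
  have y2 : y 2 = c := by
    have : ((2 : Fin (k+3)) : ℕ) = 2 := by rw [Fin.val_two]
    simp only [hy, this]; norm_num
  refine ⟨y, ?_⟩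
  ext j
  obtain ⟨j, hj⟩ := j
  simp only [KPp]
  split_ifs with i0 i1 i2 i3
  · subst i0; simp [y0, y1, h1]
  · subst i1; simp [y0, y2, h2]
  · subst i2; simp [y0, y1, y2, h3]
  · subst i3; simp [y0, y1, y2, e3]
  · simp only [eval_X, hy]
    rw [if_neg (by omega), if_neg (by omega), if_neg (by omega)]
    exact congrArg x.ofLp (Fin.ext (by simp only [Fin.succ_mk]; omega))

lemma full_KP {k : ℕ} {ν : Measure (E (k + 4))} (h : IsUnif (k + 3) ν) {x0 : E (k + 4)}
    (hx0 : x0 ∈ msupp ν) (hs : msupp ν ⊆ stdKP (k + 4) (by omega)) :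
    msupp ν = stdKP (k + 4) (by omega) := by
  obtain ⟨i3, hi3⟩ : ∃ i3 : Fin (k + 4), i3 = ⟨3, by omega⟩ := ⟨_, rfl⟩
  have hsa : ∀ (j : ℕ) (hj : j < 3), i3.succAbove ⟨j, by omega⟩ = ⟨j, by omega⟩ := by
    intro j hj; rw [hi3, Fin.succAbove_of_castSucc_lt _ _ (by simpa [Fin.lt_def] using hj)]; rfl
  obtain ⟨σ, hσ, hv⟩ : ∃ σ : ℝ, (σ = 1 ∨ σ = -1) ∧
      volume (tl i3 '' {x ∈ msupp ν | 0 ≤ σ * x i3}) ≠ 0 := by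
    by_contra hcon
    push Not at hcon
    have hN : ∀ σ : ℝ, (σ = 1 ∨ σ = -1) → ν {x ∈ msupp ν | 0 ≤ σ * x i3} = 0 := fun σ hσ =>
      NULL h i3 0 (g := fun y => y ⟨0, by omega⟩ ^ 2 + y ⟨1, by omega⟩ ^ 2 + y ⟨2, by omega⟩ ^ 2)
        (by fun_prop) (fun x hx => by
          have := hs hx.1
          simp only [stdKP, mem_ofPred_eq] at this
          simp only [tl, add_zero]
          rw [hsa 0 (by omega), hsa 1 (by omega), hsa 2 (by omega), hi3, this]) (hcon σ hσ)
    refine unif_ne h hx0 (measure_mono_null (fun x hx => ?_)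
      (measure_union_null (hN 1 (Or.inl rfl)) (hN (-1) (Or.inr rfl))))
    rcases le_total 0 (x i3) with h1 | h1
    · exact Or.inl ⟨hx, by linarith⟩
    · exact Or.inr ⟨hx, by linarith⟩
  have hall := FULLP (by omega) h (KPp (k := k) σ) (fun h0 => hv ?_)
  · have half : ∀ x ∈ stdKP (k + 4) (by omega), 0 ≤ σ * x i3 → x ∈ msupp ν := by
      intro x hx hxi
      rw [hi3] at hxi
      obtain ⟨y, rfl⟩ := KPp_surj hσ x hx hxi
      exact hall y
    refine subset_antisymm hs fun x hx => ?_
    rcases le_total 0 (σ * x i3) with h1 | h1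
    · exact half x hx h1
    · have := FULLL (by omega) h (x := -x) (fun t ht => half _ ?_ ?_) (-1)
      · simpa using this
      · simp only [stdKP, mem_ofPred_eq, PiLp.smul_apply, PiLp.neg_apply, smul_eq_mul, mul_pow,
          neg_sq] at hx ⊢
        rw [hx]; ring
      · simp only [PiLp.smul_apply, PiLp.neg_apply, smul_eq_mul]; nlinarith
  · refine measure_mono_null ?_ (addHaar_image_eq_zero_of_differentiableOn_of_addHaar_eq_zero volume
      (f := fun y : Fin (k + 3) → ℝ => fun j => eval y (KPp (k := k) σ (i3.succAbove j))) ?_ h0)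
    · rintro _ ⟨x, ⟨hx, hxi⟩, rfl⟩
      rw [hi3] at hxi
      obtain ⟨y, rfl⟩ := KPp_surj hσ x (hs hx) hxi
      exact ⟨y, hx, rfl⟩
    · refine Differentiable.differentiableOn ?_
      rw [differentiable_pi]
      exact fun j => (poly_contDiff _).differentiable (by norm_num)

lemma qdeg {n : ℕ} (a b : Fin n → ℝ) (i : Fin n) (ha : a i ≠ 0) : (qpoly a b).totalDegree = 2 := by
  apply le_antisymm
  · refine (totalDegree_add _ _).trans (max_le ?_ ?_) <;>
      refine totalDegree_finsetSum_le fun k _ => (totalDegree_mul _ _).trans ?_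
    · simp
    · simp
  · have : Finsupp.single i 2 ∈ (qpoly a b).support := by
      rw [MvPolynomial.mem_support_iff]
      have : coeff (Finsupp.single i 2) (qpoly a b) = a i := by
        rw [qpoly, coeff_add, coeff_sum, coeff_sum]
        have e1 : ∀ k, coeff (Finsupp.single i 2) (C (a k) * X k ^ 2) = if k = i then a k else 0 := by
          intro k
          rw [coeff_C_mul, coeff_X_pow]
          simp [Finsupp.single_left_inj]
        have e2 : ∀ k, coeff (Finsupp.single i 2) (C (b k) * X k) = 0 := by
          intro k
          rw [coeff_C_mul, coeff_X, if_neg, mul_zero]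
          intro h
          have := congrArg (fun f => f.sum fun _ e => e) h
          simp at this
        simp [e1, e2]
      rw [this]; exact ha
    have := le_totalDegree this
    simpa using this

lemma map_zero_mem {n : ℕ} {ν : Measure (E n)} (h0 : (0 : E n) ∈ msupp ν) (f : E n ≃ₗᵢ[ℝ] E n) :
    (0 : E n) ∈ msupp (ν.map f.toIsometryEquiv) := by
  rw [msupp_map]
  have : f.toIsometryEquiv.symm 0 = f.symm 0 := rfl
  rw [this, map_zero]; exact h0

lemma perm4 {k : ℕ} (i : Fin 4 → Fin (k + 4)) (hi : Function.Injective i) :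
    ∃ σ : Fin (k + 4) ≃ Fin (k + 4), ∀ j : Fin 4, σ (Fin.castLE (by omega) j) = i j := by
  classical
  let f1 : Fin 4 → Fin (k + 4) := Fin.castLE (by omega)
  have hf1 : Function.Injective f1 := Fin.castLE_injective _
  let e : {x // x ∈ range f1} ≃ {x // x ∈ range i} :=
    (Equiv.ofInjective f1 hf1).symm.trans (Equiv.ofInjective i hi)
  refine ⟨e.extendSubtype, fun j => ?_⟩
  have := Equiv.extendSubtype_apply_of_mem e (f1 j) ⟨j, rfl⟩
  rw [show Fin.castLE (by omega) j = f1 j from rfl, this]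
  have e1 : (⟨f1 j, ⟨j, rfl⟩⟩ : {x // x ∈ range f1}) = Equiv.ofInjective f1 hf1 j := rfl
  simp only [e, Equiv.trans_apply]
  rw [e1, Equiv.symm_apply_apply]; rfl

theorem CLASS {k : ℕ} {ν : Measure (E (k + 4))} (h : IsUnif (k + 3) ν)
    (h0 : (0 : E (k + 4)) ∈ msupp ν) :
    (∃ v : E (k + 4), v ≠ 0 ∧ msupp ν = {x | ⟪v, x⟫ = 0}) ∨
      ∃ y, IsKPCone (n := k + 4) (by omega) y (msupp ν) := by
  classical
  by_cases hnh : ∃ v : E (k + 4), v ≠ 0 ∧ ∀ x ∈ msupp ν, ⟪v, x⟫ = 0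
  · left
    obtain ⟨v, hv, hvs⟩ := hnh
    refine ⟨v, hv, subset_antisymm hvs fun y hy => ?_⟩
    obtain ⟨f, hf⟩ : ∃ f : E (k + 4) ≃ₗᵢ[ℝ] E (k + 4), f v = ‖v‖ • EuclideanSpace.single 0 1 :=
      ⟨_, Submodule.reflection_sub (v := v) (w := ‖v‖ • EuclideanSpace.single 0 1)
        (by simp [norm_smul])⟩
    have hz : ∀ x, ⟪v, x⟫ = 0 ↔ (f x) 0 = 0 := by
      intro x
      rw [← f.inner_map_map, hf, inner_smul_left, EuclideanSpace.inner_single_left]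
      simp [hv]
    have := full_plane (by omega) (h.map f.toIsometryEquiv) (map_zero_mem h0 f) (fun x hx => by
      rw [msupp_map] at hx
      have := (hz _).1 (hvs _ hx)
      have e : f (f.toIsometryEquiv.symm x) = x := f.apply_symm_apply x
      rwa [e] at this) (f y) ((hz y).1 hy)
    rw [msupp_map] at this
    have e : f.toIsometryEquiv.symm (f y) = y := f.symm_apply_apply y
    rwa [e] at this
  · right
    obtain ⟨f, a, b, ha, ha0, hq⟩ := QUAD (by omega) h h0
    set ν' := ν.map f.toIsometryEquiv with hν'
    have h' : IsUnif (k + 3) ν' := h.map _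
    have h0' := map_zero_mem h0 f
    have hmem : ∀ x, x ∈ msupp ν' ↔ f.symm x ∈ msupp ν := fun x => msupp_map ν _ x
    have hq' : ∀ x ∈ msupp ν', eval x.ofLp (qpoly a b) = 0 := by
      intro x hx
      have := hq _ ((hmem x).1 hx)
      rwa [f.apply_symm_apply] at this
    have hnh' : ¬ ∃ v : E (k + 4), v ≠ 0 ∧ ∀ x ∈ msupp ν', ⟪v, x⟫ = 0 := by
      rintro ⟨v, hv, hvs⟩
      refine hnh ⟨f.symm v, by simpa using hv, fun x hx => ?_⟩
      rw [← f.inner_map_map, f.apply_symm_apply]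
      exact hvs _ ((hmem _).2 (by rwa [f.symm_apply_apply]))
    have hdeg := qdeg a b 0 ha0
    have hdiv := DIV h' h0' a b ha0 hq' hnh'
    have hG : ∀ ε : ℝ, 0 < ε → GS (k + 3) (msupp ν') ε (gam (k + 3) ν' ε) :=
      fun ε hε => gam_GS (by omega) h' h0' hε
    obtain ⟨U, M, u0, eta, u1, u2, e, w, hA⟩ := ASY_exists hG a b hdeg hq' hdiv
    obtain ⟨L, l, hL⟩ := hA.lim rfl ha 0 ha0
    have hqe : ∀ x : E (k + 4), eval x.ofLp (qpoly a b) = ∑ i, (a i * x i ^ 2 + b i * x i) := by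
      intro x; simp [qpoly, Finset.sum_add_distrib]
    rcases hL.class rfl ha with ⟨i0, hi0, hi1, hb⟩ | ⟨hall, c3, c1, hb0, hab⟩ | ⟨hall, c1, c2⟩
    · refine absurd ⟨EuclideanSpace.single i0 1, by simp, fun x hx => ?_⟩ hnh'
      have := hq' x hx
      rw [hqe, Finset.sum_eq_single i0 (fun j _ hj => by simp [hi1 j hj, hb]) (by simp), hi0, hb] at this
      rw [EuclideanSpace.inner_single_left]
      simp at this ⊢; exact this
    · obtain ⟨j0, j1, j2, d01, d02, d12, hf3⟩ := Finset.card_eq_three.1 c3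
      obtain ⟨j3, hf1⟩ := Finset.card_eq_one.1 c1
      have m3 : ∀ i, a i = -1 / 2 ↔ i = j0 ∨ i = j1 ∨ i = j2 := fun i => by
        have := Finset.ext_iff.1 hf3 i; simpa using this
      have m1 : ∀ i, a i = 1 / 2 ↔ i = j3 := fun i => by
        have := Finset.ext_iff.1 hf1 i; simpa using this
      have a0 := (m3 j0).2 (by simp)
      have a1 := (m3 j1).2 (by simp)
      have a2 := (m3 j2).2 (by simp)
      have a3 := (m1 j3).2 rfl
      have d3 : ∀ i, a i = -1 / 2 → i ≠ j3 := fun i hi hij => by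
        rw [hij, a3] at hi; norm_num at hi
      obtain ⟨σ, hσ⟩ := perm4 ![j0, j1, j2, j3] (by
        intro p q; fin_cases p <;> fin_cases q <;>
          simp [d01, d02, d12, d01.symm, d02.symm, d12.symm, d3 _ a0, d3 _ a1, d3 _ a2,
            (d3 _ a0).symm, (d3 _ a1).symm, (d3 _ a2).symm])
      have s0 : σ ⟨0, by omega⟩ = j0 := hσ 0
      have s1 : σ ⟨1, by omega⟩ = j1 := hσ 1
      have s2 : σ ⟨2, by omega⟩ = j2 := hσ 2
      have s3 : σ ⟨3, by omega⟩ = j3 := hσ 3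
      let P := LinearIsometryEquiv.piLpCongrLeft 2 ℝ ℝ σ.symm
      have hP : ∀ (x : E (k + 4)) i, (P x) i = x (σ i) := fun x i => by
        simp [P, LinearIsometryEquiv.piLpCongrLeft_apply, Equiv.piCongrLeft']
      let c : E (k + 4) := WithLp.toLp 2 fun i => b i / (2 * a i)
      let G : E (k + 4) ≃ᵢ E (k + 4) :=
        (f.toIsometryEquiv.trans (IsometryEquiv.addRight c)).trans P.toIsometryEquiv
      have hGa : ∀ x, G x = P (f x + c) := fun x => rfl
      have hs : msupp (ν.map G) ⊆ stdKP (k + 4) (by omega) := by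
        intro u hu
        rw [msupp_map] at hu
        obtain ⟨x, rfl⟩ := G.surjective u
        rw [G.symm_apply_apply] at hu
        have e1 := hq x hu
        rw [hqe] at e1
        have e2 : ∑ i, (a i * (f x) i ^ 2 + b i * (f x) i) =
            ∑ i, (a i * (f x + c) i ^ 2) - ∑ i, a i * b i ^ 2 := by
          rw [← Finset.sum_sub_distrib]
          refine Finset.sum_congr rfl fun i _ => ?_
          simp only [PiLp.add_apply, c]
          rcases hall i with hi | hi | hi
          · simp [hi, hb0 i hi]
          · rw [hi]; ring
          · rw [hi]; ring
        rw [e2, hab, sub_zero, ← Equiv.sum_comp σ] at e1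
        have e3 : ∀ i, (f x + c) (σ i) = (G x) i := fun i => by rw [hGa, hP]
        simp only [e3] at e1
        rw [Fin.sum_univ_succ, Fin.sum_univ_succ, Fin.sum_univ_succ, Fin.sum_univ_succ,
          Finset.sum_eq_zero] at e1
        · change a (σ ⟨0, by omega⟩) * (G x) ⟨0, by omega⟩ ^ 2 +
            (a (σ ⟨1, by omega⟩) * (G x) ⟨1, by omega⟩ ^ 2 + (a (σ ⟨2, by omega⟩) *
            (G x) ⟨2, by omega⟩ ^ 2 + (a (σ ⟨3, by omega⟩) * (G x) ⟨3, by omega⟩ ^ 2 + 0))) = 0 at e1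
          rw [s0, s1, s2, s3, a0, a1, a2, a3] at e1
          simp only [stdKP, mem_ofPred_eq]
          linarith
        · intro i _
          have hz : a (σ i.succ.succ.succ.succ) = 0 := by
            have hne : ∀ j (hj : j < 4), σ i.succ.succ.succ.succ ≠ σ ⟨j, by omega⟩ := by
              intro j hj he
              have := Fin.val_eq_of_eq (σ.injective he)
              simp at this; omega
            rcases hall (σ i.succ.succ.succ.succ) with hi | hi | hi
            · exact hi
            · rcases (m3 _).1 hi with hi | hi | hi
              · exact absurd (hi.trans s0.symm) (hne 0 (by omega))
              · exact absurd (hi.trans s1.symm) (hne 1 (by omega))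
              · exact absurd (hi.trans s2.symm) (hne 2 (by omega))
            · exact absurd (((m1 _).1 hi).trans s3.symm) (hne 3 (by omega))
          rw [hz, zero_mul]
      have hx0 : G 0 ∈ msupp (ν.map G) := by rw [msupp_map, G.symm_apply_apply]; exact h0
      have hfull := full_KP (h.map G) hx0 hs
      refine ⟨f.symm (-c), f.trans P, ?_⟩
      ext z
      simp only [mem_ofPred_eq, mem_preimage]
      rw [← hfull, msupp_map]
      have : (f.trans P) z = G (f.symm (-c) + z) := by
        rw [hGa, map_add f, f.apply_symm_apply, show -c + f z + c = f z by abel]; rfl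
      rw [this, G.symm_apply_apply]
    · exact (no_exotic rfl hG a b hdeg hq' hdiv hall c1 c2).elim
end

section

section BU
variable {n m : ℕ} {μ : Measure (E n)}

lemma mpos [IsLocallyFiniteMeasure μ] {z : E n} (hz : z ∈ msupp μ) {s : ℝ} (hs : 0 < s) :
    0 < μ.real (closedBall z s) :=
  ENNReal.toReal_pos (hz s hs).ne' (isCompact_closedBall z s).measure_ne_top

lemma mr_mono [IsLocallyFiniteMeasure μ] {x y : E n} {s t : ℝ} (h : dist x y + s ≤ t) :
    μ.real (closedBall x s) ≤ μ.real (closedBall y t) :=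
  measureReal_mono (closedBall_subset_closedBall' (by linarith))
    (isCompact_closedBall y t).measure_ne_top

lemma ratio0 [IsLocallyFiniteMeasure μ] (hA : AOD m μ) {K : Set (E n)} (hK : K ⊆ msupp μ)
    (hKc : IsCompact K) {ι : Type} {l : Filter ι} {z : ι → E n} (hz : ∀ j, z j ∈ K) {r : ι → ℝ}
    (hr : ∀ j, 0 < r j) (hr0 : Tendsto r l (𝓝 0)) {τ : ℝ} (hτ : 0 < τ) :
    Tendsto (fun j => μ.real (closedBall (z j) (τ * r j)) / μ.real (closedBall (z j) (r j))) l
      (𝓝 (τ ^ m)) := by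
  have ha : ∀ τ : ℝ, 1/2 ≤ τ → τ ≤ 1 → ∀ r : ι → ℝ, (∀ j, 0 < r j) → Tendsto r l (𝓝 0) →
      Tendsto (fun j => μ.real (closedBall (z j) (τ * r j)) / μ.real (closedBall (z j) (r j))) l
      (𝓝 (τ ^ m)) := by
    intro τ h1 h2 r hr hr0
    rw [Metric.tendsto_nhds]
    intro δ hδ
    obtain ⟨r₀, h0, h⟩ := hA K hK hKc δ hδ
    filter_upwards [hr0.eventually (gt_mem_nhds h0)] with j hj
    rw [Real.dist_eq]
    exact h (z j) (hz j) (r j) (hr j) hj.le τ ⟨h1, h2⟩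
  have hb : ∀ N : ℕ, ∀ τ : ℝ, (1/2) ^ N ≤ τ → τ ≤ 1 → ∀ r : ι → ℝ, (∀ j, 0 < r j) → Tendsto r l (𝓝 0) →
      Tendsto (fun j => μ.real (closedBall (z j) (τ * r j)) / μ.real (closedBall (z j) (r j))) l
      (𝓝 (τ ^ m)) := by
    intro N
    induction N with
    | zero => intro τ h1 h2; exact ha τ (by norm_num at h1; linarith) h2
    | succ N ih =>
      intro τ h1 h2 r hr hr0
      rcases le_total (1/2) τ with h3 | h3
      · exact ha τ h3 h2 r hr hr0
      · have hτ : 0 < τ := lt_of_lt_of_le (by positivity) h1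
        have i1 := ih (2 * τ) (by rw [pow_succ] at h1; linarith) (by linarith) r hr hr0
        have i2 := ha (1/2) le_rfl (by norm_num) (fun j => 2 * τ * r j)
          (fun j => by have := hr j; positivity) (by simpa using hr0.const_mul (2 * τ))
        have := i2.mul i1
        rw [← mul_pow, show 1 / 2 * (2 * τ) = τ by ring] at this
        refine this.congr fun j => ?_
        have p2 : 0 < μ.real (closedBall (z j) (2 * τ * r j)) :=
          mpos (hK (hz j)) (by have := hr j; positivity)
        rw [show 1 / 2 * (2 * τ * r j) = τ * r j by ring, div_mul_div_cancel₀ p2.ne']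
  rcases le_total τ 1 with h1 | h1
  · obtain ⟨N, hN⟩ := exists_pow_lt_of_lt_one hτ (by norm_num : (1/2 : ℝ) < 1)
    exact hb N τ hN.le h1 r hr hr0
  · obtain ⟨N, hN⟩ := exists_pow_lt_of_lt_one (inv_pos.2 hτ) (by norm_num : (1/2 : ℝ) < 1)
    have := (hb N τ⁻¹ hN.le (inv_le_one_of_one_le₀ h1) (fun j => τ * r j)
      (fun j => by have := hr j; positivity) (by simpa using hr0.const_mul τ)).inv₀ (by positivity)
    rw [inv_pow, inv_inv] at this
    refine this.congr fun j => ?_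
    rw [inv_div, inv_mul_cancel_left₀ hτ.ne']

lemma ratio1 [IsLocallyFiniteMeasure μ] (hA : AOD m μ) {K : Set (E n)} (hK : K ⊆ msupp μ)
    (hKc : IsCompact K) {ι : Type} {l : Filter ι} {x z : ι → E n} (hx : ∀ j, x j ∈ K)
    (hz : ∀ j, z j ∈ K) {r : ι → ℝ}
    (hr : ∀ j, 0 < r j) (hr0 : Tendsto r l (𝓝 0)) {R : ℝ} (hR : 0 ≤ R)
    (hd : ∀ᶠ j in l, dist (z j) (x j) ≤ R * r j) {τ : ℝ} (hτ : 0 < τ) :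
    Tendsto (fun j => μ.real (closedBall (z j) (τ * r j)) / μ.real (closedBall (x j) (r j))) l
      (𝓝 (τ ^ m)) := by
  have up : ∀ x z : ι → E n, (∀ j, x j ∈ K) → (∀ j, z j ∈ K) → (∀ᶠ j in l, dist (z j) (x j) ≤ R * r j) →
      ∀ b : ℝ, 1 < b →
      ∀ᶠ j in l, μ.real (closedBall (z j) (r j)) / μ.real (closedBall (x j) (r j)) < b := by
    intro x z hx hz hd b hb
    obtain ⟨T, hT0, hT⟩ : ∃ T : ℝ, 0 < T ∧ (T ^ m)⁻¹ * (T + R) ^ m < b := by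
      have : Tendsto (fun T : ℝ => (1 + R * T⁻¹) ^ m) atTop (𝓝 ((1 + R * 0) ^ m)) :=
        ((tendsto_inv_atTop_zero.const_mul R).const_add 1).pow m
      rw [mul_zero, add_zero, one_pow] at this
      obtain ⟨T, h1, h2⟩ := ((this.eventually (gt_mem_nhds hb)).and (eventually_gt_atTop 0)).exists
      refine ⟨T, h2, lt_of_eq_of_lt ?_ h1⟩
      rw [← inv_pow, ← mul_pow]; congr 1; field_simp
    have t1 := (ratio0 hA hK hKc hz hr hr0 hT0).inv₀ (by positivity)
    have t2 := ratio0 hA hK hKc hx hr hr0 (τ := T + R) (by positivity)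
    filter_upwards [(t1.mul t2).eventually (gt_mem_nhds hT), hd] with j hj hdj
    refine lt_of_le_of_lt ?_ hj
    have hrj := hr j
    have p1 := mpos (hK (hz j)) hrj
    have p2 := mpos (hK (hx j)) hrj
    have p3 : 0 < μ.real (closedBall (z j) (T * r j)) := mpos (hK (hz j)) (by positivity)
    have p4 : μ.real (closedBall (z j) (T * r j)) ≤ μ.real (closedBall (x j) ((T + R) * r j)) :=
      mr_mono (by linarith)
    rw [inv_div, div_mul_div_comm, div_le_div_iff₀ p2 (by positivity)]
    nlinarith [mul_le_mul_of_nonneg_left p4 (mul_pos p1 p2).le]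
  have h1 : Tendsto (fun j => μ.real (closedBall (z j) (r j)) / μ.real (closedBall (x j) (r j))) l
      (𝓝 1) := by
    rw [tendsto_order]
    refine ⟨fun a ha => ?_, fun b hb => up x z hx hz hd b hb⟩
    rcases le_or_gt a 0 with h0 | h0
    · exact Eventually.of_forall fun j => h0.trans_lt (div_pos (mpos (hK (hz j)) (hr j)) (mpos (hK (hx j)) (hr j)))
    · filter_upwards [up z x hz hx (by simpa only [dist_comm] using hd) a⁻¹
        ((one_lt_inv₀ h0).2 ha)] with j hj
      have p1 := mpos (hK (hz j)) (hr j)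
      have p2 := mpos (hK (hx j)) (hr j)
      rw [lt_inv_comm₀ (by positivity) h0, inv_div] at hj
      exact hj
  have := (ratio0 hA hK hKc hz hr hr0 hτ).mul h1
  rw [mul_one] at this
  refine this.congr fun j => ?_
  have p1 := mpos (hK (hz j)) (hr j)
  have p2 := mpos (hK (hx j)) (hr j)
  field_simp

def Lam (μ : Measure (E n)) (x : E n) (r : ℝ) (f : E n → ℝ) : ℝ :=
  (μ.real (closedBall x r))⁻¹ * ∫ w, f (r⁻¹ • (w - x)) ∂μ

lemma Lam_int [IsLocallyFiniteMeasure μ] (x : E n) {r : ℝ} (hr : 0 < r) {f : E n → ℝ}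
    (hf : Continuous f) (hc : HasCompactSupport f) : Integrable (fun w => f (r⁻¹ • (w - x))) μ := by
  refine Continuous.integrable_of_hasCompactSupport (by fun_prop) ?_
  exact hc.comp_homeomorph ((Homeomorph.subRight x).trans
    (Homeomorph.smulOfNeZero r⁻¹ (inv_ne_zero hr.ne')))

lemma scale_mem (x y w : E n) {r : ℝ} (hr : 0 < r) (s : ℝ) :
    r⁻¹ • (w - x) ∈ closedBall y s ↔ w ∈ closedBall (x + r • y) (s * r) := by
  have : r⁻¹ • (w - x) - y = r⁻¹ • (w - (x + r • y)) := by
    rw [← sub_sub, smul_sub r⁻¹ (w - x), smul_smul, inv_mul_cancel₀ hr.ne', one_smul]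
  rw [mem_closedBall, mem_closedBall, dist_eq_norm, dist_eq_norm, this, norm_smul, norm_inv,
    Real.norm_of_nonneg hr.le, inv_mul_le_iff₀ hr, mul_comm]

lemma Lam_le [IsLocallyFiniteMeasure μ] (x : E n) {r : ℝ} (hr : 0 < r) {f : E n → ℝ}
    (hf : Continuous f) (hc : HasCompactSupport f) {y : E n} {s C : ℝ} (hC : 0 ≤ C)
    (h1 : ∀ v ∈ closedBall y s, f v ≤ C) (h2 : ∀ v, v ∉ closedBall y s → f v ≤ 0) :
    Lam μ x r f ≤ C * (μ.real (closedBall (x + r • y) (s * r)) / μ.real (closedBall x r)) := by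
  have : ∫ w, f (r⁻¹ • (w - x)) ∂μ ≤ ∫ w, (closedBall (x + r • y) (s * r)).indicator (fun _ => C) w ∂μ := by
    refine integral_mono (Lam_int x hr hf hc) ((integrable_indicator_iff measurableSet_closedBall).2
      (integrableOn_const (isCompact_closedBall _ _).measure_ne_top)) fun w => ?_
    by_cases hw : w ∈ closedBall (x + r • y) (s * r)
    · rw [indicator_of_mem hw]; exact h1 _ ((scale_mem x y w hr s).2 hw)
    · rw [indicator_of_notMem hw]; exact h2 _ (fun h => hw ((scale_mem x y w hr s).1 h))
  rw [integral_indicator measurableSet_closedBall, setIntegral_const, smul_eq_mul] at this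
  calc _ ≤ (μ.real (closedBall x r))⁻¹ * (μ.real (closedBall (x + r • y) (s * r)) * C) :=
        mul_le_mul_of_nonneg_left this (by positivity)
    _ = _ := by rw [div_eq_mul_inv]; ring

lemma Lam_ge [IsLocallyFiniteMeasure μ] (x : E n) {r : ℝ} (hr : 0 < r) {f : E n → ℝ}
    (hf : Continuous f) (hc : HasCompactSupport f) {y : E n} {s : ℝ}
    (h1 : ∀ v ∈ closedBall y s, 1 ≤ f v) (h2 : ∀ v, 0 ≤ f v) :
    μ.real (closedBall (x + r • y) (s * r)) / μ.real (closedBall x r) ≤ Lam μ x r f := by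
  have : ∫ w, (closedBall (x + r • y) (s * r)).indicator (fun _ => (1:ℝ)) w ∂μ ≤ ∫ w, f (r⁻¹ • (w - x)) ∂μ := by
    refine integral_mono ((integrable_indicator_iff measurableSet_closedBall).2
      (integrableOn_const (isCompact_closedBall _ _).measure_ne_top)) (Lam_int x hr hf hc) fun w => ?_
    by_cases hw : w ∈ closedBall (x + r • y) (s * r)
    · rw [indicator_of_mem hw]; exact h1 _ ((scale_mem x y w hr s).2 hw)
    · rw [indicator_of_notMem hw]; exact h2 _
  rw [integral_indicator measurableSet_closedBall, setIntegral_const, smul_eq_mul, mul_one] at this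
  rw [div_eq_mul_inv, mul_comm]
  exact mul_le_mul_of_nonneg_left this (by positivity)

lemma cutoff (y : E n) {s t : ℝ} (hst : s < t) : ∃ f : E n → ℝ, Continuous f ∧ HasCompactSupport f ∧
    (∀ v, 0 ≤ f v) ∧ (∀ v, f v ≤ 1) ∧ (∀ v ∈ closedBall y s, f v = 1) ∧
    ∀ v, v ∉ closedBall y t → f v = 0 := by
  obtain ⟨f, h1, h2, h3, h4⟩ := exists_continuous_one_zero_of_isCompact (isCompact_closedBall y s)
    (isOpen_ball (x := y) (ε := t)).isClosed_compl (by
      rw [disjoint_compl_right_iff_subset]; exact closedBall_subset_ball hst)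
  exact ⟨f, f.continuous, h3, fun v => (h4 v).1, fun v => (h4 v).2, fun v hv => h1 hv,
    fun v hv => h2 (fun h => hv (ball_subset_closedBall h))⟩

open CompactlySupported in
lemma riesz [IsLocallyFiniteMeasure μ] (hA : AOD m μ) {K : Set (E n)} (hK : K ⊆ msupp μ)
    (hKc : IsCompact K) (U : Ultrafilter ℕ) {x : ℕ → E n} (hx : ∀ j, x j ∈ K) {r : ℕ → ℝ}
    (hr : ∀ j, 0 < r j) (hr0 : Tendsto r U (𝓝 0)) : ∃ ν : Measure (E n), IsLocallyFiniteMeasure ν ∧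
      ∀ f : E n → ℝ, Continuous f → HasCompactSupport f →
        Tendsto (fun j => Lam μ (x j) (r j) f) U (𝓝 (∫ w, f w ∂ν)) := by
  have hlim : ∀ f : C_c(E n, ℝ), ∃ L : ℝ, Tendsto (fun j => Lam μ (x j) (r j) f) U (𝓝 L) := by
    intro f
    obtain ⟨C, hC⟩ := f.2.exists_bound_of_continuous f.1.2
    obtain ⟨R, hR⟩ := f.2.isCompact.isBounded.subset_closedBall (0 : E n)
    have hC0 : 0 ≤ C := (norm_nonneg _).trans (hC 0)
    have hz : ∀ v, v ∉ closedBall (0 : E n) (|R| + 1) → f v = 0 := fun v hv => by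
      apply image_eq_zero_of_notMem_tsupport (f := f)
      intro h
      exact hv (closedBall_subset_closedBall (by linarith [le_abs_self R]) (hR h))
    have hb := (ratio0 hA hK hKc hx hr hr0 (τ := |R| + 1) (by positivity)).const_mul C
    have hev := hb.eventually (gt_mem_nhds (lt_add_one _))
    obtain ⟨L, -, hL⟩ := (isCompact_Icc (a := -(C * (|R| + 1) ^ m + 1)) (b := C * (|R| + 1) ^ m + 1)).ultrafilter_le_nhds
      (U.map fun j => Lam μ (x j) (r j) f) (by
        rw [le_principal_iff]
        show ∀ᶠ j in (U : Filter ℕ), Lam μ (x j) (r j) f ∈ Icc _ _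
        filter_upwards [hev] with j hj
        have a1 := Lam_le (μ := μ) (x j) (hr j) f.1.2 f.2 (y := 0) (s := |R| + 1) hC0
          (fun v _ => (le_abs_self _).trans (hC v)) (fun v hv => (hz v hv).le)
        have a2 := Lam_le (μ := μ) (x j) (hr j) (f := fun v => -f v) (by exact f.1.2.neg) (by exact f.2.neg) (y := 0)
          (s := |R| + 1) hC0 (fun v _ => (neg_le_abs _).trans (hC v)) (fun v hv => by simp [hz v hv])
        rw [smul_zero, add_zero] at a1 a2
        have a3 : Lam μ (x j) (r j) (fun v => -f v) = - Lam μ (x j) (r j) f := by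
          simp only [Lam, integral_neg, mul_neg]
        rw [a3] at a2
        exact ⟨by linarith, a1.trans hj.le⟩)
    exact ⟨L, hL⟩
  choose L hL using hlim
  let Λ0 : C_c(E n, ℝ) →ₗ[ℝ] ℝ :=
    { toFun := L
      map_add' := fun f g => by
        refine tendsto_nhds_unique (hL (f + g)) (((hL f).add (hL g)).congr fun j => ?_)
        simp only [Lam]
        have i1 : Integrable (fun w => f ((r j)⁻¹ • (w - x j))) μ := Lam_int _ (hr j) f.1.2 f.2
        have i2 : Integrable (fun w => g ((r j)⁻¹ • (w - x j))) μ := Lam_int _ (hr j) g.1.2 g.2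
        rw [← mul_add, ← integral_add i1 i2]
        rfl
      map_smul' := fun c f => by
        refine tendsto_nhds_unique (hL (c • f)) (((hL f).const_mul c).congr fun j => ?_)
        simp only [Lam]
        rw [mul_left_comm, ← integral_const_mul]
        rfl }
  let Λ := PositiveLinearMap.mk₀ Λ0 (fun f hf => ge_of_tendsto' (hL f) fun j => by
    have : 0 ≤ ∫ w, f ((r j)⁻¹ • (w - x j)) ∂μ := integral_nonneg fun w => hf _
    simp only [Lam]; positivity)
  refine ⟨RealRMK.rieszMeasure Λ, inferInstance, fun f hf hc => ?_⟩
  have := RealRMK.integral_rieszMeasure Λ ⟨⟨f, hf⟩, hc⟩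
  have e : ∫ w, f w ∂(RealRMK.rieszMeasure Λ) = L ⟨⟨f, hf⟩, hc⟩ := this
  rw [e]; exact hL ⟨⟨f, hf⟩, hc⟩

theorem BLOW [IsLocallyFiniteMeasure μ] (hA : AOD m μ) {K : Set (E n)} (hK : K ⊆ msupp μ)
    (hKc : IsCompact K) (U : Ultrafilter ℕ) {x : ℕ → E n} (hx : ∀ j, x j ∈ K) {r : ℕ → ℝ}
    (hr : ∀ j, 0 < r j) (hr0 : Tendsto r U (𝓝 0)) : ∃ ν : Measure (E n), IsUnif m ν ∧
      (∀ y : ℕ → E n, (∀ j, x j + r j • y j ∈ msupp μ) → ∀ y0, Tendsto y U (𝓝 y0) → y0 ∈ msupp ν) ∧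
      ∀ y0 ∈ msupp ν, ∃ y : ℕ → E n, (∀ j, x j + r j • y j ∈ msupp μ) ∧ Tendsto y U (𝓝 y0) := by
  let K' := msupp μ ∩ cthickening 1 K
  have hK' : K' ⊆ msupp μ := inter_subset_left
  have hKc' : IsCompact K' := hKc.cthickening.inter_left (msupp_closed μ)
  have hKK : K ⊆ K' := fun z hz => ⟨hK hz, self_subset_cthickening K hz⟩
  obtain ⟨ν, hfin, hν⟩ := riesz hA hK hKc U hx hr hr0
  have hmass : ∀ y : ℕ → E n, (∀ j, x j + r j • y j ∈ msupp μ) → ∀ y0, Tendsto y U (𝓝 y0) →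
      ∀ s : ℝ, 0 < s → Tendsto (fun j => μ.real (closedBall (x j + r j • y j) (s * r j)) /
        μ.real (closedBall (x j) (r j))) U (𝓝 (s ^ m)) := by
    intro y hy y0 hy0 s hs
    have hyb : ∀ᶠ j in (U : Filter ℕ), ‖y j‖ < ‖y0‖ + 1 :=
      hy0.norm.eventually (gt_mem_nhds (lt_add_one _))
    have hrb : ∀ᶠ j in (U : Filter ℕ), r j < (‖y0‖ + 1)⁻¹ := hr0.eventually (gt_mem_nhds (by positivity))
    classical
    let z : ℕ → E n := fun j => if x j + r j • y j ∈ K' then x j + r j • y j else x j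
    have hz : ∀ᶠ j in (U : Filter ℕ), z j = x j + r j • y j := by
      filter_upwards [hyb, hrb] with j h1 h2
      refine if_pos ⟨hy j, mem_cthickening_of_dist_le _ (x j) _ _ (hx j) ?_⟩
      rw [dist_eq_norm, add_sub_cancel_left, norm_smul, Real.norm_of_nonneg (hr j).le]
      rw [lt_inv_comm₀ (hr j) (by positivity)] at h2
      calc r j * ‖y j‖ ≤ r j * (r j)⁻¹ := mul_le_mul_of_nonneg_left (h1.trans h2).le (hr j).le
        _ = 1 := mul_inv_cancel₀ (hr j).ne'
    have := ratio1 hA hK' hKc' (l := U) (x := x) (z := z) (fun j => hKK (hx j)) (fun j => by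
      simp only [z]; split_ifs with h
      · exact h
      · exact hKK (hx j)) hr hr0 (R := ‖y0‖ + 1) (by positivity) (by
        filter_upwards [hyb, hz] with j h1 h2
        rw [h2, dist_eq_norm, add_sub_cancel_left, norm_smul, Real.norm_of_nonneg (hr j).le, mul_comm]
        exact mul_le_mul_of_nonneg_right h1.le (hr j).le) hs
    refine this.congr' ?_
    filter_upwards [hz] with j hj
    rw [hj]
  have hball : ∀ y : ℕ → E n, (∀ j, x j + r j • y j ∈ msupp μ) → ∀ y0, Tendsto y U (𝓝 y0) →
      ∀ s : ℝ, 0 < s → ν.real (closedBall y0 s) = s ^ m := by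
    intro y hy y0 hy0 s hs
    have hclose : ∀ δ > 0, ∀ᶠ j in (U : Filter ℕ), dist (y j) y0 < δ := fun δ hδ =>
      Metric.tendsto_nhds.1 hy0 δ hδ
    have hd : ∀ j, dist (x j + r j • y j) (x j + r j • y0) = r j * dist (y j) y0 := by
      intro j
      rw [dist_add_left, dist_smul₀, Real.norm_of_nonneg (hr j).le]
    have hcont : Continuous fun δ : ℝ => (s + 2 * δ) ^ m := by fun_prop
    apply le_antisymm
    · have : ∀ δ > 0, ν.real (closedBall y0 s) ≤ (s + 2 * δ) ^ m := by
        intro δ hδ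
        obtain ⟨f, f1, f2, f3, f4, f5, f6⟩ := cutoff y0 (lt_add_of_pos_right s hδ)
        have e1 : ν.real (closedBall y0 s) ≤ ∫ w, f w ∂ν := by
          rw [← integral_indicator_one measurableSet_closedBall]
          refine integral_mono ((integrable_indicator_iff measurableSet_closedBall).2
            (integrableOn_const (isCompact_closedBall _ _).measure_ne_top))
            (f1.integrable_of_hasCompactSupport f2) fun w => ?_
          by_cases hw : w ∈ closedBall y0 s
          · rw [indicator_of_mem hw, f5 w hw]; rfl
          · rw [indicator_of_notMem hw]; exact f3 w
        refine e1.trans (le_of_tendsto_of_tendsto (hν f f1 f2) (hmass y hy y0 hy0 (s + 2 * δ) (by positivity)) ?_)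
        filter_upwards [hclose δ hδ] with j hj
        refine (Lam_le (x j) (hr j) f1 f2 (y := y0) zero_le_one (fun v _ => f4 v)
          (fun v hv => (f6 v hv).le)).trans ?_
        rw [one_mul]
        refine div_le_div_of_nonneg_right (mr_mono ?_) (by positivity)
        rw [dist_comm, hd]; nlinarith [hr j]
      have h2 := ge_of_tendsto ((hcont.tendsto 0).mono_left (nhdsWithin_le_nhds (s := Ioi 0)))
        (eventually_mem_nhdsWithin.mono this)
      simpa using h2
    · have : ∀ δ > 0, δ < s / 2 → (s + 2 * (-δ)) ^ m ≤ ν.real (closedBall y0 s) := by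
        intro δ hδ hδs
        obtain ⟨f, f1, f2, f3, f4, f5, f6⟩ := cutoff y0 (sub_lt_self s hδ)
        have e1 : ∫ w, f w ∂ν ≤ ν.real (closedBall y0 s) := by
          rw [← integral_indicator_one measurableSet_closedBall]
          refine integral_mono (f1.integrable_of_hasCompactSupport f2)
            ((integrable_indicator_iff measurableSet_closedBall).2
            (integrableOn_const (isCompact_closedBall _ _).measure_ne_top)) fun w => ?_
          by_cases hw : w ∈ closedBall y0 s
          · rw [indicator_of_mem hw]; exact f4 w
          · rw [indicator_of_notMem hw]; exact (f6 w hw).le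
        refine le_trans (le_of_tendsto_of_tendsto (hmass y hy y0 hy0 (s + 2 * (-δ)) (by linarith)) (hν f f1 f2) ?_) e1
        filter_upwards [hclose δ hδ] with j hj
        refine le_trans ?_ (Lam_ge (x j) (hr j) f1 f2 (y := y0) (s := s - δ) (fun v hv => (f5 v hv).ge) f3)
        refine div_le_div_of_nonneg_right (mr_mono ?_) (by positivity)
        rw [hd]; nlinarith [hr j]
      have h2 := le_of_tendsto (((hcont.comp continuous_neg).tendsto 0).mono_left
        (nhdsWithin_le_nhds (s := Ioi 0))) ((eventually_mem_nhdsWithin.and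
          (nhdsWithin_le_nhds (gt_mem_nhds (half_pos hs)))).mono fun δ h => this δ h.1 h.2)
      simpa using h2
  have hA' : ∀ y : ℕ → E n, (∀ j, x j + r j • y j ∈ msupp μ) → ∀ y0, Tendsto y U (𝓝 y0) → y0 ∈ msupp ν := by
    intro y hy y0 hy0 s hs
    have := hball y hy y0 hy0 s hs
    by_contra h0
    rw [not_lt, nonpos_iff_eq_zero] at h0
    rw [Measure.real, h0, ENNReal.toReal_zero] at this
    exact (pow_pos hs m).ne this
  have hB : ∀ y0 ∈ msupp ν, ∃ y : ℕ → E n, (∀ j, x j + r j • y j ∈ msupp μ) ∧ Tendsto y U (𝓝 y0) := by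
    intro y0 hy0
    have hS : ∀ j, ∃ y ∈ {y : E n | x j + r j • y ∈ msupp μ},
        infDist y0 {y : E n | x j + r j • y ∈ msupp μ} = dist y0 y := fun j =>
      ((msupp_closed μ).preimage (by fun_prop : Continuous fun y : E n => x j + r j • y)).exists_infDist_eq_dist
        ⟨0, by simpa using hK (hx j)⟩ y0
    choose y hy1 hy2 using hS
    refine ⟨y, hy1, ?_⟩
    rw [Metric.tendsto_nhds]
    intro ε hε
    by_contra hcon
    rw [← Ultrafilter.eventually_not] at hcon
    obtain ⟨f, f1, f2, f3, f4, f5, f6⟩ := cutoff y0 (half_lt_self hε)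
    obtain ⟨g, g1, g2, g3, g4, g5, g6⟩ := cutoff y0 (half_lt_self (half_pos hε))
    have e1 : ν.real (closedBall y0 (ε / 2 / 2)) ≤ ∫ w, g w ∂ν := by
      rw [← integral_indicator_one measurableSet_closedBall]
      refine integral_mono ((integrable_indicator_iff measurableSet_closedBall).2
        (integrableOn_const (isCompact_closedBall _ _).measure_ne_top))
        (g1.integrable_of_hasCompactSupport g2) fun w => ?_
      by_cases hw : w ∈ closedBall y0 (ε / 2 / 2)
      · rw [indicator_of_mem hw, g5 w hw]; rfl
      · rw [indicator_of_notMem hw]; exact g3 w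
    have e2 : ∫ w, g w ∂ν = 0 := by
      refine tendsto_nhds_unique (hν g g1 g2) (tendsto_const_nhds.congr' ?_)
      filter_upwards [hcon] with j hj
      rw [Lam, integral_eq_zero_of_ae, mul_zero]
      filter_upwards [msupp_ae μ] with w hw
      refine g6 _ fun hmem => hj ?_
      have hw' : (r j)⁻¹ • (w - x j) ∈ {y : E n | x j + r j • y ∈ msupp μ} := by
        simp only [mem_ofPred_eq]
        rw [smul_smul, mul_inv_cancel₀ (hr j).ne', one_smul, add_sub_cancel]; exact hw
      rw [dist_comm, ← hy2 j]
      refine (infDist_le_dist_of_mem hw').trans_lt ?_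
      rw [dist_comm]
      exact (mem_closedBall.1 hmem).trans_lt (half_lt_self hε)
    have e3 : 0 < ν.real (closedBall y0 (ε / 2 / 2)) := mpos hy0 (by positivity)
    linarith
  refine ⟨ν, fun y0 hy0 s hs => ?_, hA', hB⟩
  obtain ⟨y, h1, h2⟩ := hB y0 hy0
  rw [← hball y h1 y0 h2 s hs, Measure.real, ENNReal.ofReal_toReal (isCompact_closedBall _ _).measure_ne_top]
end BU
end

section

def nr {n : ℕ} (ε : ℝ) (A B : Set (E n)) : Prop := ∀ v ∈ A, ‖v‖ ≤ 1 → ∃ w ∈ B, ‖w‖ ≤ 1 ∧ ‖v - w‖ < ε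

def NN {n : ℕ} (ε : ℝ) (A B : Set (E n)) : Prop := nr ε A B ∧ nr ε B A

def sc {n : ℕ} (S : Set (E n)) (x : E n) (r : ℝ) : Set (E n) := {v | x + r • v ∈ S}

def AP {n : ℕ} (H : Set (E n)) : Prop :=
  ∀ h ∈ H, ‖h‖ ≤ 1 → ∀ ε > 0, ∃ w ∈ H, ‖w‖ < 1 ∧ ‖w - h‖ < ε

def Kur {n : ℕ} (A : ℕ → Set (E n)) (H : Set (E n)) : Prop :=
  (∀ y : ℕ → E n, (∀ᶠ j in (hyperfilter ℕ : Filter ℕ), y j ∈ A j) → ∀ y0,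
    Tendsto y (hyperfilter ℕ) (𝓝 y0) → y0 ∈ H) ∧
  ∀ y0 ∈ H, ∀ ε > 0, ∀ᶠ j in (hyperfilter ℕ : Filter ℕ), ∃ w ∈ A j, ‖w - y0‖ < ε

section
variable {n : ℕ}

lemma nr.trans {a b : ℝ} {A B C : Set (E n)} (h1 : nr a A B) (h2 : nr b B C) : nr (a + b) A C := by
  intro v hv hv1
  obtain ⟨w, hw, hw1, h⟩ := h1 v hv hv1
  obtain ⟨z, hz, hz1, h'⟩ := h2 w hw hw1
  exact ⟨z, hz, hz1, by linarith [norm_sub_le_norm_sub_add_norm_sub v w z]⟩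

lemma nr.mono {a b : ℝ} {A B : Set (E n)} (h1 : nr a A B) (h : a ≤ b) : nr b A B :=
  fun v hv hv1 => let ⟨w, hw, hw1, h'⟩ := h1 v hv hv1; ⟨w, hw, hw1, h'.trans_le h⟩

lemma NN.trans {a b : ℝ} {A B C : Set (E n)} (h1 : NN a A B) (h2 : NN b B C) : NN (a + b) A C :=
  ⟨h1.1.trans h2.1, add_comm a b ▸ h2.2.trans h1.2⟩

lemma NN.pre {a : ℝ} {A B : Set (E n)} (h : NN a A B) (f : E n ≃ₗᵢ[ℝ] E n) :
    NN a (f ⁻¹' A) (f ⁻¹' B) := by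
  have : ∀ {A B : Set (E n)}, nr a A B → nr a (f ⁻¹' A) (f ⁻¹' B) := by
    intro A B h v hv hv1
    obtain ⟨w, hw, hw1, h'⟩ := h (f v) hv (by simpa using hv1)
    refine ⟨f.symm w, by simpa using hw, by simpa using hw1, ?_⟩
    rwa [← f.norm_map, map_sub, f.apply_symm_apply]
  exact ⟨this h.1, this h.2⟩

lemma dxr_le {x : E n} {r ε : ℝ} (hr : 0 < r) (hε : 0 < ε) {S C : Set (E n)}
    (h : nr ε (sc S x r) (sc C x r)) : dxr x r S C ≤ ε := by
  have hs : setD (S ∩ closedBall x r) (C ∩ closedBall x r) ≤ r * ε := by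
    refine Real.iSup_le (fun a => Real.iSup_le (fun ha => ?_) (by positivity)) (by positivity)
    have e : ∀ w : E n, x + r • r⁻¹ • (w - x) = w := fun w => by
      rw [smul_inv_smul₀ hr.ne']; abel
    obtain ⟨w, hw, hw1, h'⟩ := h (r⁻¹ • (a - x)) (by simpa [sc, e] using ha.1) (by
      have := ha.2
      rw [mem_closedBall, dist_eq_norm] at this
      rw [norm_smul, norm_inv, Real.norm_of_nonneg hr.le, inv_mul_le_iff₀ hr]; simpa)
    have hm : x + r • w ∈ C ∩ closedBall x r := by
      refine ⟨hw, ?_⟩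
      rw [mem_closedBall, dist_eq_norm, add_sub_cancel_left, norm_smul, Real.norm_of_nonneg hr.le]
      nlinarith
    refine (infDist_le_dist_of_mem hm).trans ?_
    · have : a - (x + r • w) = r • (r⁻¹ • (a - x) - w) := by
        rw [smul_sub, smul_inv_smul₀ hr.ne']; abel
      rw [dist_eq_norm, this, norm_smul, Real.norm_of_nonneg hr.le]
      nlinarith
  rw [dxr, one_div, inv_mul_le_iff₀ hr]; exact hs

lemma Dxr_le {x : E n} {r ε : ℝ} (hr : 0 < r) (hε : 0 < ε) {S C : Set (E n)}
    (h : NN ε (sc S x r) (sc C x r)) : Dxr x r S C ≤ ε :=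
  max_le (dxr_le hr hε h.1) (dxr_le hr hε h.2)

lemma Dxr_nonneg {x : E n} {r : ℝ} (hr : 0 < r) (S C : Set (E n)) : 0 ≤ Dxr x r S C := by
  refine le_max_of_le_left (mul_nonneg (by positivity) ?_)
  exact Real.iSup_nonneg fun _ => Real.iSup_nonneg fun _ => infDist_nonneg

lemma nr_lim {A B : ℕ → Set (E n)} {H : Set (E n)}
    (hA : ∀ y : ℕ → E n, (∀ᶠ j in (hyperfilter ℕ : Filter ℕ), y j ∈ A j) → ∀ y0,
      Tendsto y (hyperfilter ℕ) (𝓝 y0) → y0 ∈ H)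
    (hB : ∀ y0 ∈ H, ‖y0‖ ≤ 1 → ∀ ε > 0, ∀ᶠ j in (hyperfilter ℕ : Filter ℕ),
      ∃ w ∈ B j, ‖w‖ ≤ 1 ∧ ‖w - y0‖ < ε) {ε : ℝ} (hε : 0 < ε) :
    ∀ᶠ j in (hyperfilter ℕ : Filter ℕ), nr ε (A j) (B j) := by
  by_contra hc
  rw [← Ultrafilter.eventually_not] at hc
  have : ∀ j, ∃ v : E n, ‖v‖ ≤ 1 ∧ (¬ nr ε (A j) (B j) → v ∈ A j ∧ ∀ w ∈ B j, ‖w‖ ≤ 1 → ε ≤ ‖v - w‖) := by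
    intro j
    by_cases h : nr ε (A j) (B j)
    · exact ⟨0, by simp, fun h' => absurd h h'⟩
    · have h2 := h
      simp only [nr] at h2
      push Not at h2
      obtain ⟨v, hv, hv1, h3⟩ := h2
      exact ⟨v, hv1, fun _ => ⟨hv, h3⟩⟩
  choose v hv1 hv using this
  obtain ⟨y0, hy1, hy⟩ := (isCompact_closedBall (0 : E n) 1).ultrafilter_le_nhds
    ((hyperfilter ℕ).map v) (by
      rw [le_principal_iff]
      show ∀ᶠ j in (hyperfilter ℕ : Filter ℕ), v j ∈ closedBall 0 1
      exact Eventually.of_forall fun j => by simpa using hv1 j)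
  have hy : Tendsto v (hyperfilter ℕ) (𝓝 y0) := hy
  have h0 := hA v (hc.mono fun j hj => (hv j hj).1) y0 hy
  have h1 := hB y0 h0 (by simpa using hy1) (ε / 2) (by positivity)
  have h2 := hy.eventually (ball_mem_nhds y0 (half_pos hε))
  obtain ⟨j, ⟨⟨w, hw, hw1, hw2⟩, h3⟩, h4⟩ := ((h1.and h2).and hc).exists
  have := (hv j h4).2 w hw hw1
  rw [dist_eq_norm] at h3
  rw [norm_sub_rev] at hw2
  linarith [norm_sub_le_norm_sub_add_norm_sub (v j) y0 w]

lemma DC {A : ℕ → Set (E n)} {H : Set (E n)} (hK : Kur A H) (hc : IsClosed H) (hap : AP H)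
    {ε : ℝ} (hε : 0 < ε) : ∀ᶠ j in (hyperfilter ℕ : Filter ℕ), NN ε (A j) H := by
  refine (nr_lim (B := fun _ => H) hK.1 (fun y hy hy1 ε hε => Eventually.of_forall fun j =>
    ⟨y, hy, hy1, by simpa using hε⟩) hε).and (nr_lim (A := fun _ => H) (H := H)
      (fun y hy y0 h => hc.mem_of_tendsto h hy) (fun y0 hy0 hy1 ε hε => ?_) hε)
  obtain ⟨w, hw, hw1, hw2⟩ := hap y0 hy0 hy1 (ε / 2) (by positivity)
  filter_upwards [hK.2 w hw (min (ε / 2) (1 - ‖w‖)) (lt_min (by positivity) (by linarith))]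
    with j ⟨z, hz, hz1⟩
  refine ⟨z, hz, ?_, ?_⟩
  · linarith [min_le_right (ε / 2) (1 - ‖w‖), norm_le_norm_add_norm_sub' z w]
  · linarith [min_le_left (ε / 2) (1 - ‖w‖), norm_sub_le_norm_sub_add_norm_sub z w y0]

lemma Kur.scale {A : ℕ → Set (E n)} {H : Set (E n)} (hK : Kur A H) {l : ℝ} (hl : 0 < l) :
    Kur (fun j => sc (A j) 0 l) (sc H 0 l) := by
  refine ⟨fun y hy y0 h => ?_, fun y0 hy ε hε => ?_⟩
  · simp only [sc, zero_add, mem_ofPred_eq] at hy ⊢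
    exact hK.1 _ hy _ (h.const_smul l)
  · simp only [sc, zero_add, mem_ofPred_eq] at hy ⊢
    filter_upwards [hK.2 _ hy (l * ε) (by positivity)] with j ⟨w, hw, hw1⟩
    refine ⟨l⁻¹ • w, by rwa [smul_inv_smul₀ hl.ne'], ?_⟩
    have : l⁻¹ • w - y0 = l⁻¹ • (w - l • y0) := by rw [smul_sub, inv_smul_smul₀ hl.ne']
    rwa [this, norm_smul, norm_inv, Real.norm_of_nonneg hl.le, inv_mul_lt_iff₀ hl]

lemma sc_sc (S : Set (E n)) (x : E n) (r l : ℝ) : sc (sc S x r) 0 l = sc S x (l * r) := by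
  ext v; simp [sc, smul_smul, mul_comm]

lemma AP_cone {H : Set (E n)} (h : ∀ v ∈ H, ∀ t : ℝ, t • v ∈ H) : AP H := by
  intro v hv hv1 ε hε
  have ht : 0 < min (1 / 2) (ε / 2) := by positivity
  have h1 := min_le_left (1 / 2) (ε / 2)
  have h2 := min_le_right (1 / 2) (ε / 2)
  refine ⟨(1 - min (1 / 2) (ε / 2)) • v, h v hv _, ?_, ?_⟩
  · rw [norm_smul, Real.norm_of_nonneg (by linarith)]; nlinarith [norm_nonneg v]
  · rw [sub_smul, one_smul, sub_sub_cancel_left, norm_neg, norm_smul, Real.norm_of_nonneg ht.le]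
    nlinarith [norm_nonneg v]

def pl (v : E n) : Set (E n) := {w | ⟪v, w⟫ = 0}

lemma pl_smul {v w : E n} (h : w ∈ pl v) (t : ℝ) : t • w ∈ pl v := by
  simp only [pl, mem_ofPred_eq, inner_smul_right] at *; simp [h]

lemma pl_closed (v : E n) : IsClosed (pl v) :=
  isClosed_eq (continuous_const.inner continuous_id) continuous_const

lemma pl_mono {A : Set (E n)} {v : E n} {b l : ℝ} (h : NN b A (pl v)) (h0 : 0 ∈ A) (hb : 0 < b)
    (hl : 0 < l) (hl1 : l ≤ 1) : NN (2 * b / l) (sc A 0 l) (pl v) := by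
  have hbl : 0 < b / l := by positivity
  have e : 2 * b / l = b / l + b / l := by ring
  constructor
  · intro w hw hw1
    obtain ⟨p, hp, hp1, h'⟩ := h.1 (l • w) (by simpa [sc] using hw) (by
      rw [norm_smul, Real.norm_of_nonneg hl.le]; nlinarith [norm_nonneg w])
    have h2 : ‖w - l⁻¹ • p‖ < b / l := by
      have e3 : w - l⁻¹ • p = l⁻¹ • (l • w - p) := by rw [smul_sub, inv_smul_smul₀ hl.ne']
      rwa [e3, norm_smul, norm_inv, Real.norm_of_nonneg hl.le, inv_mul_lt_iff₀ hl,
        mul_div_cancel₀ _ hl.ne']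
    have h3 : ‖l⁻¹ • p‖ ≤ 1 + b / l := by linarith [norm_le_norm_add_norm_sub w (l⁻¹ • p)]
    refine ⟨(1 + b / l)⁻¹ • l⁻¹ • p, pl_smul (pl_smul hp _) _, ?_, ?_⟩
    · rw [norm_smul, norm_inv, Real.norm_of_nonneg (by positivity), inv_mul_le_iff₀ (by positivity)]
      simpa using h3
    · have h4 : ‖l⁻¹ • p - (1 + b / l)⁻¹ • l⁻¹ • p‖ ≤ b / l := by
        have : l⁻¹ • p - (1 + b / l)⁻¹ • l⁻¹ • p = ((1 + b / l)⁻¹ * (b / l)) • l⁻¹ • p := by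
          generalize l⁻¹ • p = z
          match_scalars; field_simp; ring
        rw [this, norm_smul, Real.norm_of_nonneg (by positivity), mul_assoc,
          inv_mul_le_iff₀ (by positivity)]
        nlinarith
      rw [e]
      linarith [norm_sub_le_norm_sub_add_norm_sub w (l⁻¹ • p) ((1 + b / l)⁻¹ • l⁻¹ • p)]
  · intro w hw hw1
    rcases le_or_gt l b with hlb | hlb
    · refine ⟨0, by simpa [sc] using h0, by simp, ?_⟩
      have : 1 ≤ b / l := by rwa [le_div_iff₀ hl, one_mul]
      rw [sub_zero]; linarith
    · obtain ⟨a, ha, -, h'⟩ := h.2 ((l - b) • w) (pl_smul hw _) (by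
        rw [norm_smul, Real.norm_of_nonneg (by linarith)]; nlinarith [norm_nonneg w])
      have h1 : ‖(l - b) • w‖ ≤ l - b := by
        rw [norm_smul, Real.norm_of_nonneg (by linarith)]; nlinarith [norm_nonneg w]
      refine ⟨l⁻¹ • a, by simpa [sc, smul_inv_smul₀ hl.ne'] using ha, ?_, ?_⟩
      · rw [norm_smul, norm_inv, Real.norm_of_nonneg hl.le, inv_mul_le_iff₀ hl]
        linarith [norm_le_norm_add_norm_sub ((l - b) • w) a]
      · have e2 : w - l⁻¹ • a = l⁻¹ • (((l - b) • w - a) + b • w) := by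
          match_scalars <;> field_simp; ring
        have h5 : ‖b • w‖ ≤ b := by
          rw [norm_smul, Real.norm_of_nonneg hb.le]; nlinarith [norm_nonneg w]
        rw [e2, norm_smul, norm_inv, Real.norm_of_nonneg hl.le, inv_mul_lt_iff₀ hl,
          mul_div_cancel₀ _ hl.ne']
        linarith [norm_add_le ((l - b) • w - a) (b • w)]

end
end

section

section
variable {n : ℕ} (hn : 4 ≤ n)

def qd (w : E n) : ℝ := (w ⟨3, by omega⟩) ^ 2 -
  ((w ⟨0, by omega⟩) ^ 2 + (w ⟨1, by omega⟩) ^ 2 + (w ⟨2, by omega⟩) ^ 2)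

def Jd (y : E n) : E n := y ⟨3, by omega⟩ • EuclideanSpace.single ⟨3, by omega⟩ (1 : ℝ) -
  (y ⟨0, by omega⟩ • EuclideanSpace.single ⟨0, by omega⟩ (1 : ℝ) +
   y ⟨1, by omega⟩ • EuclideanSpace.single ⟨1, by omega⟩ (1 : ℝ) +
   y ⟨2, by omega⟩ • EuclideanSpace.single ⟨2, by omega⟩ (1 : ℝ))

def KK (y : E n) : Set (E n) := {w | qd hn (w - y) = 0}

lemma qd_cont : Continuous (qd hn) := by unfold qd; fun_prop

lemma KK_closed (y : E n) : IsClosed (KK hn y) :=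
  isClosed_eq ((qd_cont hn).comp (continuous_id.sub continuous_const)) continuous_const

lemma qd_exp (a : ℝ) (w y : E n) :
    qd hn (a • w - y) = a ^ 2 * qd hn w - 2 * a * ⟪Jd hn y, w⟫ + qd hn y := by
  simp only [qd, Jd, inner_sub_left, inner_add_left, inner_smul_left, EuclideanSpace.inner_single_left]
  simp
  ring

lemma qd_smul (a : ℝ) (w : E n) : qd hn (a • w) = a ^ 2 * qd hn w := by
  simp [qd]; ring

lemma KK_cone {v : E n} (h : v ∈ KK hn 0) (t : ℝ) : t • v ∈ KK hn 0 := by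
  simp only [KK, mem_ofPred_eq, sub_zero, qd_smul] at *; simp [h]

lemma kp_form {y : E n} {H : Set (E n)} :
    IsKPCone hn y H ↔ ∃ f : E n ≃ₗᵢ[ℝ] E n, H = f ⁻¹' KK hn (f y) := by
  have e : ∀ z : E n, z ∈ stdKP n hn ↔ qd hn z = 0 := fun z => by
    simp only [stdKP, qd, mem_ofPred_eq, sub_eq_zero]
  refine exists_congr fun f => ⟨fun h => ?_, fun h => ?_⟩
  · ext z
    have := Set.ext_iff.1 h (z - y)
    simpa [e, KK] using this
  · subst h
    ext z
    simp [e, KK]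

lemma kp_closed {y : E n} {H : Set (E n)} (h : IsKPCone hn y H) : IsClosed H := by
  obtain ⟨f, rfl⟩ := (kp_form hn).1 h
  exact (KK_closed hn _).preimage f.continuous

lemma kp_sc {y : E n} {H : Set (E n)} (h : IsKPCone hn y H) (x : E n) {r : ℝ} (hr : r ≠ 0) :
    IsKPCone hn (r⁻¹ • (y - x)) (sc H x r) := by
  obtain ⟨f, rfl⟩ := (kp_form hn).1 h
  refine (kp_form hn).2 ⟨f, ?_⟩
  ext z
  have : f (x + r • z) - f y = r • (f z - f (r⁻¹ • (y - x))) := by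
    simp only [map_add, map_sub, map_smul, smul_sub, smul_inv_smul₀ hr]; abel
  simp only [sc, mem_preimage, KK, mem_ofPred_eq, this, qd_smul]
  simp [hr]

set_option maxHeartbeats 1000000 in
lemma AP_KK {y : E n} (h0 : (0 : E n) ∈ KK hn y) : AP (KK hn y) := by
  intro h hh hh1 ε hε
  by_contra hc
  push Not at hc
  have h1 : ‖h‖ = 1 := le_antisymm hh1 (hc h hh |>.mt (by simpa using hε) |> not_lt.1)
  have hy : qd hn y = 0 := by
    have h0 : qd hn (0 - y) = 0 := h0
    simpa [qd] using h0
  have hu : qd hn (h - y) = 0 := hh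
  have hmin : IsLocalExtrOn (fun x : E n => ‖x‖ ^ 2) {x | qd hn (x - y) = qd hn (h - y)} h := by
    left
    filter_upwards [self_mem_nhdsWithin, mem_nhdsWithin_of_mem_nhds (ball_mem_nhds h hε)] with x hx hb
    rw [mem_ball, dist_eq_norm] at hb
    have : 1 ≤ ‖x‖ := by
      by_contra h2
      exact absurd hb (not_lt.2 (hc x (by rw [KK, mem_ofPred_eq, ← hu]; exact hx) (not_le.1 h2)))
    simp only [h1]
    nlinarith
  have hp : ∀ i : Fin n, HasStrictFDerivAt (fun x : E n => (x i - y i) ^ 2)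
      ((2 * (h i - y i)) • (EuclideanSpace.proj i : E n →L[ℝ] ℝ)) h := fun i => by
    have := ((EuclideanSpace.proj i : E n →L[ℝ] ℝ).hasStrictFDerivAt (x := h)).sub_const (y i) |>.pow 2
    simpa using this
  have hq : HasStrictFDerivAt (fun x : E n => qd hn (x - y)) _ h :=
    (hp ⟨3, by omega⟩).sub (((hp ⟨0, by omega⟩).add (hp ⟨1, by omega⟩)).add (hp ⟨2, by omega⟩))
  obtain ⟨a, b, hab, he⟩ := hmin.exists_multipliers_of_hasStrictFDerivAt_1d hq
    (hasStrictFDerivAt_norm_sq h)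
  have ht : ∀ i : Fin n, _ := fun i => DFunLike.congr_fun he (EuclideanSpace.single i 1)
  simp [PiLp.single_apply] at ht
  have t0 := ht ⟨0, by omega⟩
  have t1 := ht ⟨1, by omega⟩
  have t2 := ht ⟨2, by omega⟩
  have t3 := ht ⟨3, by omega⟩
  have hin : ∀ i, ⟪h, EuclideanSpace.single i (1 : ℝ)⟫ = h i := fun i => by
    rw [EuclideanSpace.inner_single_right]; simp
  simp [hin] at t0 t1 t2 t3
  simp only [qd, PiLp.sub_apply] at hu hy
  rcases eq_or_ne b 0 with rfl | hb
  · have ha : a ≠ 0 := fun h => hab (by simp [h])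
    simp [ha] at t0 t1 t2 t3
    have hl : ∀ t : ℝ, (1 - t) • h ∈ KK hn y := fun t => by
      simp only [KK, mem_ofPred_eq, qd, PiLp.sub_apply, PiLp.smul_apply, smul_eq_mul]
      rw [sub_eq_zero] at t0 t1 t2 t3
      rw [t0, t1, t2, t3]
      linear_combination t ^ 2 * hy
    have ht' : 0 < min (1 / 2) (ε / 2) := by positivity
    have h3 := min_le_left (1 / 2) (ε / 2)
    have h4 := min_le_right (1 / 2) (ε / 2)
    have := hc _ (hl (min (1 / 2) (ε / 2))) (by
      rw [norm_smul, h1, Real.norm_of_nonneg (by linarith)]; linarith)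
    rw [sub_smul, one_smul, sub_sub_cancel_left, norm_neg, norm_smul, Real.norm_of_nonneg ht'.le, h1] at this
    linarith
  · have hz : a * (h ⟨3, by omega⟩ - y ⟨3, by omega⟩) = 0 := by
      set u0 := h ⟨0, by omega⟩ - y ⟨0, by omega⟩ with hu0
      set u1 := h ⟨1, by omega⟩ - y ⟨1, by omega⟩ with hu1
      set u2 := h ⟨2, by omega⟩ - y ⟨2, by omega⟩ with hu2
      set u3 := h ⟨3, by omega⟩ - y ⟨3, by omega⟩ with hu3
      have y0 : b * y ⟨0, by omega⟩ = (a - b) * u0 := by rw [hu0] at *; linarith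
      have y1 : b * y ⟨1, by omega⟩ = (a - b) * u1 := by rw [hu1] at *; linarith
      have y2 : b * y ⟨2, by omega⟩ = (a - b) * u2 := by rw [hu2] at *; linarith
      have y3 : b * y ⟨3, by omega⟩ = -(a + b) * u3 := by rw [hu3] at *; linarith
      have e : b * (a * u3 ^ 2) = 0 := by
        have e4 : (b * y ⟨3, by omega⟩) ^ 2 - ((b * y ⟨0, by omega⟩) ^ 2 + (b * y ⟨1, by omega⟩) ^ 2 +
          (b * y ⟨2, by omega⟩) ^ 2) = 0 := by linear_combination b ^ 2 * hy
        rw [y0, y1, y2, y3] at e4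
        linear_combination e4 / 4 - (a - b) ^ 2 / 4 * hu
      rcases mul_eq_zero.1 ((mul_eq_zero.1 e).resolve_left hb) with h | h
      · rw [h, zero_mul]
      · rw [pow_eq_zero_iff two_ne_zero] at h; rw [h, mul_zero]
    have hs : (a * (h ⟨0, by omega⟩ - y ⟨0, by omega⟩)) ^ 2 + (a * (h ⟨1, by omega⟩ - y ⟨1, by omega⟩)) ^ 2 +
        (a * (h ⟨2, by omega⟩ - y ⟨2, by omega⟩)) ^ 2 = 0 := by
      linear_combination (a * (h ⟨3, by omega⟩ - y ⟨3, by omega⟩)) * hz - a ^ 2 * hu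
    obtain ⟨z0, z1, z2⟩ : a * (h ⟨0, by omega⟩ - y ⟨0, by omega⟩) = 0 ∧
        a * (h ⟨1, by omega⟩ - y ⟨1, by omega⟩) = 0 ∧ a * (h ⟨2, by omega⟩ - y ⟨2, by omega⟩) = 0 := by
      have : ∀ p q r : ℝ, p ^ 2 + q ^ 2 + r ^ 2 = 0 → p = 0 ∧ q = 0 ∧ r = 0 := fun p q r h =>
        ⟨by nlinarith, by nlinarith, by nlinarith⟩
      exact this _ _ _ hs
    have : h = 0 := by
      ext i
      have := ht i
      rw [hin] at this
      simp only [PiLp.zero_apply]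
      refine (mul_eq_zero.1 (?_ : b * h i = 0)).resolve_left hb
      split_ifs at this <;> linarith
    simp [this] at h1

lemma AP_kp {y : E n} {H : Set (E n)} (h : IsKPCone hn y H) (h0 : (0 : E n) ∈ H) : AP H := by
  obtain ⟨f, rfl⟩ := (kp_form hn).1 h
  intro v hv hv1 ε hε
  obtain ⟨w, hw, hw1, hw2⟩ := AP_KK hn (by simpa using h0) (f v) hv (by simpa using hv1) ε hε
  refine ⟨f.symm w, by simpa using hw, by simpa using hw1, ?_⟩
  rwa [← f.norm_map, map_sub, f.apply_symm_apply]

lemma zoom_in {y : E n} (hy : qd hn y = 0) (hJ : Jd hn y ≠ 0) {δ : ℝ} (hδ : 0 < δ) :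
    ∃ l : ℝ, 0 < l ∧ l ≤ 1 ∧ NN δ (sc (KK hn y) 0 l) (pl (Jd hn y)) := by
  have mem : ∀ {l : ℝ}, 0 < l → ∀ w : E n, w ∈ sc (KK hn y) 0 l ↔ l * qd hn w = 2 * ⟪Jd hn y, w⟫ := by
    intro l hl w
    simp only [sc, KK, mem_ofPred_eq, zero_add, qd_exp, hy, add_zero]
    constructor
    · intro h; apply mul_left_cancel₀ hl.ne'; linarith
    · intro h; linear_combination l * h
  let a : ℕ → ℝ := fun j => 1 / ((j : ℝ) + 1)
  have ha : ∀ j, 0 < a j := fun j => by positivity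
  have ha0 : Tendsto a (hyperfilter ℕ : Filter ℕ) (𝓝 0) :=
    tendsto_one_div_add_atTop_nhds_zero_nat.mono_left Nat.hyperfilter_le_atTop
  have hK : Kur (fun j => sc (KK hn y) 0 (a j)) (pl (Jd hn y)) := by
    refine ⟨fun z hz z0 h => ?_, fun z0 hz ε hε => ?_⟩
    · have e1 : Tendsto (fun j => a j * qd hn (z j)) (hyperfilter ℕ : Filter ℕ) (𝓝 (0 * qd hn z0)) :=
        ha0.mul (((qd_cont hn).tendsto z0).comp h)
      have e2 : Tendsto (fun j => 2 * ⟪Jd hn y, z j⟫) (hyperfilter ℕ : Filter ℕ)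
        (𝓝 (2 * ⟪Jd hn y, z0⟫)) := (tendsto_const_nhds.inner h).const_mul 2
      have := tendsto_nhds_unique (e1.congr' (hz.mono fun j hj => (mem (ha j) _).1 hj)) e2
      simp only [pl, mem_ofPred_eq]; linarith
    · have hv : 0 < ‖Jd hn y‖ := norm_pos_iff.2 hJ
      set v := Jd hn y with hvd
      let η := ε / (2 * ‖v‖)
      have hη : 0 < η := by positivity
      have e1 : ∀ w : E n, ∀ᶠ j in (hyperfilter ℕ : Filter ℕ), |a j * qd hn w| < 2 * (η * ‖v‖ ^ 2) := by
        intro w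
        have := (ha0.mul_const (qd hn w)).abs
        rw [zero_mul, abs_zero] at this
        exact this.eventually (gt_mem_nhds (by positivity))
      filter_upwards [e1 (z0 + η • v), e1 (z0 + (-η) • v)] with j h1 h2
      have hin : ∀ s : ℝ, ⟪v, z0 + s • v⟫ = s * ‖v‖ ^ 2 := fun s => by
        rw [inner_add_right, inner_smul_right, real_inner_self_eq_norm_sq, show ⟪v, z0⟫ = 0 from hz,
          zero_add]
      have hcont : Continuous fun s : ℝ => a j * qd hn (z0 + s • v) - 2 * (s * ‖v‖ ^ 2) := by
        have := qd_cont hn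
        fun_prop
      obtain ⟨s, hs, hs0⟩ := intermediate_value_Icc' (by linarith : -η ≤ η) hcont.continuousOn
        (show (0 : ℝ) ∈ Icc _ _ from ⟨by linarith [(abs_lt.1 h1).2], by linarith [(abs_lt.1 h2).1]⟩)
      refine ⟨z0 + s • v, (mem (ha j) _).2 (by rw [hin]; linarith), ?_⟩
      rw [add_sub_cancel_left, norm_smul]
      calc ‖s‖ * ‖v‖ ≤ η * ‖v‖ := by gcongr; exact abs_le.2 hs
        _ = ε / 2 := by simp only [η]; field_simp
        _ < ε := by linarith
  obtain ⟨j, hj⟩ := (DC hK (pl_closed _) (AP_cone fun v hv t => pl_smul hv t) hδ).exists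
  exact ⟨a j, ha j, (div_le_one (by positivity)).2 (by linarith [Nat.cast_nonneg (α := ℝ) j]), hj⟩

lemma zoom_out (y : E n) {δ : ℝ} (hδ : 0 < δ) :
    ∃ l : ℝ, 2 ≤ l ∧ NN δ (sc (KK hn y) 0 l) (KK hn 0) := by
  let a : ℕ → ℝ := fun j => 1 / ((j : ℝ) + 1)
  have ha : ∀ j, 0 < a j := fun j => by positivity
  have ha0 : Tendsto a (hyperfilter ℕ : Filter ℕ) (𝓝 0) :=
    tendsto_one_div_add_atTop_nhds_zero_nat.mono_left Nat.hyperfilter_le_atTop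
  have mem : ∀ j (w : E n), w ∈ sc (KK hn y) 0 (2 * (a j)⁻¹) ↔ qd hn (w - (a j / 2) • y) = 0 := by
    intro j w
    have e : (2 * (a j)⁻¹) • w - y = (2 * (a j)⁻¹) • (w - (a j / 2) • y) := by
      have := (ha j).ne'
      match_scalars <;> field_simp
    simp only [sc, KK, mem_ofPred_eq, zero_add, e, qd_smul]
    simp [(ha j).ne']
  have hs : Tendsto (fun j => (a j / 2) • y) (hyperfilter ℕ : Filter ℕ) (𝓝 0) := by
    simpa using (ha0.div_const 2).smul_const y
  have hK : Kur (fun j => sc (KK hn y) 0 (2 * (a j)⁻¹)) (KK hn 0) := by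
    refine ⟨fun z hz z0 h => ?_, fun z0 hz ε hε => ?_⟩
    · have e1 := ((qd_cont hn).tendsto (z0 - 0)).comp (h.sub hs)
      exact (tendsto_nhds_unique (tendsto_const_nhds.congr' (hz.mono fun j hj =>
        ((mem j _).1 hj).symm)) e1).symm
    · have := hs.norm
      rw [norm_zero] at this
      filter_upwards [this.eventually (gt_mem_nhds hε)] with j hj
      refine ⟨z0 + (a j / 2) • y, (mem j _).2 ?_, by rwa [add_sub_cancel_left]⟩
      have hz : qd hn (z0 - 0) = 0 := hz
      rwa [add_sub_cancel_right, ← sub_zero z0]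
  obtain ⟨j, hj⟩ := (DC hK (KK_closed hn _) (AP_cone fun v hv t => KK_cone hn hv t) hδ).exists
  refine ⟨_, ?_, hj⟩
  simp only [a, one_div, inv_inv]; linarith [Nat.cast_nonneg (α := ℝ) j]

lemma gap (v : E n) (hv : v ≠ 0) : ¬ nr (1 / (4 * n)) (KK hn 0) (pl v) := by
  intro h
  have hn0 : (4 : ℝ) ≤ n := by exact_mod_cast hn
  have hv0 : 0 < ‖v‖ := norm_pos_iff.2 hv
  have key : ∀ w : E n, qd hn w = 0 → ‖w‖ ≤ 1 → |⟪v, w⟫| ≤ ‖v‖ * (1 / (4 * n)) := by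
    intro w hw hw1
    obtain ⟨z, hz, -, h'⟩ := h w (by simpa [KK] using hw) hw1
    have : ⟪v, w⟫ = ⟪v, w - z⟫ := by rw [inner_sub_right, show ⟪v, z⟫ = 0 from hz, sub_zero]
    rw [this]
    exact (abs_real_inner_le_norm _ _).trans (by gcongr)
  have nb : ∀ (i j : Fin n) (s : ℝ), |s| ≤ 1 / 2 →
      ‖(1 / 2 : ℝ) • EuclideanSpace.single i (1 : ℝ) + s • EuclideanSpace.single j (1 : ℝ)‖ ≤ 1 := by
    intro i j s hs
    refine (norm_add_le _ _).trans ?_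
    rw [norm_smul, norm_smul]
    simp only [PiLp.norm_single, norm_one, mul_one, Real.norm_eq_abs]
    norm_num; linarith
  have hc : ∀ k : Fin n, |v k| ≤ ‖v‖ * (1 / (2 * n)) := by
    have tst : ∀ (j : Fin n), j.1 < 3 → ∀ s : ℝ, s ^ 2 = 1 / 4 →
        |v ⟨3, by omega⟩ / 2 + s * v j| ≤ ‖v‖ * (1 / (4 * n)) := by
      intro j hj s hs
      have := key ((1 / 2 : ℝ) • EuclideanSpace.single ⟨3, by omega⟩ (1 : ℝ) +
        s • EuclideanSpace.single j (1 : ℝ)) ?_ (nb _ _ _ ?_)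
      · convert this using 2
        simp only [inner_add_right, inner_smul_right, EuclideanSpace.inner_single_right]
        simp; ring
      · obtain ⟨j, hj'⟩ := j
        simp only at hj
        interval_cases j <;> simp [qd] <;> linarith
      · rw [← sq_le_sq₀ (abs_nonneg _) (by norm_num), sq_abs, hs]; norm_num
    have e : ‖v‖ * (1 / (2 * n)) = 2 * (‖v‖ * (1 / (4 * n))) := by field_simp; norm_num
    intro k
    rw [e]
    rcases lt_trichotomy k.1 3 with hk | hk | hk
    · have h1 := abs_le.1 (tst k hk (1 / 2) (by norm_num))
      have h2 := abs_le.1 (tst k hk (-1 / 2) (by norm_num))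
      exact abs_le.2 ⟨by linarith, by linarith⟩
    · have h1 := abs_le.1 (tst ⟨0, by omega⟩ (by simp) (1 / 2) (by norm_num))
      have h2 := abs_le.1 (tst ⟨0, by omega⟩ (by simp) (-1 / 2) (by norm_num))
      rw [show k = ⟨3, by omega⟩ from Fin.ext hk]
      exact abs_le.2 ⟨by linarith, by linarith⟩
    · have := key (EuclideanSpace.single k 1) ?_ (by simp)
      · simp only [EuclideanSpace.inner_single_right] at this
        simp at this
        have h3 : 0 ≤ ‖v‖ * (1 / (4 * n)) := by positivity
        simp only [one_div, mul_inv] at h3 ⊢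
        linarith
      · have : ∀ i : Fin n, i.1 ≤ 3 → (EuclideanSpace.single k (1 : ℝ) : E n) i = 0 := fun i hi => by
          rw [PiLp.single_apply, if_neg (fun h => by subst h; omega)]
        rw [qd, this _ le_rfl, this _ (by simp), this _ (by simp), this _ (by simp)]; norm_num
  have h1 : ‖v‖ ^ 2 ≤ ∑ _k : Fin n, (‖v‖ * (1 / (2 * n))) ^ 2 := by
    rw [EuclideanSpace.norm_sq_eq]
    refine Finset.sum_le_sum fun k _ => ?_
    rw [Real.norm_eq_abs]
    gcongr
    exact hc k
  simp only [Finset.sum_const, Finset.card_univ, Fintype.card_fin, nsmul_eq_mul] at h1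
  have e : n * (‖v‖ * (1 / (2 * n))) ^ 2 = ‖v‖ ^ 2 / (4 * n) := by field_simp; norm_num
  rw [e, le_div_iff₀ (by positivity)] at h1
  nlinarith [sq_pos_of_pos hv0]

end
end

section

section
variable {k : ℕ}

lemma bddD {ι : Type*} {n : ℕ} {x : E n} {r : ℝ} (hr : 0 < r) (S : Set (E n)) (C : ι → Set (E n)) :
    BddBelow (range fun i => Dxr x r S (C i)) :=
  ⟨0, by rintro _ ⟨i, rfl⟩; exact Dxr_nonneg hr _ _⟩

lemma thetaP_le {S : Set (E (k + 4))} {x v : E (k + 4)} {r ε : ℝ} (hr : 0 < r) (hε : 0 < ε) (hv : v ≠ 0)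
    (h : NN ε (sc S x r) (pl v)) : thetaP (k + 3) S x r ≤ ε := by
  have hf : Fact (finrank ℝ (E (k + 4)) = k + 3 + 1) := ⟨by simp⟩
  let L := AffineSubspace.mk' x (Submodule.span ℝ {v})ᗮ
  have hL : sc (L : Set (E (k + 4))) x r = pl v := by
    ext w
    simp only [sc, pl, mem_ofPred_eq, L, SetLike.mem_coe, AffineSubspace.mem_mk', vsub_eq_sub,
      add_sub_cancel_left, Submodule.mem_orthogonal_singleton_iff_inner_right, inner_smul_right]
    simp [hr.ne']
  exact (ciInf_le (bddD hr S _) ⟨L, AffineSubspace.self_mem_mk' _ _, by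
    rw [AffineSubspace.direction_mk']
    exact Submodule.finrank_orthogonal_span_singleton hv⟩).trans (Dxr_le hr hε (by rwa [hL]))

lemma sc_inv {n : ℕ} (H : Set (E n)) (x : E n) {r : ℝ} (hr : r ≠ 0) :
    sc (sc H (-(r⁻¹ • x)) r⁻¹) x r = H := by
  ext w; simp [sc, hr, smul_smul]

lemma varthetaC_le {n : ℕ} (hn : 4 ≤ n) {S H : Set (E n)} {x y : E n} {r ε : ℝ} (hr : 0 < r) (hε : 0 < ε)
    (hH : IsKPCone hn y H) (h0 : (0 : E n) ∈ H) (h : NN ε (sc S x r) H) : varthetaC hn S x r ≤ ε :=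
  (ciInf_le (bddD hr S _) ⟨sc H (-(r⁻¹ • x)) r⁻¹, ⟨_, kp_sc hn hH _ (inv_ne_zero hr.ne')⟩, by
    simpa [sc] using h0⟩).trans (Dxr_le hr hε (by rwa [sc_inv H x hr.ne']))

lemma thetaC_le {n : ℕ} (hn : 4 ≤ n) {S H : Set (E n)} {x : E n} {r ε : ℝ} (hr : 0 < r) (hε : 0 < ε)
    (hH : IsKPCone hn 0 H) (h : NN ε (sc S x r) H) : thetaC hn S x r ≤ ε :=
  (ciInf_le (bddD hr S _) ⟨sc H (-(r⁻¹ • x)) r⁻¹, by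
    have := kp_sc hn hH (-(r⁻¹ • x)) (inv_ne_zero hr.ne')
    rwa [zero_sub, neg_neg, smul_smul, inv_inv, mul_inv_cancel₀ hr.ne', one_smul] at this⟩).trans
    (Dxr_le hr hε (by rwa [sc_inv H x hr.ne']))

lemma blow {μ : Measure (E (k + 4))} [IsLocallyFiniteMeasure μ] (hA : AOD (k + 3) μ)
    {K : Set (E (k + 4))} (hK : K ⊆ msupp μ) (hKc : IsCompact K) {x : ℕ → E (k + 4)} (hx : ∀ j, x j ∈ K)
    {r : ℕ → ℝ} (hr : ∀ j, 0 < r j) (hr1 : ∀ j, r j ≤ 1 / ((j : ℝ) + 1)) :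
    (∃ v : E (k + 4), v ≠ 0 ∧ Kur (fun j => sc (msupp μ) (x j) (r j)) (pl v)) ∨
    ∃ y H, IsKPCone (n := k + 4) (by omega) y H ∧ (0 : E (k + 4)) ∈ H ∧
      Kur (fun j => sc (msupp μ) (x j) (r j)) H := by
  have hr0 : Tendsto r (hyperfilter ℕ : Filter ℕ) (𝓝 0) :=
    (squeeze_zero (fun j => (hr j).le) hr1 tendsto_one_div_add_atTop_nhds_zero_nat).mono_left
      Nat.hyperfilter_le_atTop
  obtain ⟨ν, hν, hA1, hB1⟩ := BLOW hA hK hKc (hyperfilter ℕ) hx hr hr0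
  have h0 : (0 : E (k + 4)) ∈ msupp ν :=
    hA1 (fun _ => 0) (fun j => by simpa using hK (hx j)) 0 tendsto_const_nhds
  have hKur : Kur (fun j => sc (msupp μ) (x j) (r j)) (msupp ν) := by
    refine ⟨fun y hy y0 h => ?_, fun y0 hy0 ε hε => ?_⟩
    · classical
      refine hA1 (fun j => if y j ∈ sc (msupp μ) (x j) (r j) then y j else 0) (fun j => ?_) y0
        (h.congr' (hy.mono fun j hj => (if_pos hj).symm))
      split_ifs with hj
      · exact hj
      · simpa using hK (hx j)
    · obtain ⟨y, hy, hy1⟩ := hB1 y0 hy0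
      filter_upwards [hy1.eventually (ball_mem_nhds y0 hε)] with j hj
      exact ⟨y j, hy j, by rwa [dist_eq_norm] at hj⟩
  rcases CLASS hν h0 with ⟨v, hv, he⟩ | ⟨y, hy⟩
  · exact Or.inl ⟨v, hv, by rwa [he] at hKur⟩
  · exact Or.inr ⟨y, _, hy, h0, hKur⟩

lemma sc_pre {n : ℕ} (f : E n ≃ₗᵢ[ℝ] E n) (H : Set (E n)) (l : ℝ) :
    sc (f ⁻¹' H) 0 l = f ⁻¹' (sc H 0 l) := by
  ext w; simp [sc]

lemma pl_pre {n : ℕ} (f : E n ≃ₗᵢ[ℝ] E n) (v : E n) : f ⁻¹' pl v = pl (f.symm v) := by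
  ext w; simp only [pl, mem_preimage, mem_ofPred_eq]
  rw [← f.symm.inner_map_map, f.symm_apply_apply]

lemma tp {n : ℕ} (hn : 4 ≤ n) {v : E n} (hv : v ≠ 0) {δ : ℝ} (hδ : 0 < δ) :
    ∃ y H, IsKPCone hn y H ∧ (0 : E n) ∈ H ∧ NN δ H (pl v) := by
  let y : E n := EuclideanSpace.single ⟨3, by omega⟩ 1 + EuclideanSpace.single ⟨0, by omega⟩ 1
  have hy : qd hn y = 0 := by simp [qd, y]
  have hJ : Jd hn y ≠ 0 := fun h => by
    have := congrArg (fun z : E n => z ⟨3, by omega⟩) h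
    simp [Jd, y] at this
  have hv0 : 0 < ‖v‖ := norm_pos_iff.2 hv
  let a : E n := (‖Jd hn y‖ / ‖v‖) • v
  have ha : ‖a‖ = ‖Jd hn y‖ := by
    rw [norm_smul, Real.norm_of_nonneg (by positivity), div_mul_cancel₀ _ hv0.ne']
  let f : E n ≃ₗᵢ[ℝ] E n := (Submodule.span ℝ {a - Jd hn y})ᗮ.reflection
  have hf : f a = Jd hn y := Submodule.reflection_sub ha
  obtain ⟨l, hl, -, hN⟩ := zoom_in hn hy hJ hδ
  have h2 := hN.pre f
  have e : f ⁻¹' pl (Jd hn y) = pl v := by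
    rw [pl_pre, ← hf, f.symm_apply_apply]
    ext w
    simp only [pl, mem_ofPred_eq, a, inner_smul_left]
    simp [hv, hJ]
  rw [e, ← sc_pre] at h2
  have hk : IsKPCone hn (f.symm y) (f ⁻¹' KK hn y) := (kp_form hn).2 ⟨f, by rw [f.apply_symm_apply]⟩
  refine ⟨_, _, kp_sc hn hk 0 hl.ne', ?_, h2⟩
  have h3 : qd hn (-y) = 0 := by simpa [qd] using hy
  simpa [sc, KK] using h3

lemma part1 {μ : Measure (E (k + 4))} [IsLocallyFiniteMeasure μ] (hA : AOD (k + 3) μ) (hn : 4 ≤ k + 4)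
    {K : Set (E (k + 4))} (hK : K ⊆ msupp μ) (hKc : IsCompact K) {ε : ℝ} (hε : 0 < ε) :
    ∃ r₀ : ℝ, 0 < r₀ ∧ ∀ x ∈ K, ∀ r : ℝ, 0 < r → r ≤ r₀ → varthetaC hn (msupp μ) x r < ε := by
  by_contra hc
  push Not at hc
  choose x hx r hr hr1 hh using fun j : ℕ => hc (1 / ((j : ℝ) + 1)) (by positivity)
  rcases blow hA hK hKc hx hr hr1 with ⟨v, hv, hKu⟩ | ⟨y, H, hH, h0, hKu⟩
  · obtain ⟨y, H, hH, h0, hN⟩ := tp hn hv (δ := ε / 4) (by positivity)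
    obtain ⟨j, hj⟩ := (DC hKu (pl_closed _) (AP_cone fun v hv t => pl_smul hv t)
      (ε := ε / 4) (by positivity)).exists
    have := varthetaC_le hn (hr j) (by positivity) hH h0 (hj.trans ⟨hN.2, hN.1⟩)
    linarith [hh j]
  · obtain ⟨j, hj⟩ := (DC hKu (kp_closed hn hH) (AP_kp hn hH h0) (ε := ε / 2) (by positivity)).exists
    have := varthetaC_le hn (hr j) (by positivity) hH h0 hj
    linarith [hh j]

def Pl {n : ℕ} (S : Set (E n)) (x : E n) (δ r : ℝ) : Prop := ∃ v : E n, v ≠ 0 ∧ NN δ (sc S x r) (pl v)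

/-- Zooming in at bad scales gives flat scales. -/
lemma flat_scales {μ : Measure (E (k + 4))} [IsLocallyFiniteMeasure μ] (hA : AOD (k + 3) μ) (hn : 4 ≤ k + 4)
    {x : E (k + 4)} (hx : x ∈ msupp μ) {ε : ℝ} (hε : 0 < ε) {r : ℕ → ℝ} (hr : ∀ j, 0 < r j)
    (hr1 : ∀ j, r j ≤ 1 / ((j : ℝ) + 1)) (hb : ∀ j, ε ≤ thetaC hn (msupp μ) x (r j)) {δ : ℝ} (hδ : 0 < δ)
    {ρ : ℝ} (hρ : 0 < ρ) : ∃ s, 0 < s ∧ s ≤ ρ ∧ Pl (msupp μ) x δ s := by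
  have hlt : ∀ᶠ j in (hyperfilter ℕ : Filter ℕ), r j < ρ :=
    ((squeeze_zero (fun j => (hr j).le) hr1 tendsto_one_div_add_atTop_nhds_zero_nat).mono_left
      Nat.hyperfilter_le_atTop).eventually (gt_mem_nhds hρ)
  rcases blow hA (singleton_subset_iff.2 hx) isCompact_singleton (fun _ => mem_singleton x) hr hr1 with
    ⟨v, hv, hKu⟩ | ⟨y, H, hH, h0, hKu⟩
  · obtain ⟨j, hj, h2⟩ := ((DC hKu (pl_closed _) (AP_cone fun v hv t => pl_smul hv t) hδ).and hlt).exists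
    exact ⟨r j, hr j, h2.le, v, hv, hj⟩
  · obtain ⟨f, hf⟩ := (kp_form hn).1 hH
    have hq : qd hn (f y) = 0 := by
      have : qd hn (-(f y)) = 0 := by simpa [hf, KK] using h0
      simpa [qd] using this
    by_cases hJ : Jd hn (f y) = 0
    · exfalso
      have h1 : IsKPCone hn 0 H := (kp_form hn).2 ⟨f, by
        rw [hf]
        ext w
        simp only [mem_preimage, KK, mem_ofPred_eq, map_zero, sub_zero]
        have := qd_exp hn 1 (f w) (f y)
        rw [one_smul, hq, hJ, inner_zero_left] at this
        rw [this]; simp⟩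
      obtain ⟨j, hj⟩ := (DC hKu (kp_closed hn hH) (AP_kp hn hH h0) (ε := ε / 2) (by positivity)).exists
      linarith [hb j, thetaC_le hn (hr j) (by positivity) h1 hj]
    · obtain ⟨l, hl, hl1, hN⟩ := zoom_in hn hq hJ (half_pos hδ)
      have h2 := hN.pre f
      rw [pl_pre, ← sc_pre, ← hf] at h2
      have hk := kp_sc hn hH 0 hl.ne'
      obtain ⟨j, hj, h3⟩ := ((DC (hKu.scale hl) (kp_closed hn hk) (AP_kp hn hk (by simpa [sc] using h0))
        (half_pos hδ)).and hlt).exists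
      rw [sc_sc] at hj
      have := hr j
      refine ⟨l * r j, by positivity, by nlinarith, _, ?_, add_halves δ ▸ hj.trans h2⟩
      simpa using hJ

lemma part2 {μ : Measure (E (k + 4))} [IsLocallyFiniteMeasure μ] (hA : AOD (k + 3) μ) (hn : 4 ≤ k + 4)
    {x : E (k + 4)} (hx : x ∈ msupp μ)
    (hnf : ¬ Tendsto (fun r => thetaP (k + 3) (msupp μ) x r) (𝓝[>] 0) (𝓝 0)) :
    Tendsto (fun r => thetaC hn (msupp μ) x r) (𝓝[>] 0) (𝓝 0) := by
  have red : ∀ F : ℝ → ℝ, (∀ r, 0 < r → 0 ≤ F r) → ¬ Tendsto F (𝓝[>] 0) (𝓝 0) →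
      ∃ ε > 0, ∀ ρ > 0, ∃ r, 0 < r ∧ r ≤ ρ ∧ ε ≤ F r := by
    intro F hF hn
    by_contra hc
    push Not at hc
    refine hn (Metric.tendsto_nhds.2 fun ε hε => ?_)
    obtain ⟨ρ, hρ, h⟩ := hc ε hε
    filter_upwards [Ioc_mem_nhdsGT hρ] with r hr
    rw [Real.dist_eq, sub_zero, abs_of_nonneg (hF r hr.1)]
    exact h r hr.1 hr.2
  obtain ⟨δ0, hδ0, hP⟩ := red _ (fun r hr => Real.iInf_nonneg fun _ => Dxr_nonneg hr _ _) hnf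
  by_contra hC
  obtain ⟨ε, hε, hC⟩ := red _ (fun r hr => Real.iInf_nonneg fun _ => Dxr_nonneg hr _ _) hC
  choose r hr hr1 hb using fun j : ℕ => hC (1 / ((j : ℝ) + 1)) (by positivity)
  let c : ℝ := 1 / (4 * ((k + 4 : ℕ) : ℝ))
  have hc : 0 < c := by positivity
  let δ := min (δ0 / 2) (c / 2)
  have hδ : 0 < δ := by positivity
  have h1 : ∀ i : ℕ, ∃ t, 0 < t ∧ t ≤ 1 / ((i : ℝ) + 1) ∧ ¬ Pl (msupp μ) x δ t ∧
      ∀ M : ℝ, 2 ≤ M → M ≤ i + 1 → Pl (msupp μ) x δ (M * t) := by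
    intro i
    have hi : (0 : ℝ) < i + 1 := by positivity
    obtain ⟨s, hs, hs1, v, hv, hN⟩ := flat_scales hA hn hx hε hr hr1 hb (δ := δ / (2 * (i + 1)))
      (by positivity) (ρ := 1 / ((i : ℝ) + 1)) (by positivity)
    have hs2 : ∀ t, s / (i + 1) ≤ t → t ≤ s → Pl (msupp μ) x δ t := by
      intro t h1 h2
      have ht : 0 < t := lt_of_lt_of_le (by positivity) h1
      have h3 := pl_mono hN (by simpa [sc] using hx) (by positivity) (l := t / s) (by positivity)
        ((div_le_one hs).2 h2)
      rw [sc_sc, div_mul_cancel₀ _ hs.ne'] at h3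
      have h4 : 2 * (δ / (2 * ((i : ℝ) + 1))) / (t / s) ≤ δ := by
        rw [div_le_iff₀ hi] at h1
        rw [div_le_iff₀ (by positivity)]
        have : 2 * (δ / (2 * ((i : ℝ) + 1))) = δ / (i + 1) := by field_simp
        rw [this, div_le_iff₀ hi, mul_assoc]
        have : 1 ≤ t / s * (i + 1) := by rw [div_mul_eq_mul_div, le_div_iff₀ hs]; linarith
        nlinarith
      exact ⟨v, hv, h3.1.mono h4, h3.2.mono h4⟩
    let T : Set ℝ := {t | 0 < t ∧ t ≤ s ∧ ¬ Pl (msupp μ) x δ t}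
    have hT : T.Nonempty := by
      obtain ⟨t, h1, h2, h3⟩ := hP s hs
      refine ⟨t, h1, h2, ?_⟩
      rintro ⟨w, hw, hw1⟩
      have h4 : δ0 ≤ thetaP (k + 3) (msupp μ) x t := h3
      have h5 : δ ≤ δ0 / 2 := min_le_left _ _
      linarith [thetaP_le h1 hδ hw hw1]
    have hTb : BddAbove T := ⟨s, fun t ht => ht.2.1⟩
    have hpos : 0 < sSup T := by
      obtain ⟨t, ht⟩ := hT
      exact ht.1.trans_le (le_csSup hTb ht)
    obtain ⟨t, ht, ht2⟩ := exists_lt_of_lt_csSup hT (half_lt_self hpos)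
    refine ⟨t, ht.1, ht.2.1.trans hs1, ht.2.2, fun M hM hM1 => ?_⟩
    have ht3 : t < s / (i + 1) := by
      by_contra h
      exact ht.2.2 (hs2 t (not_lt.1 h) ht.2.1)
    rw [lt_div_iff₀ hi] at ht3
    by_contra h
    have := le_csSup hTb (show M * t ∈ T from ⟨by nlinarith [ht.1], by nlinarith [ht.1], h⟩)
    nlinarith [ht.1]
  choose t ht ht1 ht2 ht3 using h1
  rcases blow hA (singleton_subset_iff.2 hx) isCompact_singleton (fun _ => mem_singleton x) ht ht1 with
    ⟨v, hv, hKu⟩ | ⟨y, H, hH, h0, hKu⟩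
  · obtain ⟨j, hj⟩ := (DC hKu (pl_closed _) (AP_cone fun v hv t => pl_smul hv t) hδ).exists
    exact ht2 j ⟨v, hv, hj⟩
  · obtain ⟨f, hf⟩ := (kp_form hn).1 hH
    obtain ⟨l, hl, hN⟩ := zoom_out hn (f y) (δ := c / 4) (by positivity)
    have h2 := hN.pre f
    rw [← sc_pre, ← hf] at h2
    have hl0 : 0 < l := by linarith
    have hk := kp_sc hn hH 0 hl0.ne'
    have hbig : ∀ᶠ j : ℕ in (hyperfilter ℕ : Filter ℕ), l ≤ j + 1 :=
      Nat.hyperfilter_le_atTop ((eventually_ge_atTop ⌈l⌉₊).mono fun j hj => by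
        have := Nat.ceil_le.1 hj; linarith)
    obtain ⟨j, hj, h3⟩ := ((DC (hKu.scale hl0) (kp_closed hn hk) (AP_kp hn hk (by simpa [sc] using h0))
      (ε := c / 4) (by positivity)).and hbig).exists
    rw [sc_sc] at hj
    obtain ⟨v, hv, h4⟩ := ht3 j l hl h3
    have h5 := (h2.2.trans hj.2).trans h4.1
    have h6 : nr c (f ⁻¹' KK hn 0) (pl v) := h5.mono (by linarith [min_le_right (δ0 / 2) (c / 2)])
    refine gap hn (f v) (by simpa using hv) ?_
    intro w hw hw1
    obtain ⟨z, hz, hz1, hz2⟩ := h6 (f.symm w) (by simpa using hw) (by simpa using hw1)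
    refine ⟨f z, ?_, by simpa using hz1, ?_⟩
    · simp only [pl, mem_ofPred_eq] at hz ⊢
      rwa [f.inner_map_map]
    · rw [← f.symm.norm_map, map_sub, f.symm_apply_apply]; exact hz2

end
end

/-- Theorem 1.4 / Theorem 3.8 / `AODstructure`: the support of an
`(n−1)`-asymptotically optimally doubling measure is uniformly well approximated by KP cones
(containing the base point) on compact sets, and at a nonflat point the approximation can be
taken by KP cones based at the point. -/
theorem aod_structure {n : ℕ} (hn : 4 ≤ n) (μ : Measure (E n))
    (hRadon : IsLocallyFiniteMeasure μ) (hAOD : AOD (n - 1) μ) :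
    (∀ K : Set (E n), K ⊆ msupp μ → IsCompact K → ∀ ε : ℝ, 0 < ε →
      ∃ r₀ : ℝ, 0 < r₀ ∧ ∀ x ∈ K, ∀ r : ℝ, 0 < r → r ≤ r₀ →
        varthetaC hn (msupp μ) x r < ε) ∧
    (∀ x ∈ msupp μ,
      ¬ Tendsto (fun r : ℝ => thetaP (n - 1) (msupp μ) x r)
          (nhdsWithin 0 (Set.Ioi 0)) (nhds 0) →
      Tendsto (fun r : ℝ => thetaC hn (msupp μ) x r)
          (nhdsWithin 0 (Set.Ioi 0)) (nhds 0)) := by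
  obtain ⟨k, rfl⟩ := Nat.exists_eq_add_of_le' hn
  exact ⟨fun K hK hKc ε hε => part1 hAOD hn hK hKc hε, fun x hx h => part2 hAOD hn hx h⟩
end
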